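/- Let q be a prime power, m ≥ 3, n ∈ ℕ, f a non-exceptional rational function of degree sum n over F_{q^m}, a ∈ F_q, and let N(l_1, l_2, g) count α ∈ F_{q^m} with α l_1-free and g-free, f(α) l_2-free, and Tr_{F_{q^m}/F_q}(α^{−1}) = a. Then for any divisors l_1, l_2 of q^m − 1 and g of x^m − 1: N(l_1, l_2, g) ≥ (θ(l_1)θ(l_2)Θ(g)/q)·(q^m − (n+2)·q^{m/2 + 1}·W(l_1)·W(l_2)·W(g)), where θ(u) = φ(u)/u and Θ(g) = Φ_q(g)/q^{deg g}. In particular, if q^{m/2 − 1} > (n+2)·W(l_1)·W(l_2)·W(g) then N(l_1, l_2, g) > 0. -/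

import Mathlib

open Polynomial UniqueFactorizationMonoid Classical

/-- `w ∈ F_{q^m}ˣ` is `u`-free: `w ≠ 0` and `w = v ^ d` with `d` a positive divisor of `u`
implies `d = 1`. -/
def IsUFree {F : Type*} [Field F] (u : ℕ) (w : F) : Prop :=
  w ≠ 0 ∧ ∀ v : F, ∀ d : ℕ, 0 < d → d ∣ u → w = v ^ d → d = 1

/-- The `F_q[x]`-module action on `F_{q^m}`: `f ∘ α = ∑ aᵢ α^{q^i}`. -/
def polyAct {K F : Type*} [Field K] [Field F] [Algebra K F] (q : ℕ)
    (f : K[X]) (α : F) : F :=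
  f.sum fun i a => a • α ^ q ^ i

/-- `α` is `g`-free: `α = h ∘ β` with `h` a monic divisor of `g` implies `h = 1`. -/
def IsGFree {K F : Type*} [Field K] [Field F] [Algebra K F] (q : ℕ)
    (g : K[X]) (α : F) : Prop :=
  ∀ h : K[X], h.Monic → h ∣ g → (∃ β : F, α = polyAct q h β) → h = 1

/-- A rational function `f ∈ F(x)` is exceptional if `f = c·xⁱ·hᵈ` for some `d > 1` dividing
`|F| − 1`, or `f = xⁱ` with `gcd(|F| − 1, i) ≠ 1`. -/
def ExceptionalRatFunc {F : Type*} [Field F] [Fintype F] (f : RatFunc F) : Prop :=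
  (∃ (c : F) (i : ℤ) (h : RatFunc F) (d : ℕ), 1 < d ∧ d ∣ Fintype.card F - 1 ∧
      f = RatFunc.C c * RatFunc.X ^ i * h ^ d) ∨
  (∃ i : ℤ, f = RatFunc.X ^ i ∧ Nat.gcd (Fintype.card F - 1) i.natAbs ≠ 1)

/-- The counting function `N_{f,a,n}(l₁, l₂, g)`. -/
noncomputable def Ncount {K F : Type*} [Field K] [Field F] [Fintype F] [Algebra K F]
    (q : ℕ) (f : RatFunc F) (a : K) (l₁ l₂ : ℕ) (g : K[X]) : ℕ :=
  Nat.card {α : F // IsUFree l₁ α ∧ IsGFree q g α ∧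
    IsUFree l₂ (RatFunc.eval (RingHom.id F) α f) ∧ Algebra.trace K F α⁻¹ = a}

/-- The polynomial analogue `Φ_q(g)` of Euler's totient over `F_q[x]`. -/
noncomputable def polyTotient {K : Type*} [Field K] (g : K[X]) : ℕ :=
  Nat.card (K[X] ⧸ Ideal.span {g})ˣ

/-- Growth lemma: if the power sums grow at most like `R ^ r`, every `ω i` has modulus `≤ R`. -/
lemma growth_bound {ι : Type*} [Fintype ι] (ω : ι → ℂ) (R C : ℝ) (hR : 0 < R) (r0 : ℕ)
    (h : ∀ r ≥ r0, ‖∑ i, ω i ^ r‖ ≤ C * R ^ r) (i0 : ι) : ‖ω i0‖ ≤ R := by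
  by_contra hlt
  push Not at hlt
  set s : Finset ℂ := (Finset.univ.image ω).erase (ω i0) with hs
  set P : ℂ[X] := ∏ w ∈ s, (X - Polynomial.C w) with hP
  have hP0 : P.eval (ω i0) ≠ 0 := by
    rw [hP, eval_prod, Finset.prod_ne_zero_iff]
    intro w hw
    simp only [eval_sub, eval_X, eval_C]
    intro h0
    rw [hs, Finset.mem_erase] at hw
    exact hw.1 (sub_eq_zero.mp h0).symm
  have hPi : ∀ i, ω i ≠ ω i0 → P.eval (ω i) = 0 := by
    intro i hi
    rw [hP, eval_prod]
    apply Finset.prod_eq_zero (i := ω i)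
    · rw [hs, Finset.mem_erase]
      exact ⟨hi, Finset.mem_image_of_mem _ (Finset.mem_univ _)⟩
    · simp
  set m : ℕ := (Finset.univ.filter (fun i => ω i = ω i0)).card with hm
  have hm0 : 0 < m := Finset.card_pos.mpr ⟨i0, by simp⟩
  have key : ∀ r, ∑ k ∈ Finset.range (P.natDegree + 1), P.coeff k * ∑ i, ω i ^ (r + k)
      = m * ω i0 ^ r * P.eval (ω i0) := by
    intro r
    have : ∑ k ∈ Finset.range (P.natDegree + 1), P.coeff k * ∑ i, ω i ^ (r + k)
        = ∑ i, ω i ^ r * P.eval (ω i) := by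
      simp_rw [Finset.mul_sum]
      rw [Finset.sum_comm]
      refine Finset.sum_congr rfl fun i _ => ?_
      rw [eval_eq_sum_range, Finset.mul_sum]
      refine Finset.sum_congr rfl fun k _ => ?_
      rw [pow_add]; ring
    rw [this, ← Finset.sum_filter_add_sum_filter_not _ (fun i => ω i = ω i0)]
    rw [Finset.sum_eq_zero (s := Finset.univ.filter (fun i => ¬ ω i = ω i0))]
    · rw [add_zero, Finset.sum_congr rfl (g := fun _ => ω i0 ^ r * P.eval (ω i0))]
      · rw [Finset.sum_const, nsmul_eq_mul]; ring
      · intro i hi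
        rw [(Finset.mem_filter.mp hi).2]
    · intro i hi
      rw [hPi i (Finset.mem_filter.mp hi).2, mul_zero]
  set K : ℝ := ∑ k ∈ Finset.range (P.natDegree + 1), ‖P.coeff k‖ * (C * R ^ k) with hK
  have bd : ∀ r ≥ r0, ‖ω i0‖ ^ r * ‖P.eval (ω i0)‖ ≤ K * R ^ r := by
    intro r hr
    have h1 : ‖(m : ℂ) * ω i0 ^ r * P.eval (ω i0)‖ ≤ K * R ^ r := by
      rw [← key r, hK, Finset.sum_mul]
      refine (norm_sum_le _ _).trans (Finset.sum_le_sum fun k _ => ?_)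
      rw [norm_mul]
      have := h (r + k) (by omega)
      calc ‖P.coeff k‖ * ‖∑ i, ω i ^ (r + k)‖ ≤ ‖P.coeff k‖ * (C * R ^ (r + k)) := by gcongr
        _ = _ := by rw [pow_add]; ring
    rw [norm_mul, norm_mul, norm_pow, Complex.norm_natCast] at h1
    have : (1 : ℝ) ≤ m := by exact_mod_cast hm0
    have h2 : 0 ≤ ‖ω i0‖ ^ r * ‖P.eval (ω i0)‖ := by positivity
    nlinarith
  have hpos : 0 < ‖P.eval (ω i0)‖ := norm_pos_iff.mpr hP0
  have hratio : 1 < ‖ω i0‖ / R := by rwa [one_lt_div hR]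
  obtain ⟨r, hr⟩ := (((tendsto_pow_atTop_atTop_of_one_lt hratio).eventually_gt_atTop
    (K / ‖P.eval (ω i0)‖)).and (Filter.eventually_ge_atTop r0)).exists
  have h3 := bd r hr.2
  have h4 := hr.1
  rw [div_pow, div_lt_div_iff₀ hpos (by positivity)] at h4
  linarith

/-- From the Newton recursion and vanishing of high coefficients, to a bound on `c 1`. -/
lemma newton_bound (N : ℕ) (c S : ℕ → ℂ) (R C : ℝ) (hR : 0 < R) (r0 : ℕ)
    (hc0 : c 0 = 1) (hcN : ∀ d > N, c d = 0)
    (hnewt : ∀ d : ℕ, 1 ≤ d → (d : ℂ) * c d = ∑ r ∈ Finset.range d, S (r + 1) * c (d - (r + 1)))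
    (hS : ∀ r ≥ r0, ‖S (2 * r)‖ ≤ C * R ^ (2 * r)) : ‖c 1‖ ≤ N * R := by
  -- the reversed polynomial
  set P : ℂ[X] := ∑ d ∈ Finset.range (N + 1), Polynomial.C (c d) * X ^ (N - d) with hP
  have hcoeff : ∀ d ≤ N, P.coeff (N - d) = c d := by
    intro d hd
    rw [hP, finsetSum_coeff, Finset.sum_eq_single d]
    · simp
    · intro b hb hbd
      rw [coeff_C_mul, coeff_X_pow, if_neg, mul_zero]
      have := Finset.mem_range.mp hb
      omega
    · intro h; exact absurd (Finset.mem_range.mpr (by omega)) h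
  have hdegle : P.natDegree ≤ N := by
    apply natDegree_sum_le_of_forall_le
    intro d _
    exact (natDegree_C_mul_X_pow_le _ _).trans (Nat.sub_le _ _)
  have hlead : P.coeff N = 1 := by simpa [hc0] using hcoeff 0 (Nat.zero_le _)
  have hdeg : P.natDegree = N :=
    le_antisymm hdegle (le_natDegree_of_ne_zero (by rw [hlead]; exact one_ne_zero))
  have hmonic : P.Monic := by rw [Monic, leadingCoeff, hdeg, hlead]
  have hcard : P.roots.card = P.natDegree := splits_iff_card_roots.mp (IsAlgClosed.splits P)
  -- enumerate the roots
  obtain ⟨ω, hω⟩ : ∃ ω : Fin N → ℂ, (Finset.univ.val.map ω) = P.roots := by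
    have hl : P.roots.toList.length = N := by rw [Multiset.length_toList, hcard, hdeg]
    refine ⟨fun i => P.roots.toList.get (i.cast hl.symm), ?_⟩
    have : (Finset.univ : Finset (Fin N)).val.map (fun i => P.roots.toList.get (i.cast hl.symm))
        = (P.roots.toList : Multiset ℂ) := by
      rw [Fin.univ_val_map]
      congr 1
      apply List.ext_get
      · simp [hcard, hdeg]
      · intro n h1 h2
        simp
    rw [this, Multiset.coe_toList]
  set e : ℕ → ℂ := fun d => MvPolynomial.aeval ω (MvPolynomial.esymm (Fin N) ℂ d) with he
  set ps : ℕ → ℂ := fun d => MvPolynomial.aeval ω (MvPolynomial.psum (Fin N) ℂ d) with hps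
  have hps' : ∀ d, ps d = ∑ i, ω i ^ d := by
    intro d; simp [hps, MvPolynomial.psum]
  have hce : ∀ d, c d = (-1) ^ d * e d := by
    intro d
    have he1 : e d = P.roots.esymm d := by
      rw [he, ← hω]; exact MvPolynomial.aeval_esymm_eq_multiset_esymm (Fin N) ℂ d ω
    rcases le_or_gt d N with hd | hd
    · have := coeff_eq_esymm_roots_of_card hcard (k := N - d) (by omega)
      rw [hcoeff d hd, hmonic.leadingCoeff, one_mul, hdeg, Nat.sub_sub_self hd] at this
      rw [this, he1]
    · rw [hcN d hd, he1, Multiset.esymm, Multiset.powersetCard_eq_empty]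
      · simp
      · rw [hcard, hdeg]; exact hd
  have hnewt2 : ∀ d : ℕ, 1 ≤ d → (d : ℂ) * c d = ∑ r ∈ Finset.range d, (- ps (r + 1)) * c (d - (r + 1)) := by
    intro d hd
    have h1 := congrArg (MvPolynomial.aeval ω) (MvPolynomial.mul_esymm_eq_sum (Fin N) ℂ d)
    rw [map_mul, map_mul, map_natCast, map_sum] at h1
    simp only [map_mul, map_pow, map_neg, map_one] at h1
    change (d : ℂ) * e d = _ at h1
    have h2 : (d : ℂ) * c d = (-1) ^ d * ((d : ℂ) * e d) := by rw [hce d]; ring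
    rw [h2, h1, ← mul_assoc, ← pow_add, Finset.sum_filter,
      Finset.Nat.sum_antidiagonal_eq_sum_range_succ_mk, Finset.mul_sum]
    rw [Finset.sum_range_succ]
    simp only [lt_self_iff_false, if_false, mul_zero, add_zero]
    rw [← Finset.sum_range_reflect]
    refine Finset.sum_congr rfl fun r hr => ?_
    have hr' := Finset.mem_range.mp hr
    rw [if_pos (by omega), hce (d - (r+1))]
    have e1 : d - 1 - r = d - (r + 1) := by omega
    rw [e1]
    have e2 : d - (d - (r + 1)) = r + 1 := by omega
    rw [e2]
    change (-1) ^ (d + (d + 1)) * ((-1) ^ (d - (r + 1)) * e (d - (r+1)) * ps (r + 1)) = _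
    have : ((-1 : ℂ)) ^ (d + (d + 1)) = -1 := Odd.neg_one_pow ⟨d, by omega⟩
    rw [this]; ring
  have hSp : ∀ r, S (r + 1) = - ps (r + 1) := by
    intro r
    induction r using Nat.strong_induction_on with
    | _ r ih =>
      have h1 := hnewt (r + 1) (by omega)
      rw [hnewt2 (r + 1) (by omega), Finset.sum_range_succ, Finset.sum_range_succ] at h1
      rw [Finset.sum_congr rfl (g := fun x => S (x + 1) * c (r + 1 - (x + 1)))] at h1
      · simp only [Nat.sub_self, hc0, mul_one] at h1
        exact (add_left_cancel h1).symm
      · intro x hx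
        rw [ih x (Finset.mem_range.mp hx)]
  have hb : ∀ i, ‖ω i‖ ≤ R := by
    intro i
    have := growth_bound (fun i => ω i ^ 2) (R ^ 2) C (by positivity) (r0 + 1) ?_ i
    · simp only [norm_pow] at this
      exact (pow_le_pow_iff_left₀ (norm_nonneg _) hR.le two_ne_zero).mp this
    · intro r hr
      have h1 := hS r (by omega)
      obtain ⟨r', rfl⟩ : ∃ r', r = r' + 1 := ⟨r - 1, by omega⟩
      have h2 := hSp (2 * r' + 1)
      have : 2 * (r' + 1) = 2 * r' + 1 + 1 := by ring
      rw [this, h2, norm_neg, hps'] at h1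
      simp_rw [← pow_mul, this]
      exact h1
  have h1 : c 1 = S 1 := by
    have := hnewt 1 le_rfl
    simpa [hc0] using this
  rw [h1, hSp 0, norm_neg, hps']
  refine (norm_sum_le _ _).trans ?_
  simp only [zero_add, pow_one]
  refine (Finset.sum_le_sum fun i _ => hb i).trans ?_
  simp

section StepanovAbstract

variable {E : Type*} [Field E] {B : Type*} [CommRing B] [Algebra E[X] B] [Algebra E B]
  [IsScalarTower E E[X] B] {ι : Type*} [Fintype ι]

/-- Elements all of whose coordinates have degree `< m`. -/
def filtV (e : Module.Basis ι E[X] B) (m : ℕ) : Submodule E B where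
  carrier := {b | ∀ i, e.repr b i ∈ degreeLT E m}
  add_mem' := by
    intro a b ha hb i
    rw [map_add, Finsupp.add_apply]
    exact Submodule.add_mem _ (ha i) (hb i)
  zero_mem' := by
    intro i
    rw [map_zero, Finsupp.zero_apply]
    exact Submodule.zero_mem _
  smul_mem' := by
    intro c b hb i
    have : c • b = (Polynomial.C c) • b := by
      rw [← algebraMap_smul E[X] c b]; rfl
    rw [this, map_smul, Finsupp.smul_apply, smul_eq_mul, ← Polynomial.smul_eq_C_mul]
    exact Submodule.smul_mem _ _ (hb i)

lemma mem_filtV {e : Module.Basis ι E[X] B} {m : ℕ} {b : B} :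
    b ∈ filtV e m ↔ ∀ i, e.repr b i ∈ degreeLT E m := Iff.rfl

lemma filtV_mono (e : Module.Basis ι E[X] B) {m m' : ℕ} (h : m ≤ m') : filtV e m ≤ filtV e m' :=
  fun _ hb i => degreeLT_mono h (hb i)

/-- The filtration piece is a product of copies of `degreeLT`. -/
noncomputable def filtVEquiv (e : Module.Basis ι E[X] B) (m : ℕ) :
    filtV e m ≃ₗ[E] (ι → degreeLT E m) where
  toFun b i := ⟨e.repr b.1 i, b.2 i⟩
  invFun f := ⟨e.equivFun.symm (fun i => (f i).1), by
    intro i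
    have : e.repr (e.equivFun.symm (fun i => (f i).1)) i = (f i).1 := by
      rw [← Module.Basis.equivFun_apply, LinearEquiv.apply_symm_apply]
    rw [this]; exact (f i).2⟩
  map_add' := by
    intro a b; ext i; simp
  map_smul' := by
    intro c b; funext i; apply Subtype.ext
    have : c • b.1 = (Polynomial.C c) • b.1 := by
      rw [← algebraMap_smul E[X] c b.1]; rfl
    simp [this, Polynomial.smul_eq_C_mul]
  left_inv := by
    intro b
    apply Subtype.ext
    apply e.equivFun.injective
    rw [LinearEquiv.apply_symm_apply]; rfl
  right_inv := by
    intro f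
    funext i
    apply Subtype.ext
    change e.repr (e.equivFun.symm (fun i => (f i).1)) i = (f i).1
    rw [← Module.Basis.equivFun_apply, LinearEquiv.apply_symm_apply]

instance filtV_finite (e : Module.Basis ι E[X] B) (m : ℕ) : Module.Finite E (filtV e m) := by
  have : Module.Finite E (degreeLT E m) := Module.Finite.equiv (degreeLTEquiv E m).symm
  exact Module.Finite.equiv (filtVEquiv e m).symm

lemma finrank_filtV (e : Module.Basis ι E[X] B) (m : ℕ) :
    Module.finrank E (filtV e m) = Fintype.card ι * m := by
  have : Module.Finite E (degreeLT E m) := Module.Finite.equiv (degreeLTEquiv E m).symm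
  rw [(filtVEquiv e m).finrank_eq, Module.finrank_pi_fintype]
  simp [(degreeLTEquiv E m).finrank_eq]

lemma mul_mem_degreeLT {a b : ℕ} {x y : E[X]} (hx : x ∈ degreeLT E a) (hy : y ∈ degreeLT E b) :
    x * y ∈ degreeLT E (a + b) := by
  rw [mem_degreeLT] at *
  rcases eq_or_ne x 0 with rfl | hx0
  · simp only [zero_mul, degree_zero]; exact WithBot.bot_lt_coe _
  rcases eq_or_ne y 0 with rfl | hy0
  · simp only [mul_zero, degree_zero]; exact WithBot.bot_lt_coe _
  rw [degree_eq_natDegree hx0] at hx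
  rw [degree_eq_natDegree hy0] at hy
  rw [degree_mul, degree_eq_natDegree hx0, degree_eq_natDegree hy0]
  norm_cast at *
  omega

lemma mem_degreeLT_natDegree (x : E[X]) : x ∈ degreeLT E (x.natDegree + 1) := by
  rw [mem_degreeLT]
  exact lt_of_le_of_lt degree_le_natDegree (by norm_cast; omega)

lemma exists_mem_filtV (e : Module.Basis ι E[X] B) (b : B) : ∃ m, b ∈ filtV e m := by
  refine ⟨Finset.univ.sup (fun i => (e.repr b i).natDegree + 1), fun i => ?_⟩
  exact degreeLT_mono (Finset.le_sup (f := fun i => (e.repr b i).natDegree + 1)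
    (Finset.mem_univ i)) (mem_degreeLT_natDegree _)

lemma exists_mem_filtV_family (e : Module.Basis ι E[X] B) {κ : Type*} [Fintype κ] (b : κ → B) :
    ∃ m, ∀ k, b k ∈ filtV e m := by
  choose f hf using fun k => exists_mem_filtV e (b k)
  exact ⟨Finset.univ.sup f, fun k => filtV_mono e (Finset.le_sup (Finset.mem_univ k)) (hf k)⟩

lemma smul_mem_filtV (e : Module.Basis ι E[X] B) {a b : ℕ} {x : E[X]} {y : B}
    (hx : x ∈ degreeLT E a) (hy : y ∈ filtV e b) : x • y ∈ filtV e (a + b) := by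
  intro i
  rw [map_smul, Finsupp.smul_apply, smul_eq_mul]
  exact mul_mem_degreeLT hx (hy i)

lemma filtV_mul (e : Module.Basis ι E[X] B) :
    ∃ C : ℕ, ∀ a b : ℕ, ∀ x ∈ filtV e a, ∀ y ∈ filtV e b, x * y ∈ filtV e (a + b + C) := by
  obtain ⟨C, hC⟩ := exists_mem_filtV_family e (fun k : ι × ι => e k.1 * e k.2)
  refine ⟨C, fun a b x hx y hy => ?_⟩
  rw [← e.sum_repr x, ← e.sum_repr y, Finset.sum_mul_sum]
  refine Submodule.sum_mem _ fun i _ => Submodule.sum_mem _ fun j _ => ?_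
  rw [smul_mul_smul_comm]
  exact smul_mem_filtV e (mul_mem_degreeLT (hx i) (hy j)) (hC (i, j))

lemma filtV_pow (e : Module.Basis ι E[X] B) {κ : Type*} [Fintype κ] (b : κ → B) :
    ∃ C : ℕ, ∀ P : ℕ, 1 ≤ P → ∀ k, b k ^ P ∈ filtV e (C * P) := by
  obtain ⟨C, hC⟩ := filtV_mul e
  obtain ⟨m, hm⟩ := exists_mem_filtV_family e b
  refine ⟨m + C, fun P hP k => ?_⟩
  induction P, hP using Nat.le_induction with
  | base => rw [pow_one, mul_one]; exact filtV_mono e (by omega) (hm k)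
  | succ P _ ih =>
    rw [pow_succ]
    exact filtV_mono e (by ring_nf; omega) (hC _ _ _ ih _ (hm k))

lemma X_pow_smul_basis_mem (e : Module.Basis ι E[X] B) (a m : ℕ) (h : a < m) (i : ι) :
    (X ^ a : E[X]) • e i ∈ filtV e m := by
  intro k
  rw [map_smul, Finsupp.smul_apply, e.repr_self, smul_eq_mul, Finsupp.single_apply, mem_degreeLT]
  split_ifs
  · rw [mul_one, degree_X_pow]; exact_mod_cast h
  · rw [mul_zero, degree_zero]; exact WithBot.bot_lt_coe _

/-- Order bound: a nonzero element of `filtV e l` vanishes to order at most `n (l + C)`. -/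
lemma filtV_order (e : Module.Basis ι E[X] B) (φ : B →+* PowerSeries E)
    (hφ : Function.Injective φ) (x0 : E)
    (hφx : ∀ r : E[X], φ (algebraMap E[X] B (r.comp (X - Polynomial.C x0))) = (r : PowerSeries E)) 
    (C : ℕ) (hC : ∀ a b : ℕ, ∀ x ∈ filtV e a, ∀ y ∈ filtV e b, x * y ∈ filtV e (a + b + C))
    (l : ℕ) (b : B) (hb : b ∈ filtV e l) (hb0 : b ≠ 0) (o : ℕ)
    (ho : (PowerSeries.X : PowerSeries E) ^ o ∣ φ b) : o ≤ Fintype.card ι * (l + C) := by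
  obtain ⟨m1, hm1⟩ := exists_mem_filtV e (1 : B)
  set M := o + m1 with hM
  let f : (filtV e M × degreeLT E o) →ₗ[E] filtV e (l + M + C) :=
    { toFun := fun vr => ⟨b * vr.1.1 + algebraMap E[X] B (vr.2.1.comp (X - Polynomial.C x0)), by
        refine Submodule.add_mem _ (hC _ _ _ hb _ vr.1.2) ?_
        rw [Algebra.algebraMap_eq_smul_one]
        refine filtV_mono e (by omega) (smul_mem_filtV e (a := o) ?_ hm1)
        have := vr.2.2
        rw [mem_degreeLT] at this ⊢
        rcases eq_or_ne vr.2.1 0 with h0 | h0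
        · rw [h0, zero_comp, degree_zero]; exact WithBot.bot_lt_coe _
        · have h1 : vr.2.1.comp (X - Polynomial.C x0) ≠ 0 := by
            intro h; apply h0
            have := hφx vr.2.1
            rw [h, map_zero, map_zero] at this
            exact_mod_cast this.symm
          rw [degree_eq_natDegree h1, natDegree_comp, natDegree_X_sub_C, mul_one,
            ← degree_eq_natDegree h0]
          exact this⟩
      map_add' := by
        intro x y
        apply Subtype.ext
        simp only [Prod.fst_add, Prod.snd_add, Submodule.coe_add, add_comp, map_add]
        ring
      map_smul' := by
        intro c x
        apply Subtype.ext
        simp only [Prod.smul_fst, Prod.smul_snd, Submodule.coe_smul, smul_comp, RingHom.id_apply,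
          smul_add]
        congr 1
        · exact mul_smul_comm _ _ _
        · rw [Algebra.algebraMap_eq_smul_one, smul_assoc, ← Algebra.algebraMap_eq_smul_one] }
  have hinj : Function.Injective f := by
    rw [← LinearMap.ker_eq_bot, LinearMap.ker_eq_bot']
    rintro ⟨v, r⟩ hvr
    have h1 : b * v.1 + algebraMap E[X] B (r.1.comp (X - Polynomial.C x0)) = 0 :=
      congrArg Subtype.val hvr
    have h2 := congrArg φ h1
    rw [map_add, map_mul, hφx, map_zero] at h2
    have h3 : (PowerSeries.X : PowerSeries E) ^ o ∣ (r.1 : PowerSeries E) := by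
      have : (r.1 : PowerSeries E) = - (φ b * φ v.1) := by linear_combination h2
      rw [this]
      exact (dvd_mul_of_dvd_left ho _).neg_right
    rw [PowerSeries.X_pow_dvd_iff] at h3
    have hr0 : r.1 = 0 := by
      ext k
      rcases lt_or_ge k o with hk | hk
      · simpa using h3 k hk
      · rw [coeff_zero]
        apply coeff_eq_zero_of_degree_lt
        exact lt_of_lt_of_le (mem_degreeLT.mp r.2) (by exact_mod_cast hk)
    rw [hr0, zero_comp, map_zero, add_zero] at h1
    have h4 := congrArg φ h1
    rw [map_mul, map_zero, mul_eq_zero] at h4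
    have hv : v.1 = 0 := by
      rcases h4 with h4 | h4
      · exact absurd (hφ (h4.trans (map_zero φ).symm)) hb0
      · exact hφ (h4.trans (map_zero φ).symm)
    exact Prod.ext (Subtype.ext hv) (Subtype.ext hr0)
  have : Module.Finite E (degreeLT E o) := Module.Finite.equiv (degreeLTEquiv E o).symm
  have h := LinearMap.finrank_le_finrank_of_injective hinj
  rw [Module.finrank_prod, finrank_filtV, finrank_filtV, (degreeLTEquiv E o).finrank_eq,
    Module.finrank_fin_fun] at h
  have : Fintype.card ι * (l + M + C) = Fintype.card ι * M + Fintype.card ι * (l + C) := by ring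
  omega

/-- Linear independence over `P`-th powers. -/
lemma indep_pow (p : ℕ) [Fact p.Prime] [CharP E p] (μ : ℕ) {κ : Type*} [Fintype κ]
    (w g : κ → PowerSeries E)
    (hw : ∀ a : κ → E, (PowerSeries.X : PowerSeries E) ^ (p ^ μ) ∣ ∑ j, PowerSeries.C (a j) * w j →
      a = 0)
    (h : ∑ j, w j * g j ^ (p ^ μ) = 0) : g = 0 := by
  have hP : p ^ μ ≠ 0 := pow_ne_zero _ (Fact.out : p.Prime).ne_zero
  have key : ∀ v : ℕ, ∀ j, (PowerSeries.X : PowerSeries E) ^ v ∣ g j := by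
    intro v
    induction v with
    | zero => intro j; simp
    | succ v ih =>
      choose g' hg' using ih
      have h1 : ∑ j, w j * g' j ^ (p ^ μ) = 0 := by
        have : (PowerSeries.X : PowerSeries E) ^ (v * p ^ μ) * ∑ j, w j * g' j ^ (p ^ μ) = 0 := by
          rw [← h, Finset.mul_sum]
          refine Finset.sum_congr rfl fun j _ => ?_
          rw [hg' j, mul_pow, pow_mul]; ring
        exact (mul_eq_zero.mp this).resolve_left (pow_ne_zero _ PowerSeries.X_ne_zero)
      have h2 : ∀ j, ∃ k : PowerSeries E,
          g' j = PowerSeries.C (PowerSeries.constantCoeff (g' j)) + PowerSeries.X * k := by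
        intro j
        have : (PowerSeries.X : PowerSeries E) ∣
            g' j - PowerSeries.C (PowerSeries.constantCoeff (g' j)) := by
          rw [PowerSeries.X_dvd_iff]; simp
        obtain ⟨k, hk⟩ := this
        exact ⟨k, by rw [← hk]; ring⟩
      choose k hk using h2
      have hch : CharP (PowerSeries E) p :=
        charP_of_injective_ringHom (f := (PowerSeries.C : E →+* PowerSeries E)) PowerSeries.C_injective p
      have h3 : ∀ j, g' j ^ (p ^ μ) = PowerSeries.C (PowerSeries.constantCoeff (g' j) ^ (p ^ μ))
          + PowerSeries.X ^ (p ^ μ) * k j ^ (p ^ μ) := by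
        intro j
        conv_lhs => rw [hk j]
        rw [add_pow_char_pow, mul_pow, map_pow]
      have h4 := hw (fun j => PowerSeries.constantCoeff (g' j) ^ (p ^ μ)) (by
        refine ⟨- ∑ j, w j * k j ^ (p ^ μ), ?_⟩
        have : ∑ j, PowerSeries.C (PowerSeries.constantCoeff (g' j) ^ (p ^ μ)) * w j
          + PowerSeries.X ^ (p ^ μ) * ∑ j, w j * k j ^ (p ^ μ) = 0 := by
          rw [← h1, Finset.mul_sum, ← Finset.sum_add_distrib]
          refine Finset.sum_congr rfl fun j _ => ?_
          rw [h3 j]; ring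
        linear_combination this)
      intro j
      have h5 : PowerSeries.constantCoeff (g' j) = 0 := by
        have := congrFun h4 j
        exact (pow_eq_zero_iff hP).mp this
      rw [hg' j, pow_succ]
      exact mul_dvd_mul_left _ (PowerSeries.X_dvd_iff.mpr h5)
  funext j
  ext n
  exact PowerSeries.X_pow_dvd_iff.mp (key (n + 1) j) n (Nat.lt_succ_self n)

end StepanovAbstract

section StepanovMain

variable {E : Type*} [Field E] {B : Type*} [CommRing B] [Algebra E[X] B] [Algebra E B]
  [IsScalarTower E E[X] B] {ι : Type*} [Fintype ι]

lemma esmul_eq (c : E) (b : B) : c • b = algebraMap E[X] B (Polynomial.C c) * b := by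
  rw [← algebraMap_smul E[X] c b, Algebra.smul_def]; rfl

lemma Xpow_indep (e : Module.Basis ι E[X] B) (m : ℕ) (c : ι × Fin m → E)
    (h : ∑ u, c u • ((X ^ (u.2 : ℕ) : E[X]) • e u.1) = 0) : c = 0 := by
  have h1 : ∑ i, (∑ a : Fin m, Polynomial.C (c (i, a)) * X ^ (a : ℕ)) • e i = 0 := by
    rw [← h, Fintype.sum_prod_type]
    refine Finset.sum_congr rfl fun i _ => ?_
    rw [Finset.sum_smul]
    refine Finset.sum_congr rfl fun a _ => ?_
    rw [← algebraMap_smul E[X] (c (i, a)), smul_smul]; rfl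
  have h2 := Fintype.linearIndependent_iff.mp e.linearIndependent _ h1
  funext ⟨i, a⟩
  have h3 := congrArg (fun r => coeff r (a : ℕ)) (h2 i)
  simp only [finsetSum_coeff, coeff_C_mul, coeff_X_pow, coeff_zero, mul_ite, mul_one,
    mul_zero, Fin.val_inj] at h3
  simpa using h3

lemma stepanov_core [IsAlgClosed E] (p : ℕ) [Fact p.Prime] [CharP E p]
    (e : Module.Basis ι E[X] B) (φ : B →+* PowerSeries E)
    (hφ : Function.Injective φ) (x0 : E)
    (hφx : ∀ r : E[X], φ (algebraMap E[X] B (r.comp (X - Polynomial.C x0))) = (r : PowerSeries E))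
    (σ : B →ₐ[E[X]] B) (C C1 C2 : ℕ)
    (hC : ∀ a b : ℕ, ∀ x ∈ filtV e a, ∀ y ∈ filtV e b, x * y ∈ filtV e (a + b + C))
    (hC1 : ∀ P : ℕ, 1 ≤ P → ∀ k, e k ^ P ∈ filtV e (C1 * P))
    (hC2 : ∀ k, σ (e k) ∈ filtV e C2)
    (μ P : ℕ) (hP : P = p ^ μ) (l m : ℕ)
    (hl : Fintype.card ι * (l + C) < P)
    (hlm : l * P + C1 * P + m + C2 + C < Fintype.card ι * l * m)
    (Xs : Finset E) (hX1 : ∀ x ∈ Xs, x ^ (P ^ 2) = x)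
    (hX2 : ∀ x ∈ Xs, ∀ b : B, (∀ π : B →+* E, (∀ r, π (algebraMap E[X] B r) = r.eval x) → π b = 0) →
      ∀ i, (e.repr b i).eval x = 0)
    (hX3 : ∀ x ∈ Xs, ∀ π : B →+* E, (∀ r, π (algebraMap E[X] B r) = r.eval x) →
      ∀ i, π (e i) ^ (P ^ 2) = π (σ (e i))) :
    Xs.card ≤ l + m * P + C1 * P + C := by
  have hP1 : 1 ≤ P := by rw [hP]; exact Nat.one_le_pow _ _ (Fact.out : p.Prime).pos
  have hchB : CharP B p := by
    have : Function.Injective (algebraMap E B) := by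
      intro a b hab
      have h1 := hφx (Polynomial.C a)
      have h2 := hφx (Polynomial.C b)
      rw [C_comp] at h1 h2
      have h3 : algebraMap E[X] B (Polynomial.C a) = algebraMap E[X] B (Polynomial.C b) := by
        have := hab
        rw [IsScalarTower.algebraMap_apply E E[X] B, IsScalarTower.algebraMap_apply E E[X] B] at this
        exact this
      rw [h3, h2] at h1
      have := congrArg (PowerSeries.coeff 0) h1
      simpa using this.symm
    exact charP_of_injective_ringHom this p
  have hφC : ∀ (c : E) (b : B), φ (c • b) = PowerSeries.C c * φ b := by
    intro c b
    have h1 := hφx (Polynomial.C c)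
    rw [C_comp] at h1
    rw [esmul_eq, map_mul, h1, Polynomial.coe_C]
  let u : ι × Fin m → B := fun t => (X ^ (t.2 : ℕ) : E[X]) • e t.1
  let w : ι × Fin l → B := fun t => (X ^ (t.2 : ℕ) : E[X]) • e t.1
  have hn0 : 0 < Fintype.card ι := by
    by_contra h
    have : Fintype.card ι = 0 := by omega
    rw [this] at hlm; simp at hlm
  -- powers
  have hupow : ∀ t, u t ^ P ∈ filtV e (m * P + C1 * P) := by
    intro t
    have : u t ^ P = (X ^ ((t.2 : ℕ) * P) : E[X]) • (e t.1) ^ P := by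
      simp only [u]; rw [_root_.smul_pow, pow_mul]
    rw [this]
    refine smul_mem_filtV e ?_ (hC1 P hP1 _)
    rw [mem_degreeLT, degree_X_pow]
    exact_mod_cast Nat.mul_lt_mul_of_pos_right t.2.2 hP1
  have hwpow : ∀ t, w t ^ P ∈ filtV e (l * P + C1 * P) := by
    intro t
    have : w t ^ P = (X ^ ((t.2 : ℕ) * P) : E[X]) • (e t.1) ^ P := by
      simp only [w]; rw [_root_.smul_pow, pow_mul]
    rw [this]
    refine smul_mem_filtV e ?_ (hC1 P hP1 _)
    rw [mem_degreeLT, degree_X_pow]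
    exact_mod_cast Nat.mul_lt_mul_of_pos_right t.2.2 hP1
  have hσu : ∀ t, σ (u t) ∈ filtV e (m + C2) := by
    intro t
    simp only [u, map_smul]
    refine smul_mem_filtV e ?_ (hC2 _)
    rw [mem_degreeLT, degree_X_pow]
    exact_mod_cast t.2.2
  -- relation
  obtain ⟨A, hA, hA0⟩ : ∃ A : (ι × Fin l) × (ι × Fin m) → E,
      ∑ t, A t • (w t.1 ^ P * σ (u t.2)) = 0 ∧ ∃ t, A t ≠ 0 := by
    let v : (ι × Fin l) × (ι × Fin m) → filtV e (l * P + C1 * P + (m + C2) + C) :=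
      fun t => ⟨w t.1 ^ P * σ (u t.2), hC _ _ _ (hwpow _) _ (hσu _)⟩
    have hv : ¬ LinearIndependent E v := by
      intro h
      have := h.fintype_card_le_finrank
      rw [finrank_filtV] at this
      simp only [Fintype.card_prod, Fintype.card_fin] at this
      have h2 : Fintype.card ι * l * (Fintype.card ι * m) =
        Fintype.card ι * (Fintype.card ι * l * m) := by ring
      rw [h2] at this
      have := Nat.le_of_mul_le_mul_left this hn0
      omega
    rw [Fintype.not_linearIndependent_iff] at hv
    obtain ⟨A, hA, hA0⟩ := hv
    refine ⟨A, ?_, hA0⟩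
    have := congrArg Subtype.val hA
    simpa [v] using this
  choose c hc using fun t => IsAlgClosed.exists_pow_nat_eq (A t) (n := P ^ 2) (by positivity)
  let G : ι × Fin l → B := fun s => ∑ t, c (s, t) • u t
  let ψ : B := ∑ s, w s * G s ^ P
  have hGP : ∀ s, G s ^ P = ∑ t, c (s, t) ^ P • u t ^ P := by
    intro s
    simp only [G]
    rw [hP, sum_pow_char_pow]
    simp only [_root_.smul_pow]
  have hψ0 : ψ ≠ 0 := by
    intro h0
    have h1 : ∑ s, φ (w s) * φ (G s) ^ (p ^ μ) = 0 := by
      have := congrArg φ h0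
      simp only [ψ, map_sum, map_mul, map_pow, map_zero, hP] at this
      exact this
    have h2 := indep_pow p μ (fun s => φ (w s)) (fun s => φ (G s)) (by
      intro a ha
      have h3 : ∑ s, PowerSeries.C (a s) * φ (w s) = φ (∑ s, a s • w s) := by
        rw [map_sum]; simp only [hφC]
      rw [h3, ← hP] at ha
      by_contra hne
      have h4 : ∑ s, a s • w s ≠ 0 := fun h => hne (Xpow_indep e l a h)
      have h5 : ∑ s, a s • w s ∈ filtV e l :=
        Submodule.sum_mem _ fun s _ => Submodule.smul_mem _ _
          (X_pow_smul_basis_mem e _ _ s.2.2 _)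
      have := filtV_order e φ hφ x0 hφx C hC l _ h5 h4 P ha
      omega) h1
    obtain ⟨⟨s, t⟩, ht⟩ := hA0
    have h3 : G s = 0 := hφ (by rw [map_zero]; exact congrFun h2 s)
    have h4 := Xpow_indep e m (fun t => c (s, t)) h3
    apply ht
    rw [← hc]
    have : c (s, t) = 0 := congrFun h4 t
    rw [this, zero_pow (by positivity)]
  have hψm : ψ ∈ filtV e (l + m * P + C1 * P + C) := by
    refine Submodule.sum_mem _ fun s _ => ?_
    rw [hGP]
    have := hC l (m * P + C1 * P) (w s) (X_pow_smul_basis_mem e _ _ s.2.2 _)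
      (∑ t, c (s, t) ^ P • u t ^ P) (Submodule.sum_mem _ fun t _ => Submodule.smul_mem _ _ (hupow t))
    exact filtV_mono e (by omega) this
  have hvan : ∀ x ∈ Xs, ∀ i, (e.repr ψ i).eval x = 0 := by
    intro x hx
    refine hX2 x hx ψ fun π hπ => ?_
    have hπs : ∀ (c : E) (b : B), π (c • b) = c * π b := by
      intro c b
      rw [esmul_eq, map_mul, hπ, eval_C]
    have hπx : ∀ (a : ℕ) (b : B), π ((X ^ a : E[X]) • b) = x ^ a * π b := by
      intro a b
      rw [Algebra.smul_def, map_mul, hπ, eval_pow, eval_X]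
    have hu : ∀ t, π (u t) ^ (P ^ 2) = π (σ (u t)) := by
      intro t
      simp only [u, map_smul, hπx]
      rw [mul_pow, hX3 x hx π hπ, ← pow_mul, mul_comm _ (P ^ 2), pow_mul, hX1 x hx]
    have hG : ∀ s, π (G s) ^ (P ^ 2) = ∑ t, A (s, t) * π (σ (u t)) := by
      intro s
      simp only [G, map_sum, hπs]
      have : P ^ 2 = p ^ (μ * 2) := by rw [hP, pow_mul]
      rw [this, sum_pow_char_pow, ← this]
      refine Finset.sum_congr rfl fun t _ => ?_
      rw [mul_pow, hc, hu]
    have : π ψ ^ P = 0 := by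
      have h1 := congrArg π hA
      rw [map_zero] at h1
      rw [← h1]
      simp only [ψ, map_sum, map_mul, map_pow]
      rw [hP, sum_pow_char_pow, ← hP]
      refine Eq.trans ?_ (Fintype.sum_prod_type _).symm
      refine Finset.sum_congr rfl fun s _ => ?_
      rw [mul_pow, ← pow_mul, ← sq, hG, Finset.mul_sum]
      refine Finset.sum_congr rfl fun t _ => ?_
      rw [hπs, map_mul, map_pow]; ring
    exact (pow_eq_zero_iff (by omega)).mp this
  obtain ⟨i, hi⟩ : ∃ i, e.repr ψ i ≠ 0 := by
    by_contra h
    push Not at h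
    apply hψ0
    apply e.repr.injective
    ext i
    rw [h i]; simp
  have h1 : Xs.card ≤ (e.repr ψ i).natDegree := by
    apply Polynomial.card_le_degree_of_subset_roots (p := e.repr ψ i)
    intro x hx
    rw [Polynomial.mem_roots hi]
    exact hvan x hx i
  have h2 := hψm i
  rw [mem_degreeLT, degree_eq_natDegree hi] at h2
  have h3 : (e.repr ψ i).natDegree < l + m * P + C1 * P + C := by exact_mod_cast h2
  omega

theorem stepanov_abstract [IsAlgClosed E] (p : ℕ) [Fact p.Prime] [CharP E p] [Nonempty ι]
    (e : Module.Basis ι E[X] B) (φ : B →+* PowerSeries E)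
    (hφ : Function.Injective φ) (x0 : E)
    (hφx : ∀ r : E[X], φ (algebraMap E[X] B (r.comp (X - Polynomial.C x0))) = (r : PowerSeries E))
    (σ : B →ₐ[E[X]] B) :
    ∃ C P0 : ℕ, ∀ μ P : ℕ, P = p ^ μ → P0 ≤ P → ∀ Xs : Finset E, (∀ x ∈ Xs, x ^ (P ^ 2) = x) →
    (∀ x ∈ Xs, ∀ b : B, (∀ π : B →+* E, (∀ r, π (algebraMap E[X] B r) = r.eval x) → π b = 0) →
      ∀ i, (e.repr b i).eval x = 0) →
    (∀ x ∈ Xs, ∀ π : B →+* E, (∀ r, π (algebraMap E[X] B r) = r.eval x) →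
      ∀ i, π (e i) ^ (P ^ 2) = π (σ (e i))) →
    Fintype.card ι * Xs.card ≤ P ^ 2 + C * P := by
  obtain ⟨C, hC⟩ := filtV_mul e
  obtain ⟨C1, hC1⟩ := filtV_pow e (fun i => e i)
  obtain ⟨C2, hC2⟩ := exists_mem_filtV_family e (fun i => σ (e i))
  set n := Fintype.card ι with hn
  have hn0 : 0 < n := Fintype.card_pos
  obtain ⟨K, hK⟩ : ∃ K, K = C + C1 + 3 := ⟨_, rfl⟩
  refine ⟨1 + n * (K + 1) + n * C1 + n * C,
    (n + n * C) * K + K + C2 + C + n + n * C + 3, ?_⟩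
  intro μ P hP hP0 Xs h1 h2 h3
  -- the parameters
  obtain ⟨s, hs⟩ : ∃ s, s = (P - 1) / n := ⟨_, rfl⟩
  have hs1 : n * s ≤ P - 1 := by rw [hs]; exact Nat.mul_div_le _ _
  have hs2 : P - 1 < n * (s + 1) := by
    rw [hs]; exact Nat.lt_mul_div_succ _ hn0
  have hsC : C ≤ s := by
    by_contra hcon
    have : s + 1 ≤ C := by omega
    have := Nat.mul_le_mul_left n this
    omega
  obtain ⟨l, hl⟩ := Nat.exists_eq_add_of_le' hsC
  obtain ⟨v, hv⟩ : ∃ v, v = P / n := ⟨_, rfl⟩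
  have hv1 : n * v ≤ P := by rw [hv]; exact Nat.mul_div_le _ _
  have hv2 : P < n * (v + 1) := by
    rw [hv]; exact Nat.lt_mul_div_succ _ hn0
  have hvP : v ≤ P := by rw [hv]; exact Nat.div_le_self _ _
  have key := stepanov_core p e φ hφ x0 hφx σ C C1 C2 hC hC1 hC2 μ P hP l (v + (K + 1))
    (by rw [← hn, ← hl]; omega)
    (by
      rw [← hn]
      have a1 : l * P + l * (n * K) ≤ n * l * (v + (K + 1)) := by
        have : n * l * (v + (K + 1)) = l * (n * (v + 1)) + l * (n * K) := by ring
        rw [this]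
        have := Nat.mul_le_mul_left l hv2.le
        omega
      have a2 : P ≤ n * l + n * C + n := by
        have : n * (s + 1) = n * l + n * C + n := by rw [hl]; ring
        omega
      have a3 : P * K ≤ l * (n * K) + (n + n * C) * K := by
        have := Nat.mul_le_mul_right K a2
        nlinarith
      have a4 : P * K = P * C + C1 * P + 3 * P := by rw [hK]; ring
      have : 0 ≤ P * C := Nat.zero_le _
      omega) Xs h1 h2 h3
  have b1 : n * Xs.card ≤ n * (l + (v + (K + 1)) * P + C1 * P + C) := Nat.mul_le_mul_left _ key
  have b2 : n * (l + (v + (K + 1)) * P + C1 * P + C) =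
    n * l + n * v * P + n * (K + 1) * P + n * C1 * P + n * C := by ring
  have b3 : n * v * P ≤ P ^ 2 := by rw [sq]; exact Nat.mul_le_mul_right _ hv1
  have b4 : n * l ≤ P := by
    have : n * s = n * l + n * C := by rw [hl]; ring
    omega
  have b5 : n * C ≤ n * C * P := Nat.le_mul_of_pos_right _ (by omega)
  have b6 : (1 + n * (K + 1) + n * C1 + n * C) * P = P + n * (K + 1) * P + n * C1 * P + n * C * P := by
    ring
  omega

end StepanovMain

section CurveIndep

variable {E : Type*} [Field E]
  {K : Type*} [Field K] [Algebra E[X] K] [IsFractionRing E[X] K]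

lemma as_no_poly (p : ℕ) (hp : p.Prime) (b c : E) (hbc : b ≠ 0 ∨ c ≠ 0) (u : E[X]) :
    u ^ p ≠ X ^ (p - 1) * u + X ^ (p - 1) * (C b * X ^ 2 + C c) := by
  intro h
  have hp2 := hp.two_le
  have hXu : X ∣ u := by
    apply Polynomial.prime_X.dvd_of_dvd_pow (n := p)
    rw [h, ← mul_add]
    exact dvd_mul_of_dvd_left (dvd_pow_self _ (by omega)) _
  obtain ⟨v, rfl⟩ := hXu
  have h1 : X * (v ^ p - v) = C b * X ^ 2 + C c := by
    have hx : (X : E[X]) ^ (p - 1) ≠ 0 := pow_ne_zero _ X_ne_zero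
    apply mul_left_cancel₀ hx
    have e1 : (X : E[X]) ^ p = X ^ (p - 1) * X := by
      rw [← pow_succ]; congr 1; omega
    rw [mul_pow, e1] at h
    linear_combination h
  have hc : c = 0 := by
    have := congrArg (fun r => eval 0 r) h1
    simpa using this.symm
  have hb : b ≠ 0 := by
    rcases hbc with h | h
    · exact h
    · exact absurd hc h
  have h2 : v ^ p - v = C b * X := by
    apply mul_left_cancel₀ (X_ne_zero (R := E))
    rw [h1, hc]; simp; ring
  have h3 : natDegree (v ^ p - v) = 1 := by rw [h2]; exact natDegree_C_mul_X _ hb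
  rcases Nat.eq_zero_or_pos v.natDegree with h0 | h0
  · have : natDegree (v ^ p - v) ≤ 0 := by
      refine (natDegree_sub_le _ _).trans ?_
      rw [natDegree_pow, h0]; simp
    omega
  · have : natDegree (v ^ p - v) = p * v.natDegree := by
      rw [natDegree_sub_eq_left_of_natDegree_lt, natDegree_pow]
      rw [natDegree_pow]
      nlinarith
    rw [this] at h3
    have : 2 ≤ p * v.natDegree := by nlinarith
    omega

lemma as_no_frac (p : ℕ) (hp : p.Prime) (b c : E) (hbc : b ≠ 0 ∨ c ≠ 0) (w : K) :
    w ^ p ≠ algebraMap E[X] _ (X ^ (p - 1)) * w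
      + algebraMap E[X] _ (X ^ (p - 1) * (C b * X ^ 2 + C c)) := by
  intro h
  have hp2 := hp.two_le
  have hIntg : IsIntegral E[X] w := by
    refine ⟨X ^ p - (C (X ^ (p - 1)) * X + C (X ^ (p - 1) * (C b * X ^ 2 + C c))), ?_, ?_⟩
    · apply monic_X_pow_sub
      refine (degree_linear_le).trans_lt ?_
      exact_mod_cast hp2
    · simp only [eval₂_sub, eval₂_pow, eval₂_X, eval₂_add, eval₂_mul, eval₂_C]
      rw [h]; simp
  obtain ⟨u, hu⟩ := IsIntegrallyClosed.isIntegral_iff.mp hIntg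
  apply as_no_poly p hp b c hbc u
  apply IsFractionRing.injective E[X] K
  rw [map_add, map_mul, map_pow, hu, h]

lemma frac_pow_poly (N : ℕ) (hN : 0 < N) (H : E[X]) (w : K)
    (h : w ^ N = algebraMap E[X] _ H) : ∃ u : E[X], u ^ N = H := by
  have hIntg : IsIntegral E[X] w := by
    refine ⟨X ^ N - C H, monic_X_pow_sub_C _ (by omega), ?_⟩
    simp [h]
  obtain ⟨u, hu⟩ := IsIntegrallyClosed.isIntegral_iff.mp hIntg
  refine ⟨u, ?_⟩
  apply IsFractionRing.injective E[X] K
  rw [map_pow, hu, h]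

/-- an `N`-th power criterion: `H ^ k = ν ^ D` forces `H` to be a `D / gcd`-th power. -/
lemma frac_pow_gcd [IsAlgClosed E] (D k : ℕ) (hD : 0 < D) (H : E[X]) (hH : H ≠ 0)
    (ν : K) (h : ν ^ D = algebraMap E[X] _ (H ^ k)) :
    ∃ u : E[X], u ^ (D / D.gcd k) = H := by
  set g := D.gcd k with hg
  have hg0 : 0 < g := Nat.gcd_pos_of_pos_left _ hD
  obtain ⟨N, hN⟩ : g ∣ D := Nat.gcd_dvd_left _ _
  obtain ⟨s, hs⟩ : g ∣ k := Nat.gcd_dvd_right _ _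
  have hDN : D / g = N := by rw [hN]; exact Nat.mul_div_cancel_left _ hg0
  have hcop : N.Coprime s := by
    have := Nat.coprime_div_gcd_div_gcd (m := D) (n := k) (by rw [← hg]; exact hg0)
    rw [← hg, hDN] at this
    rwa [hs, Nat.mul_div_cancel_left _ hg0] at this
  have hN0 : 0 < N := by
    rcases Nat.eq_zero_or_pos N with h0 | h0
    · rw [h0] at hN; omega
    · exact h0
  rw [hDN]
  -- ν^N is a g-th-root-of-unity multiple of H^s
  have h1 : (ν ^ N) ^ g = algebraMap E[X] _ ((H ^ s) ^ g) := by
    rw [← pow_mul, ← pow_mul, mul_comm N g, ← hN, h, mul_comm s g, ← hs]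
  obtain ⟨t, ht⟩ : ∃ t : E[X], algebraMap E[X] (K) t = ν ^ N := by
    have hIntg : IsIntegral E[X] (ν ^ N) := by
      refine ⟨X ^ g - C ((H ^ s) ^ g), monic_X_pow_sub_C _ (by omega), ?_⟩
      rw [eval₂_sub, eval₂_pow, eval₂_X, eval₂_C, h1, sub_self]
    exact IsIntegrallyClosed.isIntegral_iff.mp hIntg
  have h2 : t ^ g = (H ^ s) ^ g := by
    apply IsFractionRing.injective E[X] K
    rw [map_pow, ht, h1]
  have h3 : Associated t (H ^ s) := by
    have d1 : t ∣ H ^ s := (UniqueFactorizationMonoid.pow_dvd_pow_iff_dvd (by omega : g ≠ 0)).mp h2.dvd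
    have d2 : H ^ s ∣ t := (UniqueFactorizationMonoid.pow_dvd_pow_iff_dvd (by omega : g ≠ 0)).mp h2.symm.dvd
    exact associated_of_dvd_dvd d1 d2
  obtain ⟨ε, hε⟩ := h3
  obtain ⟨ω, hω, hω2⟩ := Polynomial.isUnit_iff.mp ε.isUnit
  obtain ⟨η, hη⟩ := IsAlgClosed.exists_pow_nat_eq ω hN0
  -- H^s is an N-th power in the fraction field
  set Hf := algebraMap E[X] (K) H with hHf
  have hHf0 : Hf ≠ 0 := by
    rw [hHf]; intro h0
    exact hH (IsFractionRing.injective E[X] K (by rw [h0, map_zero]))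
  have h4 : (ν * algebraMap E[X] _ (C η)) ^ N = Hf ^ s := by
    rw [mul_pow, ← ht, ← map_pow, ← map_mul, hHf, ← map_pow _ H, ← hε, ← hω2, ← C_pow, hη]
  have hb := Nat.gcd_eq_gcd_ab s N
  rw [hcop.symm.gcd_eq_one] at hb
  apply frac_pow_poly N hN0 H
    ((ν * algebraMap E[X] _ (C η)) ^ (s.gcdA N) * Hf ^ (s.gcdB N))
  rw [mul_pow, ← zpow_natCast, ← zpow_natCast, ← zpow_mul, ← zpow_mul, mul_comm _ (N : ℤ), zpow_mul,
    zpow_natCast, h4, ← zpow_natCast, ← zpow_mul, ← zpow_add₀ hHf0, mul_comm _ (N : ℤ), ← hb]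
  simp [hHf]

lemma as_degree (p : ℕ) [Fact p.Prime] [CharP E p] (b c : E) (hbc : b ≠ 0 ∨ c ≠ 0)
    {L : Type*} [Field L] [IsAlgClosed L] [Algebra (K) L] (z : L)
    (hz : z ^ p = algebraMap (K) L (algebraMap E[X] _ (X ^ (p - 1))) * z
      + algebraMap (K) L
        (algebraMap E[X] _ (X ^ (p - 1) * (C b * X ^ 2 + C c)))) :
    (minpoly (K) z).natDegree = p := by
  have hp : p.Prime := Fact.out
  set A1 : K := algebraMap E[X] _ (X ^ (p - 1)) with hA1
  set A2 : K := algebraMap E[X] _ (X ^ (p - 1) * (C b * X ^ 2 + C c)) with hA2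
  have hchK : CharP K p := by
    have : Function.Injective ((algebraMap E[X] K).comp (C : E →+* E[X])) :=
      (IsFractionRing.injective E[X] K).comp C_injective
    exact charP_of_injective_ringHom this p
  have hchL : CharP L p := charP_of_injective_algebraMap (algebraMap K L).injective p
  let g : K[X] := X ^ p - (C A1 * X + C A2)
  have hgm : g.Monic := by
    apply monic_X_pow_sub
    refine (degree_linear_le).trans_lt ?_
    exact_mod_cast hp.two_le
  have hgz : aeval z g = 0 := by
    simp only [g, map_sub, map_add, map_mul, map_pow, aeval_X, aeval_C]
    rw [hz]; ring
  have hgdeg : g.natDegree = p := by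
    simp only [g]
    rw [natDegree_sub_eq_left_of_natDegree_lt, natDegree_X_pow]
    rw [natDegree_X_pow]
    exact (natDegree_linear_le).trans_lt hp.one_lt
  have hIntg : IsIntegral K z := ⟨g, hgm, hgz⟩
  have hdvd : minpoly K z ∣ g := minpoly.dvd K z hgz
  have hle : (minpoly K z).natDegree ≤ p := by
    rw [← hgdeg]; exact natDegree_le_of_dvd hdvd hgm.ne_zero
  by_contra hne
  have hlt : (minpoly K z).natDegree < p := lt_of_le_of_ne hle hne
  have hpos : 0 < (minpoly K z).natDegree := minpoly.natDegree_pos hIntg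
  set e := (minpoly K z).natDegree with he
  set M := ((minpoly K z).map (algebraMap K L)) with hM
  have hMm : M.Monic := (minpoly.monic hIntg).map _
  have hsplit : M.Splits := IsAlgClosed.splits _
  have hcard : Multiset.card M.roots = e := by
    rw [← hsplit.natDegree_eq_card_roots, hM, natDegree_map]
  have hroot : ∀ r ∈ M.roots, r ^ p = algebraMap K L A1 * r + algebraMap K L A2 := by
    intro r hr
    rw [mem_roots hMm.ne_zero, IsRoot.def, hM, eval_map_algebraMap] at hr
    have : aeval r g = 0 := by
      obtain ⟨k, hk⟩ := hdvd
      rw [hk, map_mul, hr, zero_mul]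
    simp only [g, map_sub, map_add, map_mul, map_pow, aeval_X, aeval_C] at this
    linear_combination this
  have hsum : ∀ S : Multiset L, (∀ r ∈ S, r ^ p = algebraMap K L A1 * r + algebraMap K L A2) →
      S.sum ^ p = algebraMap K L A1 * S.sum + (Multiset.card S : L) * algebraMap K L A2 := by
    intro S
    induction S using Multiset.induction_on with
    | empty => intro _; simp [hp.ne_zero]
    | cons a S ih =>
      intro h
      have h1 := ih (fun r hr => h r (Multiset.mem_cons_of_mem hr))
      have h2 := h a (Multiset.mem_cons_self a S)
      rw [Multiset.sum_cons, add_pow_char, h1, h2, Multiset.card_cons]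
      push_cast; ring
  have h1 := hsum M.roots hroot
  have h2 : M.roots.sum = algebraMap K L (-(minpoly K z).nextCoeff) := by
    have := hsplit.nextCoeff_eq_neg_sum_roots_of_monic hMm
    rw [hM, nextCoeff_map (algebraMap K L).injective] at this
    rw [map_neg, this, neg_neg]
  rw [h2, hcard] at h1
  have h3 : (-(minpoly K z).nextCoeff) ^ p = A1 * (-(minpoly K z).nextCoeff) + (e : K) * A2 := by
    apply (algebraMap K L).injective
    rw [map_pow, h1]; simp only [map_add, map_mul, map_neg, map_natCast]
  have he0 : (e : E) ≠ 0 := by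
    intro h
    rw [CharP.cast_eq_zero_iff E p] at h
    exact absurd (Nat.le_of_dvd hpos h) (by omega)
  apply as_no_frac p hp ((e : E) * b) ((e : E) * c) ?_ (-(minpoly K z).nextCoeff)
  · rw [h3, hA1, hA2]
    congr 1
    have : (e : K) = algebraMap E[X] K (C (e : E)) := by simp
    rw [this, ← map_mul]
    congr 1
    simp only [C_mul]; ring
  · rcases hbc with h | h
    · exact Or.inl (mul_ne_zero he0 h)
    · exact Or.inr (mul_ne_zero he0 h)

theorem curve_indep_aux [IsAlgClosed E] (p : ℕ) [Fact p.Prime] [CharP E p] (b c : E)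
    (hbc : b ≠ 0 ∨ c ≠ 0) (D : ℕ) (hD : 0 < D) (hDp : ¬ p ∣ D) (H : E[X]) (hH : H ≠ 0)
    (hHpow : ∀ d, 1 < d → d ∣ D → ∀ h : E[X], h ^ d ≠ H)
    {L : Type*} [Field L] [IsAlgClosed L] [Algebra E[X] L]
    [Algebra K L] [IsScalarTower E[X] K L] (y z : L)
    (hy : y ^ D = algebraMap E[X] L H)
    (hz : z ^ p = algebraMap E[X] L (X ^ (p - 1)) * z
      + algebraMap E[X] L (X ^ (p - 1) * (C b * X ^ 2 + C c))) :
    LinearIndependent E[X] (fun i : Fin p × Fin D => z ^ (i.1 : ℕ) * y ^ (i.2 : ℕ)) := by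
  have hp : p.Prime := Fact.out
  have hzdeg : (minpoly K z).natDegree = p := by
    apply as_degree (K := K) p b c hbc z
    rw [← IsScalarTower.algebraMap_apply, ← IsScalarTower.algebraMap_apply]; exact hz
  have hzint : IsIntegral K z := by
    by_contra h
    have := minpoly.eq_zero h
    rw [this] at hzdeg
    simp at hzdeg
    exact hp.ne_zero hzdeg.symm
  let K1 : IntermediateField K L := IntermediateField.adjoin K {z}
  have hfin1 : FiniteDimensional K K1 := IntermediateField.adjoin.finiteDimensional hzint
  have hrank1 : Module.finrank K K1 = p := by
    rw [IntermediateField.adjoin.finrank hzint, hzdeg]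
  have hyint : IsIntegral K1 y := by
    refine ⟨X ^ D - C (algebraMap K K1 (algebraMap E[X] K H)), monic_X_pow_sub_C _ (by omega), ?_⟩
    rw [eval₂_sub, eval₂_pow, eval₂_X, eval₂_C, hy, ← IsScalarTower.algebraMap_apply K K1 L, ← IsScalarTower.algebraMap_apply E[X] K L, sub_self]
  set e := (minpoly K1 y).natDegree with he
  have hepos : 0 < e := minpoly.natDegree_pos hyint
  let K2 : IntermediateField K1 L := IntermediateField.adjoin K1 {y}
  have hrank2 : Module.finrank K1 K2 = e := IntermediateField.adjoin.finrank hyint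
  let yg : K2 := IntermediateField.AdjoinSimple.gen K1 y
  have hyg : yg ^ D = algebraMap K1 K2 (algebraMap K K1 (algebraMap E[X] K H)) := by
    apply (algebraMap K2 L).injective
    rw [map_pow]
    have : algebraMap K2 L yg = y := IntermediateField.AdjoinSimple.algebraMap_gen K1 y
    rw [this, hy, ← IsScalarTower.algebraMap_apply K1 K2 L, ← IsScalarTower.algebraMap_apply K K1 L, ← IsScalarTower.algebraMap_apply E[X] K L]
  have hn1 : (Algebra.norm K1 yg) ^ D = (algebraMap K K1 (algebraMap E[X] K H)) ^ e := by
    rw [← map_pow, hyg, Algebra.norm_algebraMap, hrank2]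
  have hn2 : (Algebra.norm K (Algebra.norm K1 yg)) ^ D = algebraMap E[X] K (H ^ (e * p)) := by
    rw [← map_pow, hn1, map_pow, Algebra.norm_algebraMap,
      hrank1, ← pow_mul, map_pow, mul_comm e p]
  obtain ⟨u, hu⟩ := frac_pow_gcd (K := K) D (e * p) hD H hH _ hn2
  have hgcd : D.gcd (e * p) = D.gcd e := by
    apply Nat.Coprime.gcd_mul_right_cancel_right
    exact (Nat.Prime.coprime_iff_not_dvd hp).mpr hDp
  have heD : D ≤ e := by
    by_contra hlt
    push Not at hlt
    rw [hgcd] at hu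
    refine hHpow (D / D.gcd e) ?_ (Nat.div_dvd_of_dvd (Nat.gcd_dvd_left _ _)) u hu
    have h1 : D.gcd e ≤ e := Nat.gcd_le_right _ hepos
    have h2 : D.gcd e ∣ D := Nat.gcd_dvd_left _ _
    obtain ⟨k, hk⟩ := h2
    have hg0 : 0 < D.gcd e := Nat.gcd_pos_of_pos_left _ hD
    have : D / D.gcd e = k := by
      exact Nat.div_eq_of_eq_mul_right hg0 hk
    rw [this]
    by_contra hk1
    have : k ≤ 1 := by omega
    have := Nat.mul_le_mul_left (D.gcd e) this
    omega
  let zg : K1 := IntermediateField.AdjoinSimple.gen K z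
  have hzg : algebraMap K1 L zg = z := IntermediateField.AdjoinSimple.algebraMap_gen K z
  have li1 : LinearIndependent K (fun i : Fin p => zg ^ (i : ℕ)) := by
    have h1 := linearIndependent_pow (K := K) zg
    have h2 : (minpoly K zg).natDegree = p := by
      rw [← hzdeg, ← hzg, minpoly.algebraMap_eq (algebraMap K1 L).injective]
    exact h1.comp (Fin.cast h2.symm) (Fin.cast_injective _)
  have li2 : LinearIndependent K1 (fun i : Fin D => y ^ (i : ℕ)) := by
    have h1 := linearIndependent_pow (K := K1) y
    exact h1.comp (Fin.castLE heD) (Fin.castLE_injective _)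
  have li3 := linearIndependent_smul li1 li2
  have li4 : LinearIndependent E[X] (fun i : Fin p × Fin D => zg ^ (i.1 : ℕ) • y ^ (i.2 : ℕ)) :=
    li3.restrict_scalars' E[X]
  convert li4 using 2 with i
  rw [Algebra.smul_def, map_pow, hzg]


theorem curve_indep [IsAlgClosed E] (p : ℕ) [Fact p.Prime] [CharP E p] (b c : E)
    (hbc : b ≠ 0 ∨ c ≠ 0) (D : ℕ) (hD : 0 < D) (hDp : ¬ p ∣ D) (H : E[X]) (hH : H ≠ 0)
    (hHpow : ∀ d, 1 < d → d ∣ D → ∀ h : E[X], h ^ d ≠ H)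
    {L : Type*} [Field L] [IsAlgClosed L] [Algebra E[X] L]
    (hinj : Function.Injective (algebraMap E[X] L)) (y z : L)
    (hy : y ^ D = algebraMap E[X] L H)
    (hz : z ^ p = algebraMap E[X] L (X ^ (p - 1)) * z
      + algebraMap E[X] L (X ^ (p - 1) * (C b * X ^ 2 + C c))) :
    LinearIndependent E[X] (fun i : Fin p × Fin D => z ^ (i.1 : ℕ) * y ^ (i.2 : ℕ)) := by
  have : FaithfulSMul E[X] L := (faithfulSMul_iff_algebraMap_injective E[X] L).mpr hinj
  let : Algebra (FractionRing E[X]) L := FractionRing.liftAlgebra E[X] L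
  have : IsScalarTower E[X] (FractionRing E[X]) L := FractionRing.isScalarTower_liftAlgebra E[X] L
  exact curve_indep_aux (K := FractionRing E[X]) p b c hbc D hD hDp H hH hHpow y z hy hz

end CurveIndep

universe u

lemma two_root_ring {R : Type u} [CommRing R] [Nontrivial R] (fz fy : R[X]) (hz : fz.Monic)
    (hy : fy.Monic) (np nD : ℕ) (hnp : fz.natDegree = np) (hnD : fy.natDegree = nD) (hp0 : 0 < np) :
    ∃ (B : Type u) (_ : CommRing B) (_ : Algebra R B) (z y : B)
      (e : Module.Basis (Fin np × Fin nD) R B), (∀ i, e i = z ^ (i.1 : ℕ) * y ^ (i.2 : ℕ)) ∧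
      aeval z fz = 0 ∧ aeval y fy = 0 ∧
      ∀ (S : Type u) [CommRing S] (f : R →+* S) (zs ys : S), fz.eval₂ f zs = 0 → fy.eval₂ f ys = 0 →
        ∃ π : B →+* S, (∀ r, π (algebraMap R B r) = f r) ∧ π z = zs ∧ π y = ys := by
  let B1 := AdjoinRoot fz
  let b1 : Module.Basis (Fin np) R B1 :=
    ((AdjoinRoot.powerBasis' hz).basis).reindex (finCongr (by simp [hnp]))
  have hB1 : Nontrivial B1 := by
    have : Nonempty (Fin np) := ⟨⟨0, hp0⟩⟩
    exact b1.repr.toEquiv.nontrivial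
  let fy1 : B1[X] := fy.map (algebraMap R B1)
  have hfy1 : fy1.Monic := hy.map _
  let B := AdjoinRoot fy1
  have hd : fy1.natDegree = nD := by rw [hy.natDegree_map]; exact hnD
  let b2 : Module.Basis (Fin nD) B1 B :=
    ((AdjoinRoot.powerBasis' hfy1).basis).reindex (finCongr (by simp [hd]))
  refine ⟨B, inferInstance, inferInstance, AdjoinRoot.of fy1 (AdjoinRoot.root fz),
    AdjoinRoot.root fy1, b1.smulTower b2, ?_, ?_, ?_, ?_⟩
  · rintro ⟨i, j⟩
    rw [Module.Basis.smulTower_apply]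
    simp only [b1, b2, Module.Basis.reindex_apply, PowerBasis.basis_eq_pow, AdjoinRoot.powerBasis'_gen]
    rw [Algebra.smul_def]
    simp [B]
  · have h1 : aeval (AdjoinRoot.root fz) fz = 0 := by
      rw [AdjoinRoot.aeval_eq, AdjoinRoot.mk_self]
    have : AdjoinRoot.of fy1 (AdjoinRoot.root fz) = algebraMap B1 B (AdjoinRoot.root fz) := rfl
    rw [this, aeval_algebraMap_apply, h1, map_zero]
  · have h1 : eval₂ (AdjoinRoot.of fy1) (AdjoinRoot.root fy1) fy1 = 0 := AdjoinRoot.eval₂_root fy1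
    simp only [fy1] at h1
    rw [eval₂_map] at h1
    rw [aeval_def]
    exact h1
  · intro S _ f zs ys h1 h2
    let π1 : B1 →+* S := AdjoinRoot.lift f zs h1
    have hπ1 : ∀ r, π1 (algebraMap R B1 r) = f r := fun r => AdjoinRoot.lift_of h1
    have h3 : fy1.eval₂ π1 ys = 0 := by
      simp only [fy1]
      rw [eval₂_map]
      have : π1.comp (algebraMap R B1) = f := RingHom.ext hπ1
      rw [this]; exact h2
    refine ⟨AdjoinRoot.lift π1 ys h3, ?_, ?_, ?_⟩
    · intro r
      rw [← hπ1]
      exact AdjoinRoot.lift_of h3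
    · have : AdjoinRoot.lift π1 ys h3 (AdjoinRoot.of fy1 (AdjoinRoot.root fz)) = π1 (AdjoinRoot.root fz) :=
        AdjoinRoot.lift_of h3
      rw [this]; exact AdjoinRoot.lift_root h1
    · exact AdjoinRoot.lift_root h3

section CurveBound

variable {E : Type u} [Field E]

lemma hensel_ps (f : (PowerSeries E)[X]) (hf : f.Monic) (a0 : E)
    (h0 : (f.map (PowerSeries.constantCoeff (R := E))).eval a0 = 0)
    (h1 : ((derivative f).map (PowerSeries.constantCoeff (R := E))).eval a0 ≠ 0) :
    ∃ a : PowerSeries E, f.eval a = 0 := by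
  have hc : ∀ g : (PowerSeries E)[X], PowerSeries.constantCoeff (g.eval (PowerSeries.C a0))
      = (g.map (PowerSeries.constantCoeff (R := E))).eval a0 := by
    intro g
    rw [eval_map, ← eval₂_at_apply]
    simp
  obtain ⟨a, ha, _⟩ := HenselianRing.is_henselian
    (I := (Ideal.span {PowerSeries.X} : Ideal (PowerSeries E))) f hf (PowerSeries.C a0)
    (by
      rw [Ideal.mem_span_singleton, PowerSeries.X_dvd_iff, hc, h0])
    (by
      apply IsUnit.map
      rw [PowerSeries.isUnit_iff_constantCoeff, hc]
      exact isUnit_iff_ne_zero.mpr h1)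
  exact ⟨a, ha⟩

lemma sep_grid [IsAlgClosed E] (f : E[X]) (hf : f.Separable) (n : ℕ) (hn : f.natDegree = n)
    (a : Fin n → E) (h : ∀ r, f.eval r = 0 → ∑ i, a i * r ^ (i : ℕ) = 0) : a = 0 := by
  let g : E[X] := ∑ i, C (a i) * X ^ (i : ℕ)
  have hgdeg : g ∈ degreeLT E n := by
    refine Submodule.sum_mem _ fun i _ => ?_
    rw [mem_degreeLT]
    exact (degree_C_mul_X_pow_le _ _).trans_lt (by exact_mod_cast i.2)
  have hg0 : g = 0 := by
    by_contra hne
    have h1 : f.roots.toFinset.card ≤ g.natDegree := by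
      apply Polynomial.card_le_degree_of_subset_roots
      intro r hr
      rw [Finset.mem_val, Multiset.mem_toFinset, mem_roots hf.ne_zero] at hr
      rw [mem_roots hne, IsRoot.def]
      simp only [g, eval_finsetSum, eval_mul, eval_C, eval_pow, eval_X]
      exact h r hr
    have h2 : f.roots.toFinset.card = n := by
      rw [Multiset.toFinset_card_of_nodup (nodup_roots hf),
        ← (IsAlgClosed.splits f).natDegree_eq_card_roots, hn]
    rw [mem_degreeLT, degree_eq_natDegree hne] at hgdeg
    have : g.natDegree < n := by exact_mod_cast hgdeg
    omega
  funext i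
  have := congrArg (fun r => coeff r (i : ℕ)) hg0
  simp only [g, finsetSum_coeff, coeff_C_mul, coeff_X_pow, coeff_zero, mul_ite, mul_one, mul_zero,
    Fin.val_inj] at this
  simpa using this

lemma exists_algClosed_extension (E : Type u) [Field E] : ∃ (L : Type u) (_ : Field L) (_ : IsAlgClosed L)
    (j : PowerSeries E →+* L), Function.Injective j := by
  refine ⟨AlgebraicClosure (FractionRing (PowerSeries E)), inferInstance, inferInstance,
    (algebraMap (FractionRing (PowerSeries E)) _).comp (algebraMap (PowerSeries E) _), ?_⟩
  exact (algebraMap (FractionRing (PowerSeries E)) _).injective.comp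
    (IsFractionRing.injective (PowerSeries E) _)

/-- the Artin–Schreier type polynomial -/
noncomputable def asPoly (p : ℕ) (b c : E) : E[X][X] :=
  X ^ p - (C (X ^ (p - 1)) * X + C (X ^ (p - 1) * (C b * X ^ 2 + C c)))

lemma asPoly_monic (p : ℕ) (hp : p.Prime) (b c : E) : (asPoly p b c).Monic := by
  apply monic_X_pow_sub
  refine (degree_linear_le).trans_lt ?_
  exact_mod_cast hp.two_le

lemma asPoly_natDegree (p : ℕ) (hp : p.Prime) (b c : E) : (asPoly p b c).natDegree = p := by
  unfold asPoly
  rw [natDegree_sub_eq_left_of_natDegree_lt, natDegree_X_pow]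
  rw [natDegree_X_pow]
  exact (natDegree_linear_le).trans_lt hp.one_lt

lemma asPoly_eval₂ (p : ℕ) (b c : E) {S : Type*} [CommRing S] (f : E[X] →+* S) (s : S) :
    (asPoly p b c).eval₂ f s = s ^ p - (f (X ^ (p - 1)) * s + f (X ^ (p - 1) * (C b * X ^ 2 + C c))) := by
  simp only [asPoly, eval₂_sub, eval₂_pow, eval₂_X, eval₂_add, eval₂_mul, eval₂_C]

lemma asPoly_map (p : ℕ) (b c : E) {S : Type*} [CommRing S] (f : E[X] →+* S) :
    (asPoly p b c).map f = X ^ p - (C (f (X ^ (p - 1))) * X + C (f (X ^ (p - 1) * (C b * X ^ 2 + C c)))) := by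
  simp only [asPoly, Polynomial.map_sub, Polynomial.map_pow, map_X, Polynomial.map_add,
    Polynomial.map_mul, map_C]

lemma as_sep (p : ℕ) [Fact p.Prime] [CharP E p] (u v : E) (hu : u ≠ 0) :
    (X ^ p - (C u * X + C v) : E[X]).Separable := by
  have : derivative (X ^ p - (C u * X + C v) : E[X]) = C (-u) := by
    simp [derivative_X_pow]
  rw [Polynomial.separable_def, this]
  exact isCoprime_one_right.of_isCoprime_of_dvd_right
    ((isUnit_C.mpr (isUnit_iff_ne_zero.mpr (neg_ne_zero.mpr hu))).dvd)

lemma as_deg' (p : ℕ) (hp : p.Prime) (u v : E) :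
    (X ^ p - (C u * X + C v) : E[X]).natDegree = p := by
  rw [natDegree_sub_eq_left_of_natDegree_lt, natDegree_X_pow]
  rw [natDegree_X_pow]
  exact (natDegree_linear_le).trans_lt hp.one_lt

lemma as_frob (p : ℕ) [Fact p.Prime] [CharP E p] (w G : E) (h : w ^ p = w + G) (ν : ℕ) :
    w ^ (p ^ ν) = w + ∑ i ∈ Finset.range ν, G ^ (p ^ i) := by
  induction ν with
  | zero => simp
  | succ ν ih =>
    rw [Finset.sum_range_succ, pow_succ', pow_mul, h, add_pow_char_pow, ih]
    ring


theorem curve_bound [IsAlgClosed E] (p : ℕ) [Fact p.Prime] [CharP E p] (b c : E)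
    (hbc : b ≠ 0 ∨ c ≠ 0) (D : ℕ) (hD : 0 < D) (hDp : ¬ p ∣ D) (H : E[X]) (hH : H ≠ 0)
    (hHpow : ∀ d, 1 < d → d ∣ D → ∀ h : E[X], h ^ d ≠ H)
    (ζ : E) (hζ : ζ ^ D = 1) (t : E) (ht : t ^ p = t) :
    ∃ C0 P0 : ℕ, ∀ μ P : ℕ, P = p ^ μ → P0 ≤ P → D ∣ P ^ 2 - 1 → ∀ Xs : Finset E,
      (∀ x ∈ Xs, x ≠ 0 ∧ H.eval x ≠ 0 ∧ x ^ (P ^ 2) = x ∧ H.eval x ^ ((P ^ 2 - 1) / D) = ζ ∧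
        ∑ i ∈ Finset.range (2 * μ), (b * x + c * x⁻¹) ^ (p ^ i) = t) →
      p * D * Xs.card ≤ P ^ 2 + C0 * P := by
  have hp : p.Prime := Fact.out
  have hDE : (D : E) ≠ 0 := by
    intro h; rw [CharP.cast_eq_zero_iff E p] at h; exact hDp h
  obtain ⟨B, _, _, z, y, e, he, hz, hy, huniv⟩ := two_root_ring (asPoly p b c) (X ^ D - C H)
    (asPoly_monic p hp b c) (monic_X_pow_sub_C _ hD.ne') p D (asPoly_natDegree p hp b c)
    (natDegree_X_pow_sub_C) hp.pos
  rw [aeval_def, asPoly_eval₂] at hz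
  have hyB : y ^ D = algebraMap E[X] B H := by
    simpa [sub_eq_zero] using hy
  let : Algebra E B := ((algebraMap E[X] B).comp C).toAlgebra
  have : IsScalarTower E E[X] B := IsScalarTower.of_algebraMap_eq (fun _ => rfl)
  -- base point
  obtain ⟨x0, hx0⟩ : ∃ x0 : E, (X * H).eval x0 ≠ 0 := by
    by_contra hcon
    push Not at hcon
    exact mul_ne_zero X_ne_zero hH (Polynomial.funext (fun r => by rw [hcon r, eval_zero]))
  rw [eval_mul, eval_X, mul_ne_zero_iff] at hx0
  let ε : E[X] →+* PowerSeries E := (Polynomial.coeToPowerSeries.ringHom).comp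
    (Polynomial.compRingHom (X + C x0))
  have hεdef : ∀ r, ε r = ((r.comp (X + C x0) : E[X]) : PowerSeries E) := fun r => rfl
  have hε : ∀ r, PowerSeries.constantCoeff (ε r) = r.eval x0 := by
    intro r
    rw [hεdef, Polynomial.constantCoeff_coe, coeff_zero_eq_eval_zero, eval_comp]; simp
  have hεx : ∀ r : E[X], ε (r.comp (X - C x0)) = (r : PowerSeries E) := by
    intro r
    rw [hεdef, comp_assoc]; simp
  have hεinj : Function.Injective ε := by
    rw [injective_iff_map_eq_zero]
    intro r hr
    rw [hεdef] at hr
    have h1 : r.comp (X + C x0) = 0 := by exact_mod_cast hr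
    have h2 := congrArg (fun s => s.comp (X - C x0)) h1
    simpa [comp_assoc] using h2
  -- Hensel lifts
  obtain ⟨ys, hys⟩ : ∃ ys : PowerSeries E, ys ^ D = ε H := by
    obtain ⟨a0, ha0⟩ := IsAlgClosed.exists_pow_nat_eq (H.eval x0) hD
    obtain ⟨a, ha⟩ := hensel_ps (X ^ D - C (ε H)) (monic_X_pow_sub_C _ hD.ne') a0
      (by simp [hε, ha0]) (by
        simp only [derivative_sub, derivative_X_pow, derivative_C, sub_zero, Polynomial.map_mul,
          Polynomial.map_pow, map_X, map_C, eval_mul, eval_pow, eval_X, eval_C, map_natCast]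
        refine mul_ne_zero (by simpa using hDE) (pow_ne_zero _ ?_)
        rintro rfl
        rw [zero_pow hD.ne'] at ha0
        exact hx0.2 ha0.symm)
    refine ⟨a, ?_⟩
    simpa [sub_eq_zero] using ha
  have hchP : CharP (PowerSeries E) p :=
    charP_of_injective_ringHom (f := (PowerSeries.C : E →+* PowerSeries E)) PowerSeries.C_injective p
  obtain ⟨zs, hzs⟩ : ∃ zs : PowerSeries E, (asPoly p b c).eval₂ ε zs = 0 := by
    have hmap : ((asPoly p b c).map ε).map (PowerSeries.constantCoeff (R := E)) =
        X ^ p - (C (x0 ^ (p - 1)) * X + C (x0 ^ (p - 1) * (b * x0 ^ 2 + c))) := by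
      rw [asPoly_map]
      simp [hε, Polynomial.map_sub, Polynomial.map_add, Polynomial.map_mul]
    have hu : x0 ^ (p - 1) ≠ 0 := pow_ne_zero _ hx0.1
    have hs := as_sep p (x0 ^ (p - 1)) (x0 ^ (p - 1) * (b * x0 ^ 2 + c)) hu
    obtain ⟨a0, ha0⟩ := IsAlgClosed.exists_root
      (X ^ p - (C (x0 ^ (p - 1)) * X + C (x0 ^ (p - 1) * (b * x0 ^ 2 + c))) : E[X]) (by
        intro h0
        have := natDegree_eq_of_degree_eq_some h0
        rw [as_deg' p hp] at this
        exact hp.ne_zero this)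
    obtain ⟨a, ha⟩ := hensel_ps ((asPoly p b c).map ε) ((asPoly_monic p hp b c).map _) a0
      (by rw [hmap]; exact ha0) (by
        rw [← derivative_map, hmap]
        intro h0
        exact hs.eval₂_derivative_ne_zero (RingHom.id E) (by simpa [eval₂_id] using ha0)
          (by simpa [eval₂_id] using h0))
    exact ⟨a, by rw [← eval_map]; exact ha⟩
  obtain ⟨φ, hφr, hφz, hφy⟩ := huniv (PowerSeries E) ε zs ys hzs (by
    rw [eval₂_sub, eval₂_pow, eval₂_X, eval₂_C, hys, sub_self])
  -- injectivity
  have hφ : Function.Injective φ := by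
    obtain ⟨L, _, _, j, hj⟩ := exists_algClosed_extension E
    let : Algebra E[X] L := (j.comp ε).toAlgebra
    have hal : ∀ r, algebraMap E[X] L r = j (ε r) := fun r => rfl
    rw [asPoly_eval₂, sub_eq_zero] at hzs
    have li := curve_indep p b c hbc D hD hDp H hH hHpow (L := L) (hj.comp hεinj) (j ys) (j zs)
      (by rw [hal, ← hys, map_pow]) (by rw [hal, hal, ← map_pow, hzs, map_add, map_mul])
    rw [injective_iff_map_eq_zero]
    intro β hβ
    have h1 : ∑ i, e.repr β i • (j zs ^ (i.1 : ℕ) * j ys ^ (i.2 : ℕ)) = 0 := by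
      have h2 : j (φ β) = 0 := by rw [hβ, map_zero]
      rw [← e.sum_repr β, map_sum, map_sum] at h2
      rw [← h2]
      refine Finset.sum_congr rfl fun i _ => ?_
      rw [Algebra.smul_def, Algebra.smul_def, hal, he, map_mul, hφr, map_mul, map_mul, map_pow, map_pow,
        hφz, hφy, map_mul, map_pow, map_pow]
    have h3 := Fintype.linearIndependent_iff.mp li _ h1
    apply e.repr.injective
    ext i
    rw [h3 i]; simp
  -- the automorphism
  have hchB : CharP B p := by
    have : Function.Injective (φ.comp ((algebraMap E[X] B).comp C)) := by
      have : φ.comp ((algebraMap E[X] B).comp C) = ε.comp C := RingHom.ext fun r => hφr _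
      rw [this]
      exact hεinj.comp C_injective
    exact charP_of_injective_ringHom (f := (algebraMap E[X] B).comp C)
      (Function.Injective.of_comp (f := φ) this) p
  obtain ⟨σ0, hσr, hσz, hσy⟩ := huniv B (algebraMap E[X] B) (z + algebraMap E[X] B (C t * X))
    (algebraMap E[X] B (C ζ) * y) (by
      rw [asPoly_eval₂, add_pow_char]
      have h1 : (algebraMap E[X] B (C t * X)) ^ p =
          algebraMap E[X] B (X ^ (p - 1)) * algebraMap E[X] B (C t * X) := by
        rw [← map_pow, ← map_mul]
        congr 1
        rw [mul_pow, ← C_pow, ht]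
        have : (X : E[X]) ^ p = X ^ (p - 1) * X := by
          rw [← pow_succ]; congr 1; have := hp.pos; omega
        rw [this]; ring
      rw [h1]
      linear_combination hz) (by
      rw [eval₂_sub, eval₂_pow, eval₂_X, eval₂_C, mul_pow, hyB, ← map_pow, ← C_pow, hζ]
      simp)
  let σ : B →ₐ[E[X]] B := { σ0 with commutes' := hσr }
  have hσdef : ∀ β, σ β = σ0 β := fun β => rfl
  have hne : Nonempty (Fin p × Fin D) := ⟨(⟨0, hp.pos⟩, ⟨0, hD⟩)⟩
  obtain ⟨C0, P0, hmain⟩ := stepanov_abstract p e φ hφ x0 (fun r => by rw [hφr, hεx]) σ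
  refine ⟨C0, P0, fun μ P hP hP0 hDP Xs hXs => ?_⟩
  have hfin := hmain μ P hP hP0 Xs (fun x hx => (hXs x hx).2.2.1) ?_ ?_
  · simpa using hfin
  · -- coordinates vanish
    intro x hx β hβ
    obtain ⟨hx0', hHx, -⟩ := hXs x hx
    have hu : x ^ (p - 1) ≠ 0 := pow_ne_zero _ hx0'
    have hgrid : ∀ z1 y1 : E, (X ^ p - (C (x ^ (p - 1)) * X + C (x ^ (p - 1) * (b * x ^ 2 + c))) : E[X]).eval z1 = 0 →
        (X ^ D - C (H.eval x) : E[X]).eval y1 = 0 →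
        ∑ i, (∑ k, (e.repr β (i, k)).eval x * y1 ^ (k : ℕ)) * z1 ^ (i : ℕ) = 0 := by
      intro z1 y1 h1 h2
      obtain ⟨π, hπr, hπz, hπy⟩ := huniv E (evalRingHom x) z1 y1 (by
        rw [asPoly_eval₂]
        simpa using h1) (by
        rw [eval₂_sub, eval₂_pow, eval₂_X, eval₂_C]
        simpa using h2)
      have h3 := hβ π hπr
      rw [← e.sum_repr β, map_sum] at h3
      rw [← h3, Fintype.sum_prod_type]
      refine Finset.sum_congr rfl fun i _ => ?_
      rw [Finset.sum_mul]
      refine Finset.sum_congr rfl fun k _ => ?_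
      rw [Algebra.smul_def, map_mul, hπr, he, map_mul, map_pow, map_pow, hπz, hπy]
      simp only [coe_evalRingHom]
      ring
    have hg1 : ∀ y1 : E, (X ^ D - C (H.eval x) : E[X]).eval y1 = 0 → ∀ i,
        ∑ k, (e.repr β (i, k)).eval x * y1 ^ (k : ℕ) = 0 := by
      intro y1 hy1 i
      exact congrFun (sep_grid _ (as_sep p _ _ hu) p (as_deg' p hp _ _)
        (fun i => ∑ k, (e.repr β (i, k)).eval x * y1 ^ (k : ℕ)) (fun z1 hz1 => hgrid z1 y1 hz1 hy1)) i
    rintro ⟨i, k⟩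
    exact congrFun (sep_grid _ (separable_X_pow_sub_C (H.eval x) hDE hHx) D natDegree_X_pow_sub_C
      (fun k => (e.repr β (i, k)).eval x) (fun y1 hy1 => hg1 y1 hy1 i)) k
  · intro x hx π hπ
    obtain ⟨hx0', hHx, hxP, hHP, hT⟩ := hXs x hx
    rintro ⟨i, k⟩
    have hy1 : (π y) ^ D = H.eval x := by rw [← map_pow, hyB, hπ]
    have hyP : (π y) ^ (P ^ 2) = ζ * π y := by
      have hP1 : 1 ≤ P ^ 2 := by
        rw [hP]; exact Nat.one_le_pow _ _ (Nat.pow_pos hp.pos)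
      have : P ^ 2 = D * ((P ^ 2 - 1) / D) + 1 := by
        rw [Nat.mul_div_cancel' hDP]; omega
      rw [this, pow_succ, pow_mul, hy1, hHP]
    have hz1 : (π z) ^ p = x ^ (p - 1) * π z + x ^ (p - 1) * (b * x ^ 2 + c) := by
      have := congrArg π hz
      rw [map_sub, map_add, map_mul, hπ, hπ, map_pow, map_zero, sub_eq_zero] at this
      simpa using this
    have hxp : x ^ p = x ^ (p - 1) * x := by
      rw [← pow_succ]; congr 1; have := hp.pos; omega
    have hw : (π z * x⁻¹) ^ p = π z * x⁻¹ + (b * x + c * x⁻¹) := by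
      rw [mul_pow, hz1, inv_pow, hxp]
      have : x ^ (p - 1) ≠ 0 := pow_ne_zero _ hx0'
      field_simp
    have hwP := as_frob p _ _ hw (2 * μ)
    rw [hT] at hwP
    have hP2 : P ^ 2 = p ^ (2 * μ) := by rw [hP, ← pow_mul, mul_comm]
    have hzP : (π z) ^ (P ^ 2) = π z + t * x := by
      rw [← hP2, mul_pow, inv_pow, hxP] at hwP
      field_simp at hwP
      linear_combination hwP
    rw [he, hσdef, map_mul σ0, map_pow, map_pow, hσz, hσy, map_mul, map_pow, map_pow, mul_pow, ← pow_mul,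
      ← pow_mul, mul_comm (i : ℕ), mul_comm (k : ℕ), pow_mul, pow_mul, hzP, hyP]
    rw [map_mul π, map_pow π, map_pow π, map_add, hπ, map_mul π, hπ]
    simp

end CurveBound

lemma fiber_bound {α ι : Type*} (I : Finset ι) (X : ι → ℂ) (hX : ∀ i ∈ I, ‖X i‖ ≤ 1)
    (hsum : ∑ i ∈ I, X i = 0) (G : Finset α) (φ : α → ι) (hφ : ∀ a ∈ G, φ a ∈ I)
    (V : ℝ) (w : ℕ) (hw : 0 < w) (hI : I.card ≤ w) (hV0 : 0 ≤ V)
    (hV : ∀ i ∈ I, (w : ℝ) * (G.filter (fun a => φ a = i)).card ≤ V) :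
    ‖∑ a ∈ G, X (φ a)‖ ≤ V - G.card := by
  have hwR : (0:ℝ) < w := by exact_mod_cast hw
  have h1 : ∑ a ∈ G, X (φ a) = ∑ i ∈ I, ((G.filter (fun a => φ a = i)).card : ℂ) * X i := by
    rw [← Finset.sum_fiberwise_of_maps_to hφ]
    refine Finset.sum_congr rfl fun i _ => ?_
    rw [Finset.sum_congr rfl (g := fun _ => X i)]
    · simp
    · intro a ha; rw [(Finset.mem_filter.1 ha).2]
  have h2 : (w : ℂ) * ∑ a ∈ G, X (φ a)
      = ∑ i ∈ I, (((w : ℝ) * ((G.filter (fun a => φ a = i)).card : ℝ) - V : ℝ) : ℂ) * X i := by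
    rw [h1, Finset.mul_sum]
    have : ∑ i ∈ I, (V : ℂ) * X i = 0 := by rw [← Finset.mul_sum, hsum, mul_zero]
    rw [← sub_zero (∑ i ∈ I, _), ← this, ← Finset.sum_sub_distrib]
    refine Finset.sum_congr rfl fun i _ => ?_
    push_cast; ring
  have h3 : (w : ℝ) * ‖∑ a ∈ G, X (φ a)‖ ≤ w * (V - G.card) := by
    have : (w : ℝ) * ‖∑ a ∈ G, X (φ a)‖ = ‖(w : ℂ) * ∑ a ∈ G, X (φ a)‖ := by
      rw [norm_mul]; simp
    rw [this, h2]
    calc _ ≤ ∑ i ∈ I, ‖(((w : ℝ) * ((G.filter (fun a => φ a = i)).card : ℝ) - V : ℝ) : ℂ) * X i‖ :=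
          norm_sum_le _ _
      _ ≤ ∑ i ∈ I, (V - w * ((G.filter (fun a => φ a = i)).card : ℝ)) := by
          refine Finset.sum_le_sum fun i hi => ?_
          rw [norm_mul, Complex.norm_real, Real.norm_eq_abs, abs_of_nonpos (by linarith [hV i hi])]
          have := hX i hi
          have h0 := hV i hi
          nlinarith [norm_nonneg (X i)]
      _ = I.card * V - w * G.card := by
          rw [Finset.sum_sub_distrib, ← Finset.mul_sum, Finset.card_eq_sum_card_fiberwise hφ]
          simp
      _ ≤ w * (V - G.card) := by
          have : (I.card : ℝ) ≤ w := by exact_mod_cast hI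
          nlinarith
  exact le_of_mul_le_mul_left h3 hwR

lemma monic_root {E : Type*} [Field E] {H h : E[X]} (hH : H.Monic) {d : ℕ} (hd : d ≠ 0)
    (h1 : h ^ d = H) : ∃ h' : E[X], h'.Monic ∧ h' ^ d = H := by
  have hlc : h.leadingCoeff ^ d = 1 := by rw [← leadingCoeff_pow, h1, hH]
  have h0 : h.leadingCoeff ≠ 0 := by
    intro h; rw [h, zero_pow hd] at hlc; exact zero_ne_one hlc
  refine ⟨C h.leadingCoeff⁻¹ * h, ?_, ?_⟩
  · rw [Monic, leadingCoeff_mul, leadingCoeff_C, inv_mul_cancel₀ h0]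
  · rw [mul_pow, ← C_pow, inv_pow, hlc, h1]; simp

lemma monic_pow_inj {E : Type*} [Field E] {H h : E[X]} (hH : H.Monic) (hh : h.Monic) {d : ℕ}
    (hd : d ≠ 0) (h1 : h ^ d = H ^ d) : h = H := by
  refine eq_of_monic_of_associated hh hH (associated_of_dvd_dvd ?_ ?_)
  · exact (UniqueFactorizationMonoid.pow_dvd_pow_iff_dvd hd).1 h1.dvd
  · exact (UniqueFactorizationMonoid.pow_dvd_pow_iff_dvd hd).1 h1.symm.dvd

/-- The maximal root `H` of a monic polynomial with respect to divisors of `n`. -/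
lemma exists_max_root {E : Type*} [Field E] (Fp : E[X]) (hFp : Fp.Monic) (n : ℕ) (hn : 0 < n) :
    ∃ (D N0 : ℕ) (H : E[X]), 0 < D ∧ D * N0 = n ∧ H.Monic ∧ H ^ N0 = Fp ∧
      (∀ d, 1 < d → d ∣ D → ∀ h : E[X], h ^ d ≠ H) := by
  let S := n.divisors.filter (fun N => ∃ H : E[X], H.Monic ∧ H ^ N = Fp)
  have hS : S.Nonempty := ⟨1, by simp [S, hn.ne', hFp]⟩
  obtain ⟨N0, hN0, hmax⟩ := S.exists_max_image id hS
  simp only [S, Finset.mem_filter, Nat.mem_divisors, id] at hN0 hmax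
  obtain ⟨⟨⟨D, hD⟩, -⟩, H, hH, hHF⟩ := hN0
  have hN0 : 0 < N0 := by rcases Nat.eq_zero_or_pos N0 with h | h; · simp [h] at hD; omega
                          · exact h
  refine ⟨D, N0, H, ?_, by rw [hD, mul_comm], hH, hHF, ?_⟩
  · rcases Nat.eq_zero_or_pos D with h | h; · simp [h] at hD; omega
    · exact h
  intro d hd hdD h hh
  obtain ⟨h', hm, hh'⟩ := monic_root hH (by omega) hh
  have := hmax (N0 * d) ⟨⟨hD ▸ Nat.mul_dvd_mul_left _ hdD, hn.ne'⟩, h', hm, by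
    rw [mul_comm, pow_mul, hh', hHF]⟩
  nlinarith

/-- fixed points of the `r`-th power of the `Q`-Frobenius -/
noncomputable def fixedPts (E : Type*) [Field E] (Q r : ℕ) : Finset E :=
  (X ^ (Q ^ r) - X : E[X]).roots.toFinset

lemma mem_fixedPts {E : Type*} [Field E] {Q r : ℕ} (h : 1 < Q ^ r) {x : E} :
    x ∈ fixedPts E Q r ↔ x ^ Q ^ r = x := by
  rw [fixedPts, Multiset.mem_toFinset, mem_roots (FiniteField.X_pow_card_sub_X_ne_zero E h)]
  simp [sub_eq_zero]

lemma card_fixedPts {E : Type*} [Field E] [IsAlgClosed E] (p : ℕ) [CharP E p] {Q r : ℕ}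
    (h : 1 < Q ^ r) (hp : p ∣ Q ^ r) : (fixedPts E Q r).card = Q ^ r := by
  have hs := galois_poly_separable (K := E) p (Q ^ r) hp
  rw [fixedPts, Multiset.toFinset_card_of_nodup (nodup_roots hs),
    ← (IsAlgClosed.splits _).natDegree_eq_card_roots,
    FiniteField.X_pow_card_sub_X_natDegree_eq E h]

/-- fixed points of the `p`-Frobenius come from the prime field -/
lemma exists_zmod_of_pow_eq {E : Type*} [Field E] (p : ℕ) [Fact p.Prime] [CharP E p] (w : E)
    (hw : w ^ p = w) : ∃ a : ZMod p, ZMod.castHom dvd_rfl E a = w := by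
  have hp : 1 < p := (Fact.out : p.Prime).one_lt
  have hinj : Function.Injective (ZMod.castHom (dvd_refl p) E) := RingHom.injective _
  have hsub : Finset.univ.image (ZMod.castHom (dvd_refl p) E) ⊆
      (X ^ p - X : E[X]).roots.toFinset := by
    intro x hx
    obtain ⟨a, -, rfl⟩ := Finset.mem_image.1 hx
    rw [Multiset.mem_toFinset, mem_roots (FiniteField.X_pow_card_sub_X_ne_zero E hp)]
    simp only [IsRoot.def, eval_sub, eval_pow, eval_X]
    rw [← map_pow, ZMod.pow_card, sub_self]
  have heq := Finset.eq_of_subset_of_card_le hsub (by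
    rw [Finset.card_image_of_injective _ hinj, Finset.card_univ, ZMod.card]
    refine (Multiset.toFinset_card_le _).trans ((card_roots' _).trans ?_)
    rw [FiniteField.X_pow_card_sub_X_natDegree_eq E hp])
  have : w ∈ (X ^ p - X : E[X]).roots.toFinset := by
    rw [Multiset.mem_toFinset, mem_roots (FiniteField.X_pow_card_sub_X_ne_zero E hp)]
    simp [hw]
  rw [← heq] at this
  obtain ⟨a, -, ha⟩ := Finset.mem_image.1 this
  exact ⟨a, ha⟩

/-- The standard additive character of a finite field of characteristic `p`. -/
noncomputable def psi1 (p : ℕ) [Fact p.Prime] (F : Type*) [Field F] [Algebra (ZMod p) F] :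
    AddChar F ℂ :=
  (ZMod.stdAddChar (N := p)).compAddMonoidHom (Algebra.trace (ZMod p) F).toAddMonoidHom

lemma psi1_apply (p : ℕ) [Fact p.Prime] (F : Type*) [Field F] [Algebra (ZMod p) F] (x : F) :
    psi1 p F x = ZMod.stdAddChar (Algebra.trace (ZMod p) F x) := rfl

lemma sum_pow_blocks {E : Type*} [Field E] (p : ℕ) [Fact p.Prime] [CharP E p] (ν m : ℕ) (G : E) :
    ∑ j ∈ Finset.range ν, (∑ i ∈ Finset.range m, G ^ (p ^ ν) ^ i) ^ p ^ j
      = ∑ l ∈ Finset.range (ν * m), G ^ p ^ l := by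
  have : ∀ j, (∑ i ∈ Finset.range m, G ^ (p ^ ν) ^ i) ^ p ^ j
      = ∑ i ∈ Finset.range m, G ^ p ^ (ν * i + j) := by
    intro j
    rw [sum_pow_char_pow]
    refine Finset.sum_congr rfl fun i _ => ?_
    rw [← pow_mul, ← pow_mul, ← pow_add]
  simp_rw [this]
  rw [Finset.sum_comm]
  clear this
  induction m with
  | zero => simp
  | succ m ih =>
    rw [Finset.sum_range_succ, ih, Nat.mul_succ, Finset.sum_range_add]

lemma trace_cast_eq {F E : Type*} [Field F] [Fintype F] [Field E] [Algebra F E] (p : ℕ)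
    [Fact p.Prime] [CharP F p] [CharP E p] [Algebra (ZMod p) F] (ν : ℕ)
    (hν : Fintype.card F = p ^ ν) (m : ℕ) (G : E) (s : F)
    (hs : algebraMap F E s = ∑ i ∈ Finset.range m, G ^ (p ^ ν) ^ i) :
    ZMod.castHom dvd_rfl E (Algebra.trace (ZMod p) F s)
      = ∑ l ∈ Finset.range (ν * m), G ^ p ^ l := by
  have hfr : Module.finrank (ZMod p) F = ν := by
    have := Module.card_eq_pow_finrank (K := ZMod p) (V := F)
    rw [ZMod.card, hν] at this
    exact (Nat.pow_right_injective (Fact.out : p.Prime).two_le this).symm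
  have h1 := FiniteField.algebraMap_trace_eq_sum_pow (ZMod p) F s
  rw [hfr, Nat.card_eq_fintype_card, ZMod.card] at h1
  rw [← sum_pow_blocks, ← hs]
  have h2 : (ZMod.castHom (dvd_refl p) E) = (algebraMap F E).comp (algebraMap (ZMod p) F) :=
    Subsingleton.elim _ _
  rw [h2, RingHom.comp_apply, h1, map_sum]
  simp

lemma eval_frob_fixed {E : Type*} [Field E] (p ν : ℕ) [Fact p.Prime] [CharP E p] (H : E[X])
    (hH : H.map (iterateFrobenius E p ν) = H) (r : ℕ) (x : E) :
    (H.eval x) ^ (p ^ ν) ^ r = H.eval (x ^ (p ^ ν) ^ r) := by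
  induction r with
  | zero => simp
  | succ r ih =>
    rw [pow_succ, pow_mul, ih, pow_mul]
    generalize x ^ (p ^ ν) ^ r = y
    conv_rhs => rw [← hH]
    rw [← iterateFrobenius_def, ← iterateFrobenius_def, eval_map]
    rw [eval₂_hom]

theorem charsum_bound {F : Type*} {E : Type*} [Field F] [Fintype F] [Field E] [IsAlgClosed E]
    [Algebra F E] (p ν : ℕ) [Fact p.Prime] [CharP F p] [CharP E p] [Algebra (ZMod p) F]
    (hν : Fintype.card F = p ^ ν) (hν0 : 0 < ν) (χ : MulChar F ℂ)
    (hχ : ∀ u : F, χ u = 1 → u = 1) (Fp : F[X]) (hFp : Fp.Monic) (b c : F)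
    (hyp : (b ≠ 0 ∨ c ≠ 0) ∨ ∀ h : E[X], h ^ (Fintype.card F - 1) ≠ Fp.map (algebraMap F E)) :
    ∃ (C : ℝ) (r0 : ℕ), ∀ r ≥ r0, ∀ U S : E → F,
      (∀ α ∈ fixedPts E (Fintype.card F) (2 * r), α ≠ 0 →
        algebraMap F E (U α) = (Fp.map (algebraMap F E)).eval α ^
            ((Fintype.card F ^ (2 * r) - 1) / (Fintype.card F - 1)) ∧
        algebraMap F E (S α) = ∑ i ∈ Finset.range (2 * r),
          (algebraMap F E b * α + algebraMap F E c * α⁻¹) ^ (Fintype.card F) ^ i) →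
      ‖∑ α ∈ (fixedPts E (Fintype.card F) (2 * r)).filter (fun α => α ≠ 0),
          χ (U α) * psi1 p F (S α)‖ ≤ C * (Fintype.card F : ℝ) ^ r := by
  have hp : p.Prime := Fact.out
  set Q := Fintype.card F with hQ
  have hQ2 : 2 ≤ Q := Fintype.one_lt_card
  obtain ⟨D, N0, H, hD, hDN, hHm, hHF, hHpow⟩ :=
    exists_max_root (Fp.map (algebraMap F E)) (hFp.map _) (Q - 1) (by omega)
  have hN0 : N0 ≠ 0 := by rintro rfl; simp at hDN; omega
  have hpQ : p ∣ Q := hν ▸ dvd_pow_self p hν0.ne'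
  have hDp : ¬ p ∣ D := by
    intro h
    have : p ∣ Q - 1 := h.trans ⟨N0, hDN.symm⟩
    have h1 : p ∣ 1 := by
      have := (Nat.dvd_sub_iff_right (by omega) hpQ).1 this
      exact this
    exact hp.one_lt.ne' (Nat.dvd_one.1 h1)
  have hHfrob : H.map (iterateFrobenius E p ν) = H := by
    refine monic_pow_inj hHm (hHm.map _) hN0 ?_
    rw [← Polynomial.map_pow, hHF, Polynomial.map_map]
    congr 1
    ext x
    simp only [RingHom.comp_apply, iterateFrobenius_def]
    rw [← map_pow, ← hν, FiniteField.pow_card]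
  -- the auxiliary additive data
  obtain ⟨b', c', hbc', hbceq⟩ : ∃ b' c' : F, (b' ≠ 0 ∨ c' ≠ 0) ∧
      ((b ≠ 0 ∨ c ≠ 0) → b' = b ∧ c' = c) := by
    by_cases h : b ≠ 0 ∨ c ≠ 0
    · exact ⟨b, c, h, fun _ => ⟨rfl, rfl⟩⟩
    · exact ⟨1, 0, Or.inl one_ne_zero, fun h' => absurd h' h⟩
  have hinjE : Function.Injective (algebraMap F E) := (algebraMap F E).injective
  let I : Finset (F × ZMod p) := (nthRoots D (1 : F)).toFinset ×ˢ Finset.univ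
  have hI : I.card ≤ p * D := by
    rw [Finset.card_product, Finset.card_univ, ZMod.card, mul_comm]
    exact Nat.mul_le_mul_left _ ((Multiset.toFinset_card_le _).trans (card_nthRoots _ _))
  have key : ∀ i : F × ZMod p, ∃ CP : ℕ × ℕ, i ∈ I → ∀ μ P : ℕ, P = p ^ μ → CP.2 ≤ P →
      D ∣ P ^ 2 - 1 → ∀ Xs : Finset E, (∀ x ∈ Xs, x ≠ 0 ∧ H.eval x ≠ 0 ∧ x ^ (P ^ 2) = x ∧
      H.eval x ^ ((P ^ 2 - 1) / D) = algebraMap F E i.1 ∧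
      ∑ l ∈ Finset.range (2 * μ), (algebraMap F E b' * x + algebraMap F E c' * x⁻¹) ^ (p ^ l)
        = ZMod.castHom dvd_rfl E i.2) → p * D * Xs.card ≤ P ^ 2 + CP.1 * P := by
    rintro ⟨z, a⟩
    by_cases hi : (z, a) ∈ I
    · obtain ⟨C0, P0, h⟩ := curve_bound p (algebraMap F E b') (algebraMap F E c')
        (by simpa using hbc') D hD hDp H hHm.ne_zero hHpow (algebraMap F E z)
        (by
          have := (Finset.mem_product.1 hi).1
          rw [Multiset.mem_toFinset, mem_nthRoots hD] at this
          rw [← map_pow, this, map_one]) (ZMod.castHom dvd_rfl E a)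
        (by rw [← map_pow, ZMod.pow_card])
      exact ⟨(C0, P0), fun _ => h⟩
    · exact ⟨0, fun h => absurd h hi⟩
  choose CP hCP using key
  let C0 := I.sup (fun i => (CP i).1)
  let P0 := I.sup (fun i => (CP i).2)
  let η : ZMod p → ℂ := fun a => if b ≠ 0 ∨ c ≠ 0 then ZMod.stdAddChar a else 1
  let X : F × ZMod p → ℂ := fun i => χ i.1 * η i.2
  have hχ1 : ∀ u : F, ‖χ u‖ ≤ 1 := by
    intro u
    by_cases hu : IsUnit u
    · refine le_of_eq ?_
      have : (χ u) ^ (Q - 1) = 1 := by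
        rw [← map_pow, FiniteField.pow_card_sub_one_eq_one u hu.ne_zero, map_one]
      exact Complex.norm_eq_one_of_pow_eq_one this (by omega)
    · rw [χ.map_nonunit hu]; simp
  have hη1 : ∀ a, ‖η a‖ = 1 := by
    intro a; simp only [η]; split_ifs
    · exact AddChar.norm_apply _ _
    · simp
  have hX1 : ∀ i ∈ I, ‖X i‖ ≤ 1 := by
    intro i _; simp only [X, norm_mul, hη1, mul_one]; exact hχ1 _
  have hXsum : ∑ i ∈ I, X i = 0 := by
    simp only [I, X]
    rw [Finset.sum_product, ← Finset.sum_mul_sum]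
    rcases hyp with h | h
    · have : ∑ a : ZMod p, η a = 0 := by
        simp only [η, if_pos h]
        refine AddChar.sum_eq_zero_of_ne_one ?_
        intro h1
        have := (ZMod.isPrimitive_stdAddChar p) (one_ne_zero)
        apply this
        rw [AddChar.mulShift_one, h1]
      rw [this, mul_zero]
    · have hD1 : 1 < D := by
        rcases Nat.lt_or_ge 1 D with h' | h'
        · exact h'
        · have : D = 1 := by omega
          rw [this, one_mul] at hDN
          exact absurd (hDN ▸ hHF) (h H)
      have : ∑ z ∈ (nthRoots D (1:F)).toFinset, χ z = 0 := by
        obtain ⟨g, hg⟩ := exists_pow_ne_one_of_isCyclic (G := Fˣ) (k := N0) hN0 (by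
          rw [Nat.card_eq_fintype_card, Fintype.card_units, ← hQ, ← hDN]
          nlinarith [Nat.pos_of_ne_zero hN0])
        let z0 : Fˣ := g ^ N0
        have hz0 : (z0 : F) ^ D = 1 := by
          rw [← Units.val_pow_eq_pow_val]
          simp only [z0]
          rw [← pow_mul, mul_comm, hDN, Units.val_pow_eq_pow_val,
            FiniteField.pow_card_sub_one_eq_one _ g.ne_zero]
        have hz1 : χ z0 ≠ 1 := fun h1 => hg (Units.ext (by rw [hχ _ h1]; rfl))
        have hs : ∑ z ∈ (nthRoots D (1:F)).toFinset, χ (z0 * z)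
            = ∑ z ∈ (nthRoots D (1:F)).toFinset, χ z := by
          refine Finset.sum_bij' (fun z _ => z0 * z) (fun z _ => (z0⁻¹ : Fˣ) * z) ?_ ?_ ?_ ?_ ?_
          · intro z hz
            rw [Multiset.mem_toFinset, mem_nthRoots hD] at hz ⊢
            rw [mul_pow, hz, hz0, one_mul]
          · intro z hz
            rw [Multiset.mem_toFinset, mem_nthRoots hD] at hz ⊢
            rw [mul_pow, hz, Units.val_inv_eq_inv_val, inv_pow, hz0, inv_one, one_mul]
          · intro z _; simp
          · intro z _; simp
          · intro z _; rfl
        simp_rw [map_mul, ← Finset.mul_sum] at hs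
        have h3 : (χ z0 - 1) * ∑ z ∈ (nthRoots D (1:F)).toFinset, χ z = 0 := by
          rw [sub_mul, hs, one_mul, sub_self]
        exact (mul_eq_zero.1 h3).resolve_left (sub_ne_zero.2 hz1)
      rw [this, zero_mul]
  refine ⟨C0 + 1 + H.natDegree, max 1 P0, ?_⟩
  intro r hr U S hUS
  have hr1 : 1 ≤ r := (le_max_left _ _).trans hr
  have hk1 : 1 < Q ^ (2 * r) := Nat.one_lt_pow (by omega) (by omega)
  let μ := ν * r
  have hP : Q ^ r = p ^ μ := by rw [hν, ← pow_mul]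
  have hP2 : (Q ^ r) ^ 2 = Q ^ (2 * r) := by rw [← pow_mul, mul_comm]
  have hP0 : P0 ≤ Q ^ r := by
    refine ((le_max_right _ _).trans hr).trans (Nat.lt_pow_self (by omega)).le
  have hQk : (Q - 1) ∣ Q ^ (2 * r) - 1 := by
    simpa using Nat.sub_dvd_pow_sub_pow Q 1 (2 * r)
  have hDk : D ∣ Q ^ (2 * r) - 1 := (Dvd.intro _ hDN).trans hQk
  set fx := fixedPts E Q (2 * r) with hfx
  have hmem : ∀ x, x ∈ fx ↔ x ^ Q ^ (2 * r) = x := fun x => mem_fixedPts hk1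
  let G := (fx.filter (fun α => α ≠ 0)).filter (fun α => H.eval α ≠ 0)
  -- trace values
  let w : E → E := fun x =>
    ∑ l ∈ Finset.range (2 * μ), (algebraMap F E b' * x + algebraMap F E c' * x⁻¹) ^ (p ^ l)
  have hw : ∀ x ∈ fx, ∃ a : ZMod p, ZMod.castHom dvd_rfl E a = w x := by
    intro x hx
    refine exists_zmod_of_pow_eq p _ ?_
    simp only [w]
    set g := algebraMap F E b' * x + algebraMap F E c' * x⁻¹ with hg
    have hgk : g ^ p ^ (2 * μ) = g := by
      have hpk : p ^ (2 * μ) = Q ^ (2 * r) := by rw [mul_comm, pow_mul, ← hP, hP2]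
      rw [hg, add_pow_char_pow, mul_pow, mul_pow, hpk, inv_pow, (hmem x).1 hx, ← map_pow, ← map_pow,
        FiniteField.pow_card_pow, FiniteField.pow_card_pow]
    rw [sum_pow_char]
    simp_rw [← pow_mul, ← pow_succ]
    have h1 := Finset.sum_range_succ (fun l => g ^ p ^ l) (2 * μ)
    have h2 := Finset.sum_range_succ' (fun l => g ^ p ^ l) (2 * μ)
    rw [h1] at h2
    simp only [pow_zero, pow_one, hgk] at h2
    exact (add_right_cancel h2).symm
  choose! A hA using hw
  have hUval : ∀ x ∈ fx, x ≠ 0 → algebraMap F E (U x) = H.eval x ^ ((Q ^ (2 * r) - 1) / D) := by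
    intro x hx hx0
    rw [(hUS x hx hx0).1, ← hHF, eval_pow, ← pow_mul]
    congr 1
    obtain ⟨e, he⟩ := hQk
    rw [he, Nat.mul_div_cancel_left _ (by omega), ← hDN, mul_assoc, Nat.mul_div_cancel_left _ hD]
  have hHk : ∀ x ∈ fx, H.eval x ≠ 0 → (H.eval x ^ ((Q ^ (2 * r) - 1) / D)) ^ D = 1 := by
    intro x hx hx0
    rw [← pow_mul, Nat.div_mul_cancel hDk]
    have h1 := eval_frob_fixed p ν H hHfrob (2 * r) x
    rw [← hν, (hmem x).1 hx] at h1
    have h2 : H.eval x ^ (Q ^ (2 * r) - 1) * H.eval x = 1 * H.eval x := by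
      rw [← pow_succ, Nat.sub_add_cancel hk1.le, h1, one_mul]
    exact mul_right_cancel₀ hx0 h2
  have hterm : ∀ x ∈ fx, x ≠ 0 → χ (U x) * psi1 p F (S x) = X (U x, A x) := by
    intro x hx hx0
    simp only [X, η]
    congr 1
    have h2 := (hUS x hx hx0).2
    split_ifs with h
    · rw [psi1_apply]
      congr 1
      apply (ZMod.castHom (dvd_refl p) E).injective
      rw [hA x hx]
      obtain ⟨rfl, rfl⟩ := hbceq h
      rw [trace_cast_eq p ν hν (2 * r) _ (S x) (by rw [h2, hν])]
      simp only [w, μ]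
      rw [show ν * (2 * r) = 2 * (ν * r) by ring]
    · push Not at h
      have : S x = 0 := by
        apply hinjE
        rw [h2, h.1, h.2]
        simp only [map_zero, zero_mul, add_zero]
        refine Finset.sum_eq_zero fun i _ => zero_pow (by positivity)
      rw [this, AddChar.map_zero_eq_one]
  have hsumG : ∑ α ∈ fx.filter (fun α => α ≠ 0), χ (U α) * psi1 p F (S α)
      = ∑ α ∈ G, X (U α, A α) := by
    rw [Finset.sum_filter (s := fx.filter (fun α => α ≠ 0)) (p := fun α => H.eval α ≠ 0)]
    refine Finset.sum_congr rfl fun x hx => ?_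
    obtain ⟨hx, hx0⟩ := Finset.mem_filter.1 hx
    split_ifs with h
    · exact hterm x hx hx0
    · push Not at h
      have h1 := hUval x hx hx0
      have : U x = 0 := by
        apply hinjE
        rw [h1, h, zero_pow, map_zero]
        exact (Nat.div_pos (Nat.le_of_dvd (by omega) hDk) hD).ne'
      rw [this, χ.map_zero, zero_mul]
  have hcardG : (Q : ℝ) ^ (2 * r) - 1 - H.natDegree ≤ G.card := by
    have hsub : fx ⊆ G ∪ ({0} ∪ H.roots.toFinset) := by
      intro x hx
      by_cases h0 : x = 0
      · simp [h0]
      · by_cases h1 : H.eval x = 0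
        · have : x ∈ H.roots.toFinset := by
            rw [Multiset.mem_toFinset, mem_roots hHm.ne_zero]; exact h1
          simp [this]
        · simp [G, hx, h0, h1]
    have h1 := (Finset.card_le_card hsub).trans (Finset.card_union_le _ _)
    have h2 := Finset.card_union_le ({0} : Finset E) H.roots.toFinset
    have h3 : H.roots.toFinset.card ≤ H.natDegree :=
      (Multiset.toFinset_card_le _).trans (card_roots' _)
    rw [hfx, card_fixedPts p hk1 (dvd_pow hpQ (by omega))] at h1
    simp only [Finset.card_singleton] at h2
    have h4 : Q ^ (2 * r) ≤ G.card + 1 + H.natDegree := by omega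
    have : (Q : ℝ) ^ (2 * r) ≤ G.card + 1 + H.natDegree := by exact_mod_cast h4
    linarith
  have hfb := fiber_bound I X hX1 hXsum G (fun α => (U α, A α)) ?_
    ((Q ^ r) ^ 2 + C0 * Q ^ r : ℕ) (p * D) (Nat.mul_pos hp.pos hD) hI (by positivity) ?_
  · rw [hsumG]
    refine hfb.trans ?_
    push_cast
    have h1 : (1 : ℝ) ≤ (Q : ℝ) ^ r := one_le_pow₀ (by exact_mod_cast (by omega : 1 ≤ Q))
    have h2 : ((Q : ℝ) ^ r) ^ 2 = (Q : ℝ) ^ (2 * r) := by rw [← pow_mul, mul_comm]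
    have h3 : (0:ℝ) ≤ H.natDegree := by positivity
    rw [h2]
    nlinarith
  · intro x hx
    obtain ⟨hx, hxH⟩ := Finset.mem_filter.1 hx
    obtain ⟨hx, hx0⟩ := Finset.mem_filter.1 hx
    simp only [I, Finset.mem_product, Finset.mem_univ, and_true, Multiset.mem_toFinset,
      mem_nthRoots hD]
    apply hinjE
    rw [map_pow, hUval x hx hx0, hHk x hx hxH, map_one]
  · intro i hi
    have h1 := hCP i hi μ (Q ^ r) hP ((Finset.le_sup (f := fun i => (CP i).2) hi).trans hP0)
      (by rw [hP2]; exact hDk) (G.filter (fun a => (U a, A a) = i)) (by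
        intro x hx
        obtain ⟨hx1, hxi⟩ := Finset.mem_filter.1 hx
        obtain ⟨hx2, hxH⟩ := Finset.mem_filter.1 hx1
        obtain ⟨hx3, hx0⟩ := Finset.mem_filter.1 hx2
        clear hx1 hx2 hx
        subst hxi
        rw [hP2]
        exact ⟨hx0, hxH, (hmem x).1 hx3, (hUval x hx3 hx0).symm, (hA x hx3).symm⟩)
    have h2 : (CP i).1 * Q ^ r ≤ C0 * Q ^ r :=
      Nat.mul_le_mul_right _ (Finset.le_sup (f := fun i => (CP i).1) hi)
    have h3 := h1.trans (Nat.add_le_add_left h2 _)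
    have h4 : ((p * D : ℕ) : ℝ) * (G.filter (fun a => (U a, A a) = i)).card ≤
        ((Q ^ r) ^ 2 + C0 * Q ^ r : ℕ) := by exact_mod_cast h3
    convert h4

instance monicsFinite (F : Type*) [Field F] [Finite F] (d : ℕ) :
    Finite {h : F[X] // h.Monic ∧ h.natDegree = d} := by
  refine Finite.of_injective (β := Fin (d + 1) → F) (fun h i => h.1.coeff i) ?_
  intro h k hk
  apply Subtype.ext
  ext i
  by_cases hi : i < d + 1
  · exact congrFun hk ⟨i, hi⟩
  · rw [coeff_eq_zero_of_natDegree_lt (by rw [h.2.2]; omega),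
      coeff_eq_zero_of_natDegree_lt (by rw [k.2.2]; omega)]

/-- the monic polynomials of degree `d` -/
noncomputable def monics (F : Type*) [Field F] [Finite F] (d : ℕ) : Finset F[X] :=
  (Set.finite_coe_iff (s := {h : F[X] | h.Monic ∧ h.natDegree = d}).1 (monicsFinite F d)).toFinset

lemma mem_monics {F : Type*} [Field F] [Finite F] {d : ℕ} {h : F[X]} :
    h ∈ monics F d ↔ h.Monic ∧ h.natDegree = d := by
  simp [monics]

/-- the power of the minimal polynomial of degree `r` -/
noncomputable def minPow (F : Type*) {E : Type*} [Field F] [Field E] [Algebra F E] (α : E) (r : ℕ) :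
    F[X] := minpoly F α ^ (r / (minpoly F α).natDegree)

section
variable {F E : Type*} [Field F] [Fintype F] [Field E] [Algebra F E] [Algebra.IsIntegral F E]

lemma fixed_iff_dvd {α : E} {s : ℕ} (hs : s ≠ 0) :
    α ∈ fixedPts E (Fintype.card F) s ↔ (minpoly F α).natDegree ∣ s := by
  have hIntg : IsIntegral F α := Algebra.IsIntegral.isIntegral α
  have h1 : 1 < Fintype.card F ^ s := Nat.one_lt_pow hs Fintype.one_lt_card
  rw [mem_fixedPts h1,
    (minpoly.irreducible hIntg).natDegree_dvd_iff_dvd_X_pow_card_pow_sub_X, minpoly.dvd_iff,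
    Nat.card_eq_fintype_card]
  simp [sub_eq_zero]

lemma minpoly_pow_dvd_iff (α : E) {h : F[X]} (h0 : h ≠ 0) (e : ℕ) :
    minpoly F α ^ e ∣ h ↔ e ≤ (h.map (algebraMap F E)).roots.count α := by
  have hIntg : IsIntegral F α := Algebra.IsIntegral.isIntegral α
  have hirr := minpoly.irreducible hIntg
  have h0' : h.map (algebraMap F E) ≠ 0 := (Polynomial.map_ne_zero_iff (algebraMap F E).injective).2 h0
  constructor
  · intro hd
    rw [count_roots, le_rootMultiplicity_iff h0']
    have h1 : (X - C α) ∣ (minpoly F α).map (algebraMap F E) := by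
      rw [dvd_iff_isRoot, IsRoot.def, eval_map_algebraMap, minpoly.aeval]
    refine (pow_dvd_pow_of_dvd h1 e).trans ?_
    rw [← Polynomial.map_pow]
    exact Polynomial.map_dvd _ hd
  · intro he
    obtain ⟨u, hu, hnd⟩ := (FiniteMultiplicity.of_prime_left hirr.prime h0).exists_eq_pow_mul_and_not_dvd
    set k := multiplicity (minpoly F α) h
    have hc : (h.map (algebraMap F E)).roots.count α ≤ k := by
      rw [hu, Polynomial.map_mul, Polynomial.map_pow, roots_mul, roots_pow, Multiset.count_add,
        Multiset.count_nsmul]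
      · have h1 : ((minpoly F α).map (algebraMap F E)).roots.count α ≤ 1 := by
          rw [count_roots]
          exact rootMultiplicity_le_one_of_separable
            ((PerfectField.separable_of_irreducible hirr).map) α
        have h2 : (u.map (algebraMap F E)).roots.count α = 0 := by
          rw [Multiset.count_eq_zero]
          intro hm
          have := isRoot_of_mem_roots hm
          rw [IsRoot.def, eval_map_algebraMap] at this
          exact hnd (minpoly.dvd F α this)
        rw [h2]
        nlinarith
      · rw [← Polynomial.map_pow, ← Polynomial.map_mul, ← hu]; exact h0'
    exact (pow_dvd_pow _ (he.trans hc)).trans ⟨u, hu⟩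

set_option linter.unusedSectionVars false

lemma count_pairs [IsAlgClosed E] {d : ℕ} {h : F[X]} (hh : h ∈ monics F d) :
    ∑ r ∈ Finset.range d, ((fixedPts E (Fintype.card F) (r + 1)).filter
      (fun α => minPow F α (r + 1) ∣ h)).card = d := by
  rw [mem_monics] at hh
  obtain ⟨hm, hd⟩ := hh
  set T := (h.map (algebraMap F E)).roots with hT
  have hcard : T.card = d := by
    rw [← (IsAlgClosed.splits _).natDegree_eq_card_roots, natDegree_map, hd]
  have hroot : ∀ r, ∀ α ∈ fixedPts E (Fintype.card F) (r + 1), minPow F α (r + 1) ∣ h → α ∈ T.toFinset := by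
    intro r α hα hdv
    rw [fixed_iff_dvd (F := F) (by omega)] at hα
    have hpos := minpoly.natDegree_pos (Algebra.IsIntegral.isIntegral (R := F) α)
    have h1 : 1 ≤ (r + 1) / (minpoly F α).natDegree :=
      Nat.div_pos (Nat.le_of_dvd (by omega) hα) hpos
    rw [minPow, minpoly_pow_dvd_iff α hm.ne_zero, ← hT] at hdv
    rw [Multiset.mem_toFinset, ← Multiset.one_le_count_iff_mem]
    omega
  calc _ = ∑ r ∈ Finset.range d, ∑ α ∈ T.toFinset,
        (if α ∈ fixedPts E (Fintype.card F) (r + 1) ∧ minPow F α (r + 1) ∣ h then 1 else 0) := by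
        refine Finset.sum_congr rfl fun r _ => ?_
        rw [← Finset.card_filter]
        congr 1
        ext α
        simp only [Finset.mem_filter]
        constructor
        · rintro ⟨h1, h2⟩; exact ⟨hroot r α h1 h2, h1, h2⟩
        · rintro ⟨_, h1, h2⟩; exact ⟨h1, h2⟩
    _ = ∑ α ∈ T.toFinset, T.count α := by
        rw [Finset.sum_comm]
        refine Finset.sum_congr rfl fun α hα => ?_
        rw [← Finset.card_filter]
        have hpos := minpoly.natDegree_pos (Algebra.IsIntegral.isIntegral (R := F) α)
        set δ := (minpoly F α).natDegree with hδ
        have hinj : Function.Injective (fun e : ℕ => (e + 1) * δ - 1) := by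
          intro a b hab
          have ha : 1 ≤ (a + 1) * δ := Nat.mul_pos (by omega) hpos
          have hb : 1 ≤ (b + 1) * δ := Nat.mul_pos (by omega) hpos
          have h3 : (a + 1) * δ = (b + 1) * δ := by simp only at hab; omega
          have := Nat.eq_of_mul_eq_mul_right hpos h3
          omega
        rw [← Finset.card_range (T.count α), ← Finset.card_image_of_injective (Finset.range (T.count α)) hinj]
        congr 1
        ext r
        simp only [Finset.mem_filter, Finset.mem_range, Finset.mem_image]
        constructor
        · rintro ⟨hr, hfix, hdv⟩
          rw [fixed_iff_dvd (F := F) (by omega)] at hfix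
          obtain ⟨e, he⟩ := hfix
          have hce : minpoly F α ^ ((r + 1) / (minpoly F α).natDegree) ∣ h := hdv
          rw [minpoly_pow_dvd_iff α hm.ne_zero, he, ← hδ, ← hT, Nat.mul_div_cancel_left _ hpos] at hce
          have he0 : e ≠ 0 := by rintro rfl; simp at he
          refine ⟨e - 1, by omega, ?_⟩
          rw [Nat.sub_add_cancel (by omega), mul_comm, ← he]; omega
        · rintro ⟨e, he, rfl⟩
          have h1 : 1 ≤ (e + 1) * δ := Nat.mul_pos (by omega) hpos
          have hdv : minpoly F α ^ (e + 1) ∣ h := (minpoly_pow_dvd_iff α hm.ne_zero _).2 (by rw [← hT]; omega)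
          have hle : (e + 1) * δ ≤ d := by
            have := natDegree_le_of_dvd hdv hm.ne_zero
            rwa [natDegree_pow, hd] at this
          refine ⟨by omega, ?_, ?_⟩
          · rw [fixed_iff_dvd (F := F) (by omega), Nat.sub_add_cancel h1]; exact Dvd.intro_left _ rfl
          · rw [minPow, Nat.sub_add_cancel h1, ← hδ, Nat.mul_div_cancel _ hpos]; exact hdv
    _ = d := by rw [Multiset.toFinset_sum_count_eq, hcard]

lemma minPow_monic (α : E) (r : ℕ) : (minPow F α r).Monic :=
  (minpoly.monic (Algebra.IsIntegral.isIntegral (R := F) α)).pow _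

lemma minPow_natDegree {α : E} {r : ℕ} (hr : r ≠ 0) (hα : α ∈ fixedPts E (Fintype.card F) r) :
    (minPow F α r).natDegree = r := by
  rw [fixed_iff_dvd (F := F) hr] at hα
  rw [minPow, natDegree_pow, Nat.div_mul_cancel hα]

lemma newton_identity [IsAlgClosed E] (Λ : F[X] → ℂ)
    (hΛ : ∀ h k : F[X], h.Monic → k.Monic → Λ (h * k) = Λ h * Λ k) (d : ℕ) :
    (d : ℂ) * ∑ h ∈ monics F d, Λ h = ∑ r ∈ Finset.range d,
      (∑ α ∈ fixedPts E (Fintype.card F) (r + 1), Λ (minPow F α (r + 1))) *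
        ∑ h ∈ monics F (d - (r + 1)), Λ h := by
  have h1 : (d : ℂ) * ∑ h ∈ monics F d, Λ h = ∑ h ∈ monics F d, ∑ r ∈ Finset.range d,
      ∑ α ∈ fixedPts E (Fintype.card F) (r + 1),
        if minPow F α (r + 1) ∣ h then Λ h else 0 := by
    rw [Finset.mul_sum]
    refine Finset.sum_congr rfl fun h hh => ?_
    conv_lhs => rw [← count_pairs (E := E) hh]
    push_cast
    rw [Finset.sum_mul]
    refine Finset.sum_congr rfl fun r _ => ?_
    rw [← Finset.sum_filter, Finset.sum_const, nsmul_eq_mul]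
  rw [h1, Finset.sum_comm]
  refine Finset.sum_congr rfl fun r hr => ?_
  rw [Finset.sum_comm, Finset.sum_mul]
  refine Finset.sum_congr rfl fun α hα => ?_
  have hr : r + 1 ≤ d := Finset.mem_range.1 hr
  have hPm := minPow_monic (F := F) α (r + 1)
  have hPd := minPow_natDegree (F := F) (by omega) hα
  set P := minPow F α (r + 1)
  rw [← Finset.sum_filter, Finset.mul_sum]
  symm
  refine Finset.sum_bij (fun k _ => P * k) ?_ ?_ ?_ ?_
  · intro k hk
    rw [mem_monics] at hk
    rw [Finset.mem_filter, mem_monics]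
    refine ⟨⟨hPm.mul hk.1, ?_⟩, dvd_mul_right _ _⟩
    rw [hPm.natDegree_mul hk.1, hPd, hk.2]; omega
  · intro k _ k' _ hkk
    exact mul_left_cancel₀ hPm.ne_zero hkk
  · intro h hh
    rw [Finset.mem_filter, mem_monics] at hh
    obtain ⟨⟨hm, hd⟩, k, rfl⟩ := hh
    have hk : k.Monic := hPm.of_mul_monic_left hm
    refine ⟨k, ?_, rfl⟩
    rw [mem_monics]
    refine ⟨hk, ?_⟩
    rw [hPm.natDegree_mul hk, hPd] at hd
    omega
  · intro k hk
    rw [mem_monics] at hk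
    rw [hΛ _ _ hPm hk.1]

/-- elements fixed by Frobenius lie in `F` -/
lemma mem_range_of_pow_card (x : E) (hx : x ^ Fintype.card F = x) : x ∈ Set.range (algebraMap F E) := by
  have h := FiniteField.X_pow_card_sub_X_ne_zero E (Fintype.one_lt_card (α := F))
  have hsub : Finset.univ.image (algebraMap F E) ⊆
      (X ^ Fintype.card F - X : E[X]).roots.toFinset := by
    intro x hx
    obtain ⟨a, -, rfl⟩ := Finset.mem_image.1 hx
    rw [Multiset.mem_toFinset, mem_roots h]
    simp only [IsRoot.def, eval_sub, eval_pow, eval_X]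
    rw [← map_pow, FiniteField.pow_card, sub_self]
  have heq := Finset.eq_of_subset_of_card_le hsub (by
    rw [Finset.card_image_of_injective _ (algebraMap F E).injective, Finset.card_univ]
    refine (Multiset.toFinset_card_le _).trans ((card_roots' _).trans ?_)
    rw [FiniteField.X_pow_card_sub_X_natDegree_eq E Fintype.one_lt_card])
  have : x ∈ (X ^ Fintype.card F - X : E[X]).roots.toFinset := by
    rw [Multiset.mem_toFinset, mem_roots h]
    simp [hx]
  rw [← heq] at this
  obtain ⟨a, -, ha⟩ := Finset.mem_image.1 this
  exact ⟨a, ha⟩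

lemma minPow_map (p ν : ℕ) [Fact p.Prime] [CharP E p] (hν : Fintype.card F = p ^ ν) {α : E} {r : ℕ}
    (hr : r ≠ 0) (hα : α ∈ fixedPts E (Fintype.card F) r) :
    (minPow F α r).map (algebraMap F E)
      = ∏ i ∈ Finset.range r, (X - C (α ^ Fintype.card F ^ i)) := by
  set Q := Fintype.card F with hQ
  have hIntg : IsIntegral F α := Algebra.IsIntegral.isIntegral α
  have h1 : 1 < Q ^ r := Nat.one_lt_pow hr Fintype.one_lt_card
  have hfix : α ^ Q ^ r = α := (mem_fixedPts h1).1 hα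
  set T : E[X] := ∏ i ∈ Finset.range r, (X - C (α ^ Q ^ i)) with hT
  have hTm : T.Monic := monic_prod_of_monic _ _ fun i _ => monic_X_sub_C _
  have hTd : T.natDegree = r := by
    rw [hT, natDegree_prod_of_monic _ _ fun i _ => monic_X_sub_C _]
    simp only [natDegree_X_sub_C]; simp
  have hfrob : T.map (iterateFrobenius E p ν) = T := by
    rw [hT, Polynomial.map_prod]
    have : ∀ i, (X - C (α ^ Q ^ i) : E[X]).map (iterateFrobenius E p ν) = X - C (α ^ Q ^ (i + 1)) := by
      intro i
      rw [Polynomial.map_sub, map_X, map_C, iterateFrobenius_def, ← hν, ← pow_mul, ← pow_succ]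
    simp_rw [this]
    have e1 := Finset.prod_range_succ (fun i => (X - C (α ^ Q ^ i) : E[X])) r
    have e2 := Finset.prod_range_succ' (fun i => (X - C (α ^ Q ^ i) : E[X])) r
    rw [e1] at e2
    simp only [hfix, pow_zero, pow_one] at e2
    exact (mul_right_cancel₀ (X_sub_C_ne_zero α) e2).symm
  have hlift : T ∈ lifts (algebraMap F E) := by
    rw [lifts_iff_coeff_lifts]
    intro n
    apply mem_range_of_pow_card
    conv_rhs => rw [← hfrob]
    rw [coeff_map, iterateFrobenius_def, ← hν]
  obtain ⟨T0, hT0, hT0d, hT0m⟩ := lifts_and_natDegree_eq_and_monic hlift hTm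
  have hdv : T0 ∣ minpoly F α ^ r := by
    rw [← map_dvd_map' (algebraMap F E), hT0, Polynomial.map_pow, hT]
    rw [← Finset.card_range r, ← Finset.prod_const, Finset.card_range]
    refine Finset.prod_dvd_prod_of_dvd _ _ fun i _ => ?_
    rw [dvd_iff_isRoot, IsRoot.def, eval_map_algebraMap]
    have := eval_frob_fixed p ν ((minpoly F α).map (algebraMap F E)) (by
      rw [Polynomial.map_map]
      congr 1
      ext x
      simp only [RingHom.comp_apply, iterateFrobenius_def]
      rw [← map_pow, ← hν, FiniteField.pow_card]) i α
    rw [← hν, eval_map_algebraMap, eval_map_algebraMap, minpoly.aeval, zero_pow (by positivity)] at this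
    exact this.symm
  obtain ⟨k, -, hk⟩ := (dvd_prime_pow (minpoly.irreducible hIntg).prime r).1 hdv
  have hk' := eq_of_monic_of_associated hT0m ((minpoly.monic hIntg).pow k) hk
  have hdeg : r = k * (minpoly F α).natDegree := by
    rw [← natDegree_pow, ← hk', hT0d, hTd]
  rw [← hT0, hk', minPow]
  congr 2
  rw [hdeg, Nat.mul_div_cancel _ (minpoly.natDegree_pos hIntg)]
end

noncomputable def polyRes {F : Type*} [Field F] (Fp h : F[X]) : F :=
  Fp.resultant h Fp.natDegree h.natDegree

noncomputable def Lam (p : ℕ) [Fact p.Prime] {F : Type*} [Field F] [Algebra (ZMod p) F]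
    (χ : MulChar F ℂ) (Fp : F[X]) (b c : F) (h : F[X]) : ℂ :=
  χ (polyRes Fp h) * psi1 p F (-b * h.nextCoeff - c * (h.coeff 1 / h.coeff 0))

section
variable {F : Type*} (E : Type*) [Field F] [Fintype F] [Field E] [Algebra F E] [IsAlgClosed E]
set_option linter.unusedSectionVars false

lemma polyRes_map {Fp : F[X]} (hFp : Fp.Monic) (h : F[X]) :
    algebraMap F E (polyRes Fp h) =
      ((Fp.map (algebraMap F E)).roots.map (fun β => (h.map (algebraMap F E)).eval β)).prod := by
  rw [polyRes, ← resultant_map_map]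
  have := resultant_eq_prod_eval (Fp.map (algebraMap F E)) (h.map (algebraMap F E)) h.natDegree
    (by rw [natDegree_map]) (IsAlgClosed.splits _)
  rw [natDegree_map] at this
  rw [this, (hFp.map _).leadingCoeff, one_pow, one_mul]

lemma polyRes_mul {Fp : F[X]} (hFp : Fp.Monic) (h k : F[X]) :
    polyRes Fp (h * k) = polyRes Fp h * polyRes Fp k := by
  apply (algebraMap F (AlgebraicClosure F)).injective
  rw [map_mul, polyRes_map _ hFp, polyRes_map _ hFp, polyRes_map _ hFp, ← Multiset.prod_map_mul]
  simp

lemma polyRes_one {Fp : F[X]} (hFp : Fp.Monic) : polyRes Fp 1 = 1 := by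
  apply (algebraMap F (AlgebraicClosure F)).injective
  rw [polyRes_map _ hFp]
  simp

lemma polyRes_congr {Fp M : F[X]} (hFp : Fp.Monic) {j : ℕ} (hFM : Fp ∣ M ^ j) {h k : F[X]}
    (hhk : M ∣ h - k) : polyRes Fp h = polyRes Fp k := by
  apply (algebraMap F (AlgebraicClosure F)).injective
  rw [polyRes_map _ hFp, polyRes_map _ hFp]
  congr 1
  refine Multiset.map_congr rfl fun β hβ => ?_
  have h1 := isRoot_of_mem_roots hβ
  rw [IsRoot.def, eval_map_algebraMap] at h1
  have h2 : aeval β M = 0 := by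
    have := aeval_eq_zero_of_dvd_aeval_eq_zero hFM h1
    rw [map_pow] at this
    exact eq_zero_of_pow_eq_zero this
  have h3 := aeval_eq_zero_of_dvd_aeval_eq_zero hhk h2
  rw [map_sub, sub_eq_zero] at h3
  rw [eval_map_algebraMap, eval_map_algebraMap, h3]

lemma polyRes_eq_zero {Fp : F[X]} (hFp : Fp.Monic) {h : F[X]} (β : E) (h1 : aeval β Fp = 0)
    (h2 : aeval β h = 0) : polyRes Fp h = 0 := by
  apply (algebraMap F E).injective
  rw [polyRes_map E hFp, map_zero, Multiset.prod_eq_zero_iff, Multiset.mem_map]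
  refine ⟨β, ?_, by rw [eval_map_algebraMap, h2]⟩
  rw [mem_roots (hFp.map _).ne_zero, IsRoot.def, eval_map_algebraMap, h1]

lemma polyRes_zero_coeff {Fp : F[X]} (hFp : Fp.Monic) (hX : X ∣ Fp) {h : F[X]}
    (h0 : h.coeff 0 = 0) : polyRes Fp h = 0 := by
  refine polyRes_eq_zero (AlgebraicClosure F) hFp 0 ?_ ?_
  · obtain ⟨k, rfl⟩ := hX; simp
  · have : X ∣ h := X_dvd_iff.2 h0
    obtain ⟨k, rfl⟩ := this; simp

lemma prod_roots_sub {Fp : F[X]} (hFp : Fp.Monic) (x : E) :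
    ((Fp.map (algebraMap F E)).roots.map (fun β => β - x)).prod
      = (-1) ^ Fp.natDegree * (Fp.map (algebraMap F E)).eval x := by
  rw [(IsAlgClosed.splits (Fp.map (algebraMap F E))).eval_eq_prod_roots x,
    (hFp.map _).leadingCoeff, one_mul]
  have hc : Fp.natDegree = (Fp.map (algebraMap F E)).roots.card := by
    rw [← (IsAlgClosed.splits _).natDegree_eq_card_roots, natDegree_map]
  rw [hc]
  generalize (Fp.map (algebraMap F E)).roots = s
  induction s using Multiset.induction with
  | empty => simp
  | cons a s ih => simp [pow_succ, ih]; ring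

variable (p : ℕ) [Fact p.Prime] [Algebra (ZMod p) F] (χ : MulChar F ℂ)

lemma coeff_ratio_mul {R : Type*} [Field R] (h k : R[X]) (h0 : h.coeff 0 ≠ 0) (k0 : k.coeff 0 ≠ 0) :
    (h * k).coeff 1 / (h * k).coeff 0 = h.coeff 1 / h.coeff 0 + k.coeff 1 / k.coeff 0 := by
  rw [mul_coeff_one, mul_coeff_zero]
  field_simp
  ring

lemma Lam_mul {Fp : F[X]} (hFp : Fp.Monic) (hX : X ∣ Fp) (b c : F) (h k : F[X])
    (hhk : b = 0 ∨ (h.Monic ∧ k.Monic)) :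
    Lam p χ Fp b c (h * k) = Lam p χ Fp b c h * Lam p χ Fp b c k := by
  simp only [Lam, polyRes_mul hFp]
  by_cases h0 : h.coeff 0 = 0
  · rw [polyRes_zero_coeff hFp hX h0, zero_mul, χ.map_zero]; ring
  by_cases k0 : k.coeff 0 = 0
  · rw [polyRes_zero_coeff hFp hX k0, mul_zero, χ.map_zero]; ring
  have : -b * (h * k).nextCoeff - c * ((h * k).coeff 1 / (h * k).coeff 0)
      = (-b * h.nextCoeff - c * (h.coeff 1 / h.coeff 0))
        + (-b * k.nextCoeff - c * (k.coeff 1 / k.coeff 0)) := by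
    rw [coeff_ratio_mul h k h0 k0]
    rcases hhk with rfl | ⟨hh, hk⟩
    · ring
    · rw [hh.nextCoeff_mul hk]; ring
  rw [this, AddChar.map_add_eq_mul, map_mul]
  ring

lemma Lam_one {Fp : F[X]} (hFp : Fp.Monic) (b c : F) : Lam p χ Fp b c 1 = 1 := by
  simp only [Lam, polyRes_one hFp]
  have h1 : (1 : F[X]).coeff 1 = 0 := by rw [coeff_one]; simp
  have h2 : (1 : F[X]).nextCoeff = 0 := by rw [← C_1, nextCoeff_C_eq_zero]
  rw [h1, h2]; simp

lemma coeff_eq_of_dvd {M h k : F[X]} (hXM : X ^ 2 ∣ M) (hhk : M ∣ h - k) :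
    h.coeff 0 = k.coeff 0 ∧ h.coeff 1 = k.coeff 1 := by
  have h1 := X_pow_dvd_iff.1 (hXM.trans hhk)
  have h2 := h1 0 (by omega)
  have h3 := h1 1 (by omega)
  rw [coeff_sub, sub_eq_zero] at h2 h3
  exact ⟨h2, h3⟩

lemma psi1_ne_one [CharP F p] : ∃ x : F, psi1 p F x ≠ 1 := by
  obtain ⟨x, hx⟩ := Algebra.trace_surjective (ZMod p) F 1
  refine ⟨x, ?_⟩
  rw [psi1_apply, hx]
  intro h
  have := ZMod.injective_stdAddChar (N := p) (h.trans (AddChar.map_zero_eq_one _).symm)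
  exact one_ne_zero this

/-- vanishing of the coefficients, nontrivial additive character at infinity -/
lemma Lam_sum_zero1 [CharP F p] {Fp M : F[X]} (hFp : Fp.Monic) (hM : M.Monic) (hXM : X ^ 2 ∣ M)
    {j : ℕ} (hFM : Fp ∣ M ^ j) (b c : F) (hb : b ≠ 0) (d : ℕ) (hd : M.natDegree < d) :
    ∑ h ∈ monics F d, Lam p χ Fp b c h = 0 := by
  obtain ⟨x, hx⟩ := psi1_ne_one (F := F) p
  set s := -x / b with hs
  have hsb : -b * s = x := by rw [hs]; field_simp
  set T : F[X] := C s * (M * X ^ (d - 1 - M.natDegree)) with hT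
  have hTM : M ∣ T := ⟨C s * X ^ (d - 1 - M.natDegree), by rw [hT]; ring⟩
  have hTd : T.natDegree ≤ d - 1 := by
    refine (natDegree_C_mul_le _ _).trans ?_
    rw [hM.natDegree_mul (monic_X_pow _), natDegree_X_pow]; omega
  have hTc : T.coeff (d - 1) = s := by
    have h1 : (M * X ^ (d - 1 - M.natDegree)).Monic := hM.mul (monic_X_pow _)
    have h2 : (M * X ^ (d - 1 - M.natDegree)).natDegree = d - 1 := by
      rw [hM.natDegree_mul (monic_X_pow _), natDegree_X_pow]; omega
    rw [hT, coeff_C_mul]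
    have h3 := h1.coeff_natDegree
    rw [h2] at h3
    rw [h3, mul_one]
  have hadd : ∀ (T : F[X]), T.natDegree ≤ d - 1 → ∀ h ∈ monics F d, h + T ∈ monics F d := by
    intro T hT h hh
    rw [mem_monics] at hh ⊢
    have hlt : T.degree < h.degree := by
      rw [degree_eq_natDegree hh.1.ne_zero, hh.2]
      refine lt_of_le_of_lt degree_le_natDegree ?_
      exact_mod_cast (by omega : T.natDegree < d)
    exact ⟨hh.1.add_of_left hlt, by rw [natDegree_add_eq_left_of_degree_lt hlt, hh.2]⟩
  have h1 : ∑ h ∈ monics F d, Lam p χ Fp b c (h + T) = ∑ h ∈ monics F d, Lam p χ Fp b c h := by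
    refine Finset.sum_bij' (fun h _ => h + T) (fun h _ => h + -T) ?_ ?_ ?_ ?_ ?_
    · exact fun h hh => hadd T hTd h hh
    · exact fun h hh => hadd (-T) (by rwa [natDegree_neg]) h hh
    · intro h _; ring
    · intro h _; ring
    · intro h _; rfl
  have h2 : ∀ h ∈ monics F d, Lam p χ Fp b c (h + T) = psi1 p F x * Lam p χ Fp b c h := by
    intro h hh
    have hh' := hadd T hTd h hh
    rw [mem_monics] at hh hh'
    have hdvd : M ∣ (h + T) - h := by simpa using hTM
    obtain ⟨e0, e1⟩ := coeff_eq_of_dvd hXM hdvd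
    have hn : (h + T).nextCoeff = h.nextCoeff + s := by
      rw [nextCoeff_of_natDegree_pos (by omega), nextCoeff_of_natDegree_pos (by omega), hh'.2, hh.2,
        coeff_add, hTc]
    simp only [Lam]
    rw [polyRes_congr hFp hFM hdvd, e0, e1, hn, mul_add, hsb,
      show ∀ y z : F, y + x - z = x + (y - z) by intros; ring, AddChar.map_add_eq_mul]
    ring
  rw [Finset.sum_congr rfl h2, ← Finset.mul_sum] at h1
  have h3 : (psi1 p F x - 1) * ∑ h ∈ monics F d, Lam p χ Fp b c h = 0 := by
    rw [sub_mul, h1, one_mul, sub_self]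
  exact (mul_eq_zero.1 h3).resolve_left (sub_ne_zero.2 hx)

lemma Lam_congr {Fp M : F[X]} (hFp : Fp.Monic) (hXM : X ^ 2 ∣ M)
    {j : ℕ} (hFM : Fp ∣ M ^ j) (c : F) {h k : F[X]} (hhk : M ∣ h - k) :
    Lam p χ Fp 0 c h = Lam p χ Fp 0 c k := by
  obtain ⟨e0, e1⟩ := coeff_eq_of_dvd hXM hhk
  simp only [Lam]
  rw [polyRes_congr hFp hFM hhk, e0, e1]
  simp

/-- vanishing of the coefficients, trivial additive character at infinity -/
lemma Lam_sum_zero2 {Fp M : F[X]} (hFp : Fp.Monic) (hX : X ∣ Fp) (hM : M.Monic) (hXM : X ^ 2 ∣ M)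
    {j : ℕ} (hFM : Fp ∣ M ^ j) {j' : ℕ} (hMF : M ∣ Fp ^ j') (c : F)
    (v : F[X]) (hv0 : Lam p χ Fp 0 c v ≠ 0) (hv1 : Lam p χ Fp 0 c v ≠ 1)
    (d : ℕ) (hd : M.natDegree < d) :
    ∑ h ∈ monics F d, Lam p χ Fp 0 c h = 0 := by
  have hcop : IsCoprime M v := by
    rw [Polynomial.isCoprime_iff_aeval_ne_zero_of_isAlgClosed F (AlgebraicClosure F)]
    intro β
    by_contra hcon
    push Not at hcon
    apply hv0
    have h1 : aeval β Fp = 0 := by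
      have := aeval_eq_zero_of_dvd_aeval_eq_zero hMF hcon.1
      rw [map_pow] at this
      exact eq_zero_of_pow_eq_zero this
    rw [Lam, polyRes_eq_zero (AlgebraicClosure F) hFp β h1 hcon.2, χ.map_zero, zero_mul]
  let φ : F[X] → F[X] := fun h => h - h %ₘ M + (v * h) %ₘ M
  have hφM : ∀ h, M ∣ φ h - v * h := by
    intro h
    have h1 : M ∣ h - h %ₘ M := by
      rw [modByMonic_eq_sub_mul_div h]; simp
    have h2 : M ∣ v * h - (v * h) %ₘ M := by
      rw [modByMonic_eq_sub_mul_div (v * h)]; simp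
    have := dvd_sub h1 h2
    simp only [φ]
    convert this using 1
    ring
  have hMne : M ≠ 1 := by
    rintro rfl
    have := natDegree_le_of_dvd hXM one_ne_zero
    simp at this
  have hmem : ∀ h ∈ monics F d, φ h ∈ monics F d := by
    intro h hh
    rw [mem_monics] at hh ⊢
    have hlt : (-(h %ₘ M) + (v * h) %ₘ M).degree < h.degree := by
      have e1 : M.degree < h.degree := by
        rw [degree_eq_natDegree hh.1.ne_zero, degree_eq_natDegree hM.ne_zero, hh.2]
        exact_mod_cast hd
      refine lt_trans (lt_of_le_of_lt (degree_add_le _ _) (max_lt ?_ ?_)) e1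
      · rw [degree_neg]; exact degree_modByMonic_lt _ hM
      · exact degree_modByMonic_lt _ hM
    have : φ h = h + (-(h %ₘ M) + (v * h) %ₘ M) := by simp only [φ]; ring
    rw [this]
    exact ⟨hh.1.add_of_left hlt, by rw [natDegree_add_eq_left_of_degree_lt hlt, hh.2]⟩
  have hinj : Set.InjOn φ (monics F d) := by
    intro h _ k _ hhk
    have h1 : M ∣ v * (h - k) := by
      have := dvd_sub (hφM k) (hφM h)
      rw [hhk] at this
      convert this using 1
      ring
    have h2 : M ∣ h - k := hcop.dvd_of_dvd_mul_left h1
    have h3 : h %ₘ M = k %ₘ M := by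
      have := (modByMonic_eq_zero_iff_dvd hM).2 h2
      rwa [sub_modByMonic, sub_eq_zero] at this
    have h4 : (v * h) %ₘ M = (v * k) %ₘ M := by
      have : M ∣ v * h - v * k := by rw [← mul_sub]; exact h1
      have := (modByMonic_eq_zero_iff_dvd hM).2 this
      rwa [sub_modByMonic, sub_eq_zero] at this
    simp only [φ, h3, h4] at hhk
    exact sub_left_injective (add_left_injective _ hhk)
  have himg : (monics F d).image φ = monics F d := by
    refine Finset.eq_of_subset_of_card_le ?_ ?_
    · intro x hx
      obtain ⟨h, hh, rfl⟩ := Finset.mem_image.1 hx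
      exact hmem h hh
    · rw [Finset.card_image_of_injOn hinj]
  have h1 : ∑ h ∈ monics F d, Lam p χ Fp 0 c h
      = Lam p χ Fp 0 c v * ∑ h ∈ monics F d, Lam p χ Fp 0 c h := by
    conv_lhs => rw [← himg]
    rw [Finset.sum_image hinj, Finset.mul_sum]
    refine Finset.sum_congr rfl fun h _ => ?_
    rw [Lam_congr p χ hFp hXM hFM c (hφM h), Lam_mul p χ hFp hX 0 c _ _ (Or.inl rfl)]
  have h3 : (Lam p χ Fp 0 c v - 1) * ∑ h ∈ monics F d, Lam p χ Fp 0 c h = 0 := by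
    rw [sub_mul, ← h1, one_mul, sub_self]
  exact (mul_eq_zero.1 h3).resolve_left (sub_ne_zero.2 hv1)

end

lemma coeff_ratio_prod {R : Type*} [Field R] (a : ℕ → R) (ha : ∀ i, a i ≠ 0) (r : ℕ) :
    (∏ i ∈ Finset.range r, (X - C (a i))).coeff 0 ≠ 0 ∧
    (∏ i ∈ Finset.range r, (X - C (a i))).coeff 1 / (∏ i ∈ Finset.range r, (X - C (a i))).coeff 0
      = - ∑ i ∈ Finset.range r, (a i)⁻¹ := by
  induction r with
  | zero => simp [coeff_one]
  | succ r ih =>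
    have h0 : (X - C (a r)).coeff 0 ≠ 0 := by simpa using ha r
    have h1 : (X - C (a r)).coeff 1 / (X - C (a r)).coeff 0 = - (a r)⁻¹ := by
      simp [coeff_X, coeff_C, div_neg]
    rw [Finset.prod_range_succ, Finset.sum_range_succ, coeff_ratio_mul _ _ ih.1 h0, ih.2, h1]
    refine ⟨?_, by ring⟩
    rw [mul_coeff_zero]
    exact mul_ne_zero ih.1 h0

theorem weil_sum {F : Type*} [Field F] [Fintype F]
    (p ν : ℕ) [Fact p.Prime] [CharP F p] [Algebra (ZMod p) F]
    (hν : Fintype.card F = p ^ ν) (χ : MulChar F ℂ)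
    (hχ : ∀ u : F, χ u = 1 → u = 1) (Fp M : F[X]) (hFp : Fp.Monic) (hX : X ∣ Fp)
    (hM : M.Monic) (hXM : X ^ 2 ∣ M) (j j' : ℕ) (hFM : Fp ∣ M ^ j) (hMF : M ∣ Fp ^ j') (b c : F)
    (hyp : (b ≠ 0 ∨ c ≠ 0) ∨ ∀ h : (AlgebraicClosure F)[X],
      h ^ (Fintype.card F - 1) ≠ Fp.map (algebraMap F (AlgebraicClosure F))) :
    ‖∑ α : F, χ (Fp.eval α) * psi1 p F (b * α + c * α⁻¹)‖
      ≤ M.natDegree * Real.sqrt (Fintype.card F) := by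
  have hp : p.Prime := Fact.out
  set Q := Fintype.card F with hQ
  have hQ2 : 2 ≤ Q := Fintype.one_lt_card
  have hν0 : 0 < ν := by
    rcases Nat.eq_zero_or_pos ν with h | h
    · rw [h, pow_zero] at hν; omega
    · exact h
  let E := AlgebraicClosure F
  have : CharP E p := charP_of_injective_algebraMap (algebraMap F E).injective p
  have hinjE : Function.Injective (algebraMap F E) := (algebraMap F E).injective
  set ε : F := (-1) ^ Fp.natDegree with hε
  have hε2 : ∀ r : ℕ, ε ^ r * ε ^ r = 1 := by
    intro r; rw [hε, ← mul_pow, ← mul_pow]; simp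
  have hε0 : ∀ r : ℕ, ε ^ r ≠ 0 := fun r h => by have := hε2 r; rw [h] at this; simp at this
  -- local data at points
  have hres : ∀ (r : ℕ) (hr : r ≠ 0) (α : E), α ∈ fixedPts E Q r →
      algebraMap F E (ε ^ r * polyRes Fp (minPow F α r)) =
        (Fp.map (algebraMap F E)).eval α ^ ((Q ^ r - 1) / (Q - 1)) := by
    intro r hr α hα
    rw [map_mul, polyRes_map E hFp, minPow_map p ν hν hr hα]
    simp_rw [eval_prod, eval_sub, eval_X, eval_C]
    rw [Multiset.prod_map_prod]
    simp_rw [prod_roots_sub E hFp]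
    rw [Finset.prod_mul_distrib, Finset.prod_const, Finset.card_range, ← mul_assoc]
    have : (algebraMap F E) (ε ^ r) * ((-1) ^ Fp.natDegree) ^ r = 1 := by
      have h1 := congrArg (algebraMap F E) (hε2 r)
      rw [map_mul, map_one] at h1
      have h2 : algebraMap F E (ε ^ r) = ((-1) ^ Fp.natDegree) ^ r := by rw [hε]; simp
      rw [← h2]; exact h1
    rw [this, one_mul, ← Nat.geomSum_eq hQ2, ← Finset.prod_pow_eq_pow_sum]
    refine Finset.prod_congr rfl fun i _ => ?_
    have := eval_frob_fixed p ν (Fp.map (algebraMap F E)) (by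
      rw [Polynomial.map_map]
      congr 1
      ext x
      simp only [RingHom.comp_apply, iterateFrobenius_def]
      rw [← map_pow, ← hν, FiniteField.pow_card]) i α
    rw [← hν] at this
    exact this.symm
  let U : ℕ → E → F := fun r α => ε ^ r * polyRes Fp (minPow F α r)
  let S : ℕ → E → F := fun r α => -b * (minPow F α r).nextCoeff -
    c * ((minPow F α r).coeff 1 / (minPow F α r).coeff 0)
  have hS : ∀ (r : ℕ) (hr : r ≠ 0) (α : E), α ∈ fixedPts E Q r → α ≠ 0 →
      algebraMap F E (S r α) = ∑ i ∈ Finset.range r,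
          (algebraMap F E b * α + algebraMap F E c * α⁻¹) ^ Q ^ i := by
    intro r hr α hα hα0
    have hmap := minPow_map p ν hν hr hα
    have h1 := nextCoeff_map hinjE (minPow F α r)
    rw [hmap, prod_X_sub_C_nextCoeff] at h1
    have h2 := (coeff_ratio_prod (fun i => α ^ Q ^ i) (fun i => pow_ne_zero _ hα0) r).2
    rw [← hQ] at hmap
    rw [← hmap, coeff_map, coeff_map] at h2
    simp only [S]
    rw [map_sub, map_mul, map_mul, map_neg, map_div₀, h2, ← h1]
    rw [neg_mul_neg, mul_neg, sub_neg_eq_add, Finset.mul_sum, Finset.mul_sum,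
      ← Finset.sum_add_distrib]
    refine Finset.sum_congr rfl fun i _ => ?_
    have hbb : ∀ x : F, (algebraMap F E x) ^ Q ^ i = algebraMap F E x := by
      intro x; rw [← map_pow, FiniteField.pow_card_pow]
    have hpi : Q ^ i = p ^ (ν * i) := by rw [hν, ← pow_mul]
    rw [hpi, add_pow_char_pow, mul_pow, mul_pow, ← hpi, hbb, hbb, inv_pow]
  have hLam : ∀ (r : ℕ) (hr : r ≠ 0) (α : E), α ∈ fixedPts E Q r →
      Lam p χ Fp b c (minPow F α r) = χ (ε ^ r) * (χ (U r α) * psi1 p F (S r α)) := by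
    intro r hr α hα
    simp only [Lam, U, S]
    rw [← mul_assoc, ← map_mul, ← mul_assoc, hε2, one_mul]
  have hχε : ∀ r : ℕ, ‖χ (ε ^ r)‖ = 1 := by
    intro r
    have : (χ (ε ^ r)) ^ 2 = 1 := by rw [pow_two, ← map_mul, hε2, map_one]
    exact Complex.norm_eq_one_of_pow_eq_one this (by omega)
  let cc : ℕ → ℂ := fun d => ∑ h ∈ monics F d, Lam p χ Fp b c h
  let SS : ℕ → ℂ := fun r => ∑ α ∈ fixedPts E Q r, Lam p χ Fp b c (minPow F α r)
  have hSS : ∀ r : ℕ, r ≠ 0 → SS r = χ (ε ^ r) *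
      ∑ α ∈ (fixedPts E Q r).filter (fun α => α ≠ 0), χ (U r α) * psi1 p F (S r α) := by
    intro r hr
    simp only [SS]
    rw [Finset.sum_congr rfl (hLam r hr), ← Finset.mul_sum]
    congr 1
    rw [Finset.sum_filter]
    refine Finset.sum_congr rfl fun α hα => ?_
    split_ifs with h
    · rfl
    · push Not at h
      have h1 := hres r hr α hα
      have : U r α = 0 := by
        apply hinjE
        rw [h1, h, map_zero]
        have : (Fp.map (algebraMap F E)).eval 0 = 0 := by
          obtain ⟨k, rfl⟩ := hX; simp
        rw [this, zero_pow]
        have h3 : Q - 1 ∣ Q ^ r - 1 := by simpa using Nat.sub_dvd_pow_sub_pow Q 1 r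
        have h4 : 1 < Q ^ r := Nat.one_lt_pow hr (by omega)
        exact (Nat.div_pos (Nat.le_of_dvd (by omega) h3) (by omega)).ne'
      rw [this, χ.map_zero, zero_mul]
  obtain ⟨C, r0, hC⟩ := charsum_bound (E := E) p ν hν hν0 χ hχ Fp hFp b c hyp
  have hSSb : ∀ r ≥ max 1 r0, ‖SS (2 * r)‖ ≤ C * (Q : ℝ) ^ r := by
    intro r hr
    have hr1 : 1 ≤ r := (le_max_left _ _).trans hr
    rw [hSS (2 * r) (by omega), norm_mul, hχε, one_mul]
    refine hC r ((le_max_right _ _).trans hr) (U (2 * r)) (S (2 * r)) ?_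
    intro α hα hα0
    exact ⟨hres (2 * r) (by omega) α hα, hS (2 * r) (by omega) α hα hα0⟩
  -- vanishing
  have hvan : ∀ d > M.natDegree, cc d = 0 := by
    intro d hd
    by_cases hb : b = 0
    · by_cases hv : ∃ v : F[X], Lam p χ Fp 0 c v ≠ 0 ∧ Lam p χ Fp 0 c v ≠ 1
      · obtain ⟨v, hv0, hv1⟩ := hv
        simp only [cc, hb]
        exact Lam_sum_zero2 p χ hFp hX hM hXM hFM hMF c v hv0 hv1 d hd
      · exfalso
        push Not at hv
        obtain ⟨n0, hn0⟩ := exists_nat_ge (C + Fp.natDegree)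
        set r := max (max 1 r0) (n0 + 1) with hr
        have hr1 : 1 ≤ r := (le_max_left _ _).trans (le_max_left _ _)
        have hb1 := hSSb r (le_max_left _ _)
        have hk1 : 1 < Q ^ (2 * r) := Nat.one_lt_pow (by omega) (by omega)
        have hcard := card_fixedPts (E := E) p hk1
          (dvd_pow (hν ▸ dvd_pow_self p hν0.ne') (by omega))
        have hval : ∀ α ∈ fixedPts E Q (2 * r), Lam p χ Fp b c (minPow F α (2 * r))
            = if α ∈ (Fp.map (algebraMap F E)).roots.toFinset then 0 else 1 := by
          intro α hα
          have h1 := hres (2 * r) (by omega) α hα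
          have hiff : α ∈ (Fp.map (algebraMap F E)).roots.toFinset ↔
              (Fp.map (algebraMap F E)).eval α = 0 := by
            rw [Multiset.mem_toFinset, mem_roots (hFp.map _).ne_zero, IsRoot.def]
          have h3 : Q - 1 ∣ Q ^ (2 * r) - 1 := by simpa using Nat.sub_dvd_pow_sub_pow Q 1 (2 * r)
          have h4 := (Nat.div_pos (Nat.le_of_dvd (by omega) h3) (by omega : 0 < Q - 1)).ne'
          split_ifs with h
          · rw [hiff] at h
            rw [h, zero_pow h4] at h1
            have : U (2 * r) α = 0 := hinjE (by rw [map_zero]; exact h1)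
            rw [hLam (2 * r) (by omega) α hα, this, χ.map_zero]; ring
          · rw [hiff] at h
            have hv' := hv (minPow F α (2 * r))
            rw [← hb] at hv'
            apply hv'
            have h5 : U (2 * r) α ≠ 0 := by
              intro h0
              apply pow_ne_zero ((Q ^ (2 * r) - 1) / (Q - 1)) h
              rw [← h1]
              simp only [U] at h0
              rw [h0, map_zero]
            rw [hLam (2 * r) (by omega) α hα]
            refine mul_ne_zero ?_ (mul_ne_zero ?_ ?_)
            · intro h0; have := hχε (2 * r); rw [h0] at this; simp at this
            · exact (h5.isUnit.map χ).ne_zero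
            · intro h0; have := AddChar.norm_apply (psi1 p F) (S (2 * r) α); rw [h0] at this
              simp at this
        have hSv : SS (2 * r) = ((fixedPts E Q (2 * r)).filter
            (fun α => α ∉ (Fp.map (algebraMap F E)).roots.toFinset)).card := by
          simp only [SS]
          rw [Finset.sum_congr rfl hval, Finset.card_filter]
          push_cast
          refine Finset.sum_congr rfl fun α _ => ?_
          by_cases h : α ∈ (Fp.map (algebraMap F E)).roots.toFinset <;> simp [h]
        have hge : Q ^ (2 * r) ≤ ((fixedPts E Q (2 * r)).filter
            (fun α => α ∉ (Fp.map (algebraMap F E)).roots.toFinset)).card + Fp.natDegree := by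
          rw [← hcard, ← Finset.card_filter_add_card_filter_not
            (fun α => α ∉ (Fp.map (algebraMap F E)).roots.toFinset)]
          refine Nat.add_le_add_left ?_ _
          refine (Finset.card_le_card (t := (Fp.map (algebraMap F E)).roots.toFinset) ?_).trans ?_
          · intro x hx
            simpa using (Finset.mem_filter.1 hx).2
          · refine (Multiset.toFinset_card_le _).trans ((card_roots' _).trans ?_)
            rw [natDegree_map]
        rw [hSv, Complex.norm_natCast] at hb1
        have hge' : (Q : ℝ) ^ (2 * r) ≤ ((fixedPts E Q (2 * r)).filter
            (fun α => α ∉ (Fp.map (algebraMap F E)).roots.toFinset)).card + Fp.natDegree := by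
          exact_mod_cast hge
        have h6 : ((Q : ℝ) ^ r) * (Q : ℝ) ^ r ≤ (C + Fp.natDegree) * (Q : ℝ) ^ r := by
          rw [← pow_add, ← two_mul]
          have : (1 : ℝ) ≤ (Q : ℝ) ^ r := one_le_pow₀ (by exact_mod_cast (by omega : 1 ≤ Q))
          have h7 : (0:ℝ) ≤ Fp.natDegree := by positivity
          nlinarith
        have h8 : (Q : ℝ) ^ r ≤ C + Fp.natDegree := le_of_mul_le_mul_right h6 (by positivity)
        have h9 : (r : ℝ) < (Q : ℝ) ^ r := by exact_mod_cast Nat.lt_pow_self (by omega : 1 < Q)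
        have h10 : ((n0 + 1 : ℕ) : ℝ) ≤ r := by exact_mod_cast le_max_right _ _
        push_cast at h10
        linarith
    · exact Lam_sum_zero1 p χ hFp hM hXM hFM b c hb d hd
  have hcc0 : cc 0 = 1 := by
    have : monics F 0 = {1} := by
      ext h
      rw [mem_monics, Finset.mem_singleton]
      constructor
      · rintro ⟨h1, h2⟩; exact h1.natDegree_eq_zero.1 h2
      · rintro rfl; exact ⟨monic_one, natDegree_one⟩
    simp only [cc, this, Finset.sum_singleton]
    exact Lam_one p χ hFp b c
  have hmain := newton_bound M.natDegree cc SS (Real.sqrt Q) C (Real.sqrt_pos.2 (by positivity))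
    (max 1 r0) hcc0 hvan (fun d _ => newton_identity (E := E) (Lam p χ Fp b c)
      (fun h k hh hk => Lam_mul p χ hFp hX b c h k (Or.inr ⟨hh, hk⟩)) d) (by
      intro r hr
      rw [pow_mul, Real.sq_sqrt (by positivity)]
      exact hSSb r hr)
  have hc1 : cc 1 = χ ε * ∑ α : F, χ (Fp.eval α) * psi1 p F (b * α + c * α⁻¹) := by
    simp only [cc]
    rw [Finset.mul_sum]
    symm
    refine Finset.sum_bij (fun α _ => X - Polynomial.C α) ?_ ?_ ?_ ?_
    · intro α _
      rw [mem_monics]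
      exact ⟨monic_X_sub_C _, natDegree_X_sub_C _⟩
    · intro α _ β _ h
      have := sub_right_injective h
      exact C_injective this
    · intro h hh
      rw [mem_monics] at hh
      refine ⟨-h.coeff 0, Finset.mem_univ _, ?_⟩
      rw [map_neg, sub_neg_eq_add]
      have := hh.1.eq_X_add_C hh.2
      exact this.symm
    · intro α _
      simp only [Lam]
      have h1 : polyRes Fp (X - Polynomial.C α) = ε * Fp.eval α := by
        apply hinjE
        rw [polyRes_map E hFp, map_mul]
        simp only [Polynomial.map_sub, map_X, map_C, eval_sub, eval_X, eval_C]
        rw [prod_roots_sub E hFp, hε, eval_map_algebraMap, aeval_algebraMap_apply]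
        simp
      rw [h1, map_mul, mul_assoc, nextCoeff_X_sub_C]
      congr 3
      simp [coeff_X, coeff_C, div_neg]
  rw [hc1, norm_mul] at hmain
  have := hχε 1
  rw [pow_one] at this
  rwa [this, one_mul] at hmain

lemma descend_root {F : Type*} [Field F] [Fintype F] (Fp : F[X]) (hFp : Fp.Monic)
    (d : ℕ) (hd : d ≠ 0) (h : (AlgebraicClosure F)[X])
    (hh : h ^ d = Fp.map (algebraMap F (AlgebraicClosure F))) : ∃ H : F[X], H ^ d = Fp := by
  obtain ⟨h', hm, hh'⟩ := monic_root (hFp.map (algebraMap F (AlgebraicClosure F))) hd hh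
  obtain ⟨p, hp⟩ := CharP.exists F
  obtain ⟨ν, hp1, hν⟩ := FiniteField.card F p
  haveI : Fact p.Prime := ⟨hp1⟩
  haveI : CharP (AlgebraicClosure F) p := charP_of_injective_algebraMap (algebraMap F _).injective p
  have hfrob : h'.map (iterateFrobenius (AlgebraicClosure F) p ν) = h' := by
    refine monic_pow_inj hm (hm.map _) hd ?_
    rw [← Polynomial.map_pow, hh', Polynomial.map_map]
    congr 1
    ext x
    simp only [RingHom.comp_apply, iterateFrobenius_def]
    rw [← map_pow, ← hν, FiniteField.pow_card]
  have hlift : h' ∈ lifts (algebraMap F (AlgebraicClosure F)) := by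
    rw [lifts_iff_coeff_lifts]
    intro k
    apply mem_range_of_pow_card
    conv_rhs => rw [← hfrob]
    rw [coeff_map, iterateFrobenius_def, ← hν]
  obtain ⟨H, hH⟩ := (mem_lifts _).1 hlift
  refine ⟨H, Polynomial.map_injective (algebraMap F (AlgebraicClosure F)) (algebraMap F _).injective ?_⟩
  rw [Polynomial.map_pow, hH, hh']

lemma dvd_X_pow {F : Type*} [Field F] {A : F[X]} {e : ℕ} (h : A ∣ X ^ e) :
    ∃ (c : F) (k : ℕ), c ≠ 0 ∧ A = C c * X ^ k := by
  obtain ⟨k, -, hk⟩ := (dvd_prime_pow Polynomial.prime_X e).1 h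
  obtain ⟨u, hu⟩ := hk.symm
  obtain ⟨r, hr, hr'⟩ := Polynomial.isUnit_iff.1 u.isUnit
  exact ⟨r, k, hr.ne_zero, by rw [← hu, ← hr', mul_comm]⟩

lemma ratfunc_root {F : Type*} [Field F] (R : RatFunc F) (g : ℕ) (hg : 0 < g) (c : F) (hc : c ≠ 0)
    (k : ℤ) (h : R ^ g = RatFunc.C c * RatFunc.X ^ k) :
    ∃ (c' : F) (k' : ℤ), R = RatFunc.C c' * RatFunc.X ^ k' := by
  have hR : R ≠ 0 := by
    rintro rfl
    rw [zero_pow hg.ne'] at h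
    have : RatFunc.C c * RatFunc.X ^ k ≠ (0 : RatFunc F) :=
      mul_ne_zero (by simpa using hc) (zpow_ne_zero _ RatFunc.X_ne_zero)
    exact this h.symm
  have hnum : R.num ≠ 0 := RatFunc.num_ne_zero hR
  have hden := R.denom_ne_zero
  have hcop := (RatFunc.isCoprime_num_denom R)
  obtain ⟨a, b, hab⟩ : ∃ a b : ℕ, k = (a : ℤ) - b := ⟨k.toNat, (-k).toNat, by omega⟩
  have key : R.num ^ g * X ^ b = C c * X ^ a * R.denom ^ g := by
    apply RatFunc.algebraMap_injective F
    rw [← RatFunc.num_div_denom R, div_pow, hab, zpow_sub₀ RatFunc.X_ne_zero, zpow_natCast,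
      zpow_natCast] at h
    have h1 : algebraMap F[X] (RatFunc F) R.denom ≠ 0 := RatFunc.algebraMap_ne_zero hden
    have h2 : (RatFunc.X : RatFunc F) ≠ 0 := RatFunc.X_ne_zero
    simp only [map_mul, map_pow, RatFunc.algebraMap_X, RatFunc.algebraMap_C]
    field_simp at h
    rw [h]; ring
  have d1 : R.num ∣ X ^ a := by
    have : R.num ^ g ∣ C c * X ^ a := (hcop.pow).dvd_of_dvd_mul_right (Dvd.intro _ key)
    have := (dvd_pow_self R.num hg.ne').trans this
    exact ((isUnit_C.2 hc.isUnit).dvd_mul_left).1 this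
  have d2 : R.denom ∣ X ^ b := by
    have : R.denom ^ g ∣ X ^ b := (hcop.symm.pow).dvd_of_dvd_mul_left (Dvd.intro_left _ key.symm)
    exact (dvd_pow_self R.denom hg.ne').trans this
  obtain ⟨c1, k1, hc1, e1⟩ := dvd_X_pow d1
  obtain ⟨c2, k2, hc2, e2⟩ := dvd_X_pow d2
  refine ⟨c1 / c2, k1 - k2, ?_⟩
  conv_lhs => rw [← RatFunc.num_div_denom R, e1, e2]
  simp only [map_mul, map_pow, RatFunc.algebraMap_X, RatFunc.algebraMap_C, map_div₀]
  rw [zpow_sub₀ RatFunc.X_ne_zero, zpow_natCast, zpow_natCast]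
  have h2 : (RatFunc.X : RatFunc F) ≠ 0 := RatFunc.X_ne_zero
  have h3 : RatFunc.C c2 ≠ (0 : RatFunc F) := by simpa using hc2
  field_simp

lemma intDegree_pow' {F : Type*} [Field F] (R : RatFunc F) (hR : R ≠ 0) (k : ℕ) :
    (R ^ k).intDegree = k * R.intDegree := by
  induction k with
  | zero => simp
  | succ k ih => rw [pow_succ, RatFunc.intDegree_mul (pow_ne_zero _ hR) hR, ih]; push_cast; ring

/-- `f ^ j * X ^ i = c * H ^ (Q-1)` forces `f` to be of the form `c x^k h^d`, or both exponents
to be trivial. -/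
lemma exceptional_of_power {F : Type*} [Field F] (f : RatFunc F) (hf0 : f ≠ 0) (N : ℕ) (hN : 0 < N)
    (i j : ℕ) (c : F) (hc : c ≠ 0) (H : RatFunc F)
    (h : RatFunc.X ^ i * f ^ j = RatFunc.C c * H ^ N)
    (hf : ¬ ∃ (c : F) (i : ℤ) (h : RatFunc F) (d : ℕ), 1 < d ∧ d ∣ N ∧
      f = RatFunc.C c * RatFunc.X ^ i * h ^ d) : N ∣ i ∧ N ∣ j := by
  have hX : (RatFunc.X : RatFunc F) ≠ 0 := RatFunc.X_ne_zero
  have hcc : RatFunc.C c ≠ (0 : RatFunc F) := by simpa using hc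
  have hH : H ≠ 0 := by
    rintro rfl
    rw [zero_pow hN.ne', mul_zero] at h
    exact mul_ne_zero (pow_ne_zero _ hX) (pow_ne_zero _ hf0) h
  have hj : N ∣ j := by
    by_contra hj
    apply hf
    set g := Nat.gcd j N with hg
    have hgpos : 0 < g := Nat.gcd_pos_of_pos_right _ hN
    obtain ⟨d, hd⟩ : g ∣ N := Nat.gcd_dvd_right _ _
    have hbez := Nat.gcd_eq_gcd_ab j N
    set x := Nat.gcdA j N
    set y := Nat.gcdB j N
    have hfg : f ^ g = (RatFunc.C c ^ x * RatFunc.X ^ (-(i * x) : ℤ)) * ((H ^ x * f ^ y) ^ d) ^ g := by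
      have hfj : f ^ j = RatFunc.C c * RatFunc.X ^ (-(i : ℤ)) * H ^ N := by
        rw [zpow_neg, zpow_natCast]
        field_simp
        rw [← h]; ring
      have : f ^ g = (f ^ j) ^ x * (f ^ y) ^ N := by
        rw [← zpow_natCast f g, hg, hbez, zpow_add₀ hf0, zpow_mul, zpow_natCast,
          mul_comm (N : ℤ) y, zpow_mul, zpow_natCast]
      rw [this, hfj, ← pow_mul, mul_comm d g, ← hd, mul_zpow, mul_zpow, mul_pow, ← zpow_mul,
        neg_mul]
      rw [← zpow_natCast H N, ← zpow_natCast (H ^ x), ← zpow_mul, ← zpow_mul, mul_comm x (N : ℤ)]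
      ring
    set H' := H ^ x * f ^ y
    have hH' : H' ≠ 0 := mul_ne_zero (zpow_ne_zero _ hH) (zpow_ne_zero _ hf0)
    obtain ⟨c', k', hk⟩ := ratfunc_root (f / H' ^ d) g hgpos (c ^ x) (zpow_ne_zero _ hc)
      (-(i * x) : ℤ) (by
        rw [div_pow, hfg, mul_div_assoc, div_self (pow_ne_zero _ (pow_ne_zero _ hH')), mul_one,
          map_zpow₀])
    refine ⟨c', k', H', d, ?_, ⟨g, by rw [hd, mul_comm]⟩, ?_⟩
    · have hd0 : d ≠ 0 := by rintro rfl; omega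
      have hd1 : d ≠ 1 := by
        rintro rfl
        apply hj
        rw [mul_one] at hd
        rw [hd]; exact Nat.gcd_dvd_left _ _
      omega
    · rw [← hk, div_mul_cancel₀ _ (pow_ne_zero _ hH')]
  refine ⟨?_, hj⟩
  have := congrArg RatFunc.intDegree h
  rw [RatFunc.intDegree_mul (pow_ne_zero _ hX) (pow_ne_zero _ hf0), intDegree_pow' _ hX,
    intDegree_pow' _ hf0, RatFunc.intDegree_mul hcc (pow_ne_zero _ hH), intDegree_pow' _ hH,
    RatFunc.intDegree_X, RatFunc.intDegree_C] at this
  obtain ⟨e, rfl⟩ := hj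
  have h3 : (i : ℤ) = N * (H.intDegree - e * f.intDegree) := by push_cast at this; linarith
  exact Int.natCast_dvd_natCast.1 ⟨_, h3⟩

lemma mulchar_pow_card {F : Type*} [Field F] [Fintype F] (χ : MulChar F ℂ) {u : F} (hu : u ≠ 0) :
    χ u ^ (Fintype.card F - 1) = 1 := by
  rw [← map_pow, FiniteField.pow_card_sub_one_eq_one u hu, map_one]

lemma mulchar_norm {F : Type*} [Field F] [Fintype F] (χ : MulChar F ℂ) {u : F} (hu : u ≠ 0) :
    ‖χ u‖ = 1 :=
  Complex.norm_eq_one_of_pow_eq_one (mulchar_pow_card χ hu)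
    (by have := Fintype.one_lt_card (α := F); omega)

theorem weil_main {F : Type*} [Field F] [Fintype F]
    (p ν : ℕ) [Fact p.Prime] [CharP F p] [Algebra (ZMod p) F]
    (hν : Fintype.card F = p ^ ν) (χ : MulChar F ℂ)
    (hχ : ∀ u : F, χ u = 1 → u = 1) (hQ3 : 3 ≤ Fintype.card F) (f : RatFunc F) (hf0 : f ≠ 0)
    (hf : ¬ ∃ (c : F) (i : ℤ) (h : RatFunc F) (d : ℕ), 1 < d ∧ d ∣ Fintype.card F - 1 ∧
      f = RatFunc.C c * RatFunc.X ^ i * h ^ d)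
    (i j : ℕ) (hi : 0 < i) (hj : 0 < j) (b c : F)
    (hyp : (b ≠ 0 ∨ c ≠ 0) ∨ ¬ (Fintype.card F - 1 ∣ i ∧ Fintype.card F - 1 ∣ j)) :
    ‖∑ α : F, χ α ^ i * χ (RatFunc.eval (RingHom.id F) α f) ^ j * psi1 p F (b * α + c * α⁻¹)‖
      ≤ (f.num.natDegree + f.denom.natDegree + 2 : ℕ) * Real.sqrt (Fintype.card F) := by
  set Q := Fintype.card F with hQ
  have hnum : f.num ≠ 0 := RatFunc.num_ne_zero hf0
  have hlc : f.num.leadingCoeff ≠ 0 := leadingCoeff_ne_zero.2 hnum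
  set l := f.num.leadingCoeff with hl
  set f1 : F[X] := C l⁻¹ * f.num with hf1
  set f2 : F[X] := f.denom with hf2
  have hm1 : f1.Monic := by
    rw [hf1, Monic, leadingCoeff_mul, leadingCoeff_C, inv_mul_cancel₀ hlc]
  have hm2 : f2.Monic := RatFunc.monic_denom f
  have hd1 : f1.natDegree = f.num.natDegree := by
    rw [hf1, natDegree_C_mul (inv_ne_zero hlc)]
  set Fp : F[X] := X ^ i * f1 ^ j * f2 ^ (j * (Q - 2)) with hFp
  set M : F[X] := X ^ 2 * f1 * f2 with hM
  have hFpm : Fp.Monic := ((monic_X.pow i).mul (hm1.pow j)).mul (hm2.pow _)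
  have hMm : M.Monic := ((monic_X.pow 2).mul hm1).mul hm2
  have hMd : M.natDegree = f.num.natDegree + f.denom.natDegree + 2 := by
    rw [hM, ((monic_X.pow 2).mul hm1).natDegree_mul hm2, (monic_X.pow 2).natDegree_mul hm1,
      natDegree_X_pow, hd1]; ring
  have hj'pos : 0 < j * (Q - 2) := Nat.mul_pos hj (by omega)
  have key := weil_sum p ν hν χ hχ Fp M hFpm
    (Dvd.dvd.mul_right (Dvd.dvd.mul_right (dvd_pow_self X hi.ne') _) _) hMm
    (Dvd.intro _ (by rw [hM, mul_assoc])) (i + j + j * (Q - 2)) 2 (by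
      rw [hM, hFp, mul_pow (X ^ 2 * f1) f2, mul_pow (X ^ 2) f1]
      refine mul_dvd_mul (mul_dvd_mul ?_ ?_) ?_
      · rw [← pow_mul]; exact pow_dvd_pow _ (by omega)
      · exact pow_dvd_pow _ (by omega)
      · exact pow_dvd_pow _ (by omega)) (by
      rw [hM, hFp, mul_pow (X ^ i * f1 ^ j), mul_pow (X ^ i)]
      refine mul_dvd_mul (mul_dvd_mul ?_ ?_) ?_
      · rw [← pow_mul]; exact pow_dvd_pow _ (by omega)
      · rw [← pow_mul]; exact dvd_pow_self _ (by positivity)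
      · rw [← pow_mul]; exact dvd_pow_self _ (by positivity)) b c (by
      rcases hyp with h | h
      · exact Or.inl h
      · right
        intro h' hh'
        apply h
        obtain ⟨H, hH⟩ := descend_root Fp hFpm (Q - 1) (by omega) h' hh'
        have hf2' : algebraMap F[X] (RatFunc F) f2 ≠ 0 :=
          RatFunc.algebraMap_ne_zero (RatFunc.denom_ne_zero f)
        have e1 : algebraMap F[X] (RatFunc F) f1 = RatFunc.C l⁻¹ * (f * algebraMap F[X] (RatFunc F) f2) := by
          rw [hf1, map_mul, RatFunc.algebraMap_C]
          congr 1
          have := RatFunc.num_div_denom f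
          rw [div_eq_iff hf2'] at this
          exact this
        refine exceptional_of_power f hf0 (Q - 1) (by omega) i j (l ^ j) (pow_ne_zero _ hlc)
          (algebraMap F[X] (RatFunc F) H / (algebraMap F[X] (RatFunc F) f2) ^ j) ?_ hf
        have e2 := congrArg (algebraMap F[X] (RatFunc F)) hH
        rw [map_pow, hFp, map_mul, map_mul, map_pow, map_pow, map_pow, e1, RatFunc.algebraMap_X] at e2
        rw [div_pow, e2, ← pow_mul]
        have hQ1 : Q - 1 = (Q - 2) + 1 := by omega
        rw [hQ1, mul_add, mul_one, pow_add, mul_pow, mul_pow, map_pow]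
        have hlc' : RatFunc.C l ≠ (0 : RatFunc F) := by simpa using hlc
        rw [map_inv₀]
        field_simp
        rw [mul_assoc, ← mul_pow, mul_one_div_cancel hlc', one_pow, mul_one])
  rw [hMd] at key
  refine le_trans (le_of_eq ?_) key
  have hterm : ∀ α : F, χ α ^ i * χ (RatFunc.eval (RingHom.id F) α f) ^ j * psi1 p F (b * α + c * α⁻¹)
      = χ l ^ j * (χ (Fp.eval α) * psi1 p F (b * α + c * α⁻¹)) := by
    intro α
    have he : RatFunc.eval (RingHom.id F) α f = f.num.eval α / f2.eval α := by
      rw [RatFunc.eval]; simp [eval₂_id, hf2]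
    have hn : f.num.eval α = l * f1.eval α := by
      rw [hf1, eval_mul, eval_C, mul_inv_cancel_left₀ hlc]
    rw [← mul_assoc]
    congr 1
    rw [he, hn, hFp]
    simp only [eval_mul, eval_pow, eval_X, map_mul, map_pow]
    by_cases h2 : f2.eval α = 0
    · rw [h2, div_zero, MulChar.map_zero, zero_pow hj.ne', zero_pow hj'pos.ne']; ring
    · have : χ (f2.eval α) ^ (j * (Q - 2)) = (χ (f2.eval α) ^ j)⁻¹ := by
        apply eq_inv_of_mul_eq_one_left
        rw [← pow_add, ← Nat.mul_succ,
          show (Q - 2).succ = Q - 1 by omega, mul_comm, pow_mul, mulchar_pow_card χ h2, one_pow]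
      rw [this, div_eq_mul_inv, map_mul, map_mul]
      have hinv : χ (f2.eval α)⁻¹ = (χ (f2.eval α))⁻¹ := by
        apply eq_inv_of_mul_eq_one_left
        rw [← map_mul, inv_mul_cancel₀ h2, map_one]
      rw [hinv, mul_pow, mul_pow, inv_pow]
      ring
  simp_rw [hterm]
  rw [← Finset.mul_sum, norm_mul, norm_pow, mulchar_norm χ hlc, one_pow, one_mul]

section
variable {A : Type*} [AddCommGroup A] [Fintype A]

/-- `w` has a Fourier expansion with coefficients of total size at most `B`. -/
def L1 (w : A → ℂ) (B : ℝ) : Prop :=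
  ∃ c : AddChar A ℂ → ℂ, (∀ x, w x = ∑ χ, c χ * χ x) ∧ ∑ χ, ‖c χ‖ ≤ B

lemma L1.char (χ : AddChar A ℂ) : L1 (fun x => χ x) 1 := by
  refine ⟨fun η => if η = χ then 1 else 0, fun x => ?_, ?_⟩
  · simp [ite_mul]
  · rw [Finset.sum_eq_single χ]
    · simp
    · intro b _ hb; simp [hb]
    · simp

lemma L1.smul {w : A → ℂ} {B : ℝ} (h : L1 w B) (a : ℂ) : L1 (fun x => a * w x) (‖a‖ * B) := by
  obtain ⟨c, hc, hB⟩ := h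
  refine ⟨fun χ => a * c χ, fun x => ?_, ?_⟩
  · show a * w x = _
    rw [hc, Finset.mul_sum]; exact Finset.sum_congr rfl fun _ _ => by ring
  · simp_rw [norm_mul]; rw [← Finset.mul_sum]; gcongr

lemma L1.sum {ι : Type*} (s : Finset ι) (w : ι → A → ℂ) (B : ι → ℝ) (h : ∀ i ∈ s, L1 (w i) (B i)) :
    L1 (fun x => ∑ i ∈ s, w i x) (∑ i ∈ s, B i) := by
  choose! c hc hB using h
  refine ⟨fun χ => ∑ i ∈ s, c i χ, fun x => ?_, ?_⟩
  · simp_rw [Finset.sum_mul]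
    rw [Finset.sum_comm]
    exact Finset.sum_congr rfl fun i hi => hc i hi x
  · calc ∑ χ, ‖∑ i ∈ s, c i χ‖ ≤ ∑ χ, ∑ i ∈ s, ‖c i χ‖ :=
          Finset.sum_le_sum fun _ _ => norm_sum_le _ _
      _ = ∑ i ∈ s, ∑ χ, ‖c i χ‖ := Finset.sum_comm
      _ ≤ _ := Finset.sum_le_sum hB

lemma L1.congr {w w' : A → ℂ} {B B' : ℝ} (h : L1 w B) (hw : ∀ x, w' x = w x) (hB : B ≤ B') :
    L1 w' B' := by
  obtain ⟨c, hc, h1⟩ := h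
  exact ⟨c, fun x => by rw [hw, hc], h1.trans hB⟩

lemma L1.nonneg {w : A → ℂ} {B : ℝ} (h : L1 w B) : 0 ≤ B := by
  obtain ⟨c, hc, h1⟩ := h
  exact le_trans (Finset.sum_nonneg fun _ _ => norm_nonneg _) h1

lemma L1.mul {w w' : A → ℂ} {B B' : ℝ} (h : L1 w B) (h' : L1 w' B') :
    L1 (fun x => w x * w' x) (B * B') := by
  have hB' := h'.nonneg
  have hB := h.nonneg
  obtain ⟨c, hc, h1⟩ := h
  obtain ⟨c', hc', h1'⟩ := h'
  have key := L1.sum (Finset.univ : Finset (AddChar A ℂ × AddChar A ℂ))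
    (fun χ x => (c χ.1 * c' χ.2) * (χ.1 * χ.2) x) (fun χ => ‖c χ.1 * c' χ.2‖ * 1)
    (fun χ _ => (L1.char (χ.1 * χ.2)).smul _)
  refine key.congr (fun x => ?_) ?_
  · rw [hc, hc', Finset.sum_mul_sum, ← Finset.univ_product_univ, Finset.sum_product]
    refine Finset.sum_congr rfl fun i _ => Finset.sum_congr rfl fun j _ => ?_
    rw [AddChar.mul_apply]; ring
  · simp_rw [norm_mul, mul_one]
    rw [← Finset.univ_product_univ, Finset.sum_product]
    show ∑ x, ∑ y, ‖c x‖ * ‖c' y‖ ≤ _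
    rw [← Finset.sum_mul_sum]
    gcongr

lemma L1.prod {ι : Type*} (s : Finset ι) (w : ι → A → ℂ) (B : ι → ℝ) (h : ∀ i ∈ s, L1 (w i) (B i)) :
    L1 (fun x => ∏ i ∈ s, w i x) (∏ i ∈ s, B i) := by
  induction s using Finset.induction_on with
  | empty => simpa using (L1.char (1 : AddChar A ℂ)).congr (w' := fun _ => 1) (by simp) le_rfl
  | insert a s ha ih =>
    simp_rw [Finset.prod_insert ha]
    exact (h a (by simp)).mul (ih fun i hi => h i (by simp [hi]))

lemma L1_mean {w : A → ℂ} (c : AddChar A ℂ → ℂ) (hc : ∀ x, w x = ∑ χ, c χ * χ x) :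
    c 1 * Fintype.card A = ∑ x, w x := by
  simp_rw [hc]
  rw [Finset.sum_comm]
  simp_rw [← Finset.mul_sum]
  rw [Finset.sum_eq_single 1]
  · simp
  · intro χ _ h
    rw [AddChar.sum_eq_zero_of_ne_one h, mul_zero]
  · simp

/-- complement of the kernel of a homomorphism onto a group of order `n` -/
lemma L1_compl {G : Type*} [AddCommGroup G] [Fintype G] (φ : A →+ G) :
    L1 (fun x => if φ x = 0 then 0 else 1) (2 * (1 - 1 / (Fintype.card G : ℝ))) := by
  have hn : (Fintype.card G : ℝ) ≠ 0 := by exact_mod_cast Fintype.card_ne_zero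
  have hn' : (Fintype.card G : ℂ) ≠ 0 := by exact_mod_cast Fintype.card_ne_zero
  have hn1 : 1 ≤ (Fintype.card G : ℝ) := by exact_mod_cast Fintype.card_pos
  set n := Fintype.card G
  have key := L1.sum (Finset.univ : Finset (AddChar G ℂ))
    (fun η x => (if η = 1 then (1 - 1 / n : ℂ) else - (1 / n)) * (η.compAddMonoidHom φ) x)
    (fun η => ‖(if η = 1 then (1 - 1 / n : ℂ) else - (1 / n))‖ * 1)
    (fun η _ => (L1.char (η.compAddMonoidHom φ)).smul _)
  refine key.congr (fun x => ?_) (le_of_eq ?_)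
  · have h1 : ∀ η : AddChar G ℂ, (if η = 1 then (1 - 1 / n : ℂ) else - (1 / n)) *
        (η.compAddMonoidHom φ) x = (if η = 1 then 1 else 0) - (1 / n) * η (φ x) := by
      intro η
      by_cases h : η = 1
      · simp [h]
      · simp [h]
    simp_rw [h1]
    rw [Finset.sum_sub_distrib, ← Finset.mul_sum, AddChar.sum_apply_eq_ite]
    by_cases h : φ x = 0
    · simp [h, n, hn']
    · simp [h]
  · have h2 : ‖(1 - 1 / n : ℂ)‖ = 1 - 1 / n := by
      rw [show (1 - 1 / n : ℂ) = ((1 - 1 / n : ℝ) : ℂ) by push_cast; rfl, Complex.norm_real,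
        Real.norm_of_nonneg]
      rw [sub_nonneg, div_le_one (by linarith)]; exact hn1
    have h3 : ‖(-(1 / n) : ℂ)‖ = 1 / n := by simp
    have h4 : ∀ η : AddChar G ℂ, ‖(if η = 1 then (1 - 1 / n : ℂ) else - (1 / n))‖ * 1
        = 1 / n + if η = 1 then (1 - 2 / n : ℝ) else 0 := by
      intro η
      by_cases h : η = 1
      · simp only [h, if_true]; rw [h2]; ring
      · simp only [h, if_false]; rw [h3]; ring
    simp_rw [h4]
    rw [Finset.sum_add_distrib, Finset.sum_const, Finset.card_univ, AddChar.card_eq]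
    simp only [Finset.sum_ite_eq', Finset.mem_univ, if_true, nsmul_eq_mul]
    field_simp
    ring
end

section
variable {A : Type*} [AddCommGroup A] [Fintype A] {R : Type*} [CommRing R]

/-- the range of multiplication by `r` -/
def mulRange (ρ : R →+* AddMonoid.End A) (r : R) : AddSubgroup A :=
  AddMonoidHom.range (ρ r : A →+ A)

lemma mem_mulRange (ρ : R →+* AddMonoid.End A) (r : R) (x : A) :
    x ∈ mulRange ρ r ↔ ∃ y, ρ r y = x := Iff.rfl

lemma mulRange_anti (ρ : R →+* AddMonoid.End A) {r s : R} (h : r ∣ s) {x : A}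
    (hx : x ∈ mulRange ρ s) : x ∈ mulRange ρ r := by
  obtain ⟨t, rfl⟩ := h
  obtain ⟨y, rfl⟩ := hx
  exact ⟨ρ t y, by rw [map_mul]; rfl⟩

lemma density (ρ : R →+* AddMonoid.End A) {ι : Type*} (s : Finset ι) (π : ι → R)
    (hcop : ∀ i ∈ s, ∀ j ∈ s, i ≠ j → IsCoprime (π i) (π j)) (n : ι → ℕ)
    (hn : ∀ i ∈ s, (mulRange ρ (π i)).index = n i) :
    ((Finset.univ.filter fun x : A => ∀ i ∈ s, x ∉ mulRange ρ (π i)).card : ℝ)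
      = Fintype.card A * ∏ i ∈ s, (1 - 1 / (n i : ℝ)) := by
  induction s using Finset.induction_on with
  | empty => simp
  | insert a s ha ih =>
    have ih' := ih (fun i hi j hj => hcop i (by simp [hi]) j (by simp [hj]))
      (fun i hi => hn i (by simp [hi]))
    set S := Finset.univ.filter fun x : A => ∀ i ∈ s, x ∉ mulRange ρ (π i) with hS
    set V := mulRange ρ (π a) with hV
    have hna := hn a (by simp)
    rw [← hV] at hna
    -- translation invariance
    have hcop' : IsCoprime (π a) (∏ j ∈ s, π j) :=
      IsCoprime.prod_right fun j hj => hcop a (by simp) j (by simp [hj]) (by rintro rfl; exact ha hj)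
    have hfib : ∀ c : A ⧸ V, (S.filter fun x => (QuotientAddGroup.mk x : A ⧸ V) = c).card
        = (S.filter fun x => x ∈ V).card := by
      intro c
      obtain ⟨y0, rfl⟩ := QuotientAddGroup.mk_surjective c
      obtain ⟨u, v, huv⟩ := hcop'
      set y := ρ ((∏ j ∈ s, π j)) (ρ v y0) with hy
      have hyy : (QuotientAddGroup.mk y0 : A ⧸ V) = QuotientAddGroup.mk y := by
        rw [QuotientAddGroup.eq]
        refine ⟨- ρ u y0, ?_⟩
        have h1 : y0 = ρ (π a) (ρ u y0) + y := by
          have : ρ (π a * u + (∏ j ∈ s, π j) * v) y0 = y0 := by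
            rw [mul_comm (π a), mul_comm _ v, huv, map_one]; rfl
          conv_lhs => rw [← this]
          rw [map_add, map_mul, map_mul]; rfl
        have h2 : (ρ (π a)) (-(ρ u) y0) = - ρ (π a) (ρ u y0) := map_neg _ _
        refine h2.trans ?_
        conv_rhs => rw [h1]
        abel
      rw [hyy]
      have hyV : ∀ j ∈ s, y ∈ mulRange ρ (π j) := fun j hj =>
        mulRange_anti ρ (Finset.dvd_prod_of_mem π hj) ⟨_, rfl⟩
      symm
      refine Finset.card_bij (fun x _ => x + y) ?_ ?_ ?_
      · intro x hx
        simp only [hS, Finset.mem_filter, Finset.mem_univ, true_and] at hx ⊢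
        refine ⟨fun i hi h => hx.1 i hi ?_, ?_⟩
        · exact (AddSubgroup.add_mem_cancel_right _ (hyV i hi)).1 h
        · rw [QuotientAddGroup.eq]
          have : -(x + y) + y = - x := by abel
          rw [this]; exact V.neg_mem hx.2
      · intro x _ x' _ h; exact add_right_cancel h
      · intro z hz
        simp only [hS, Finset.mem_filter, Finset.mem_univ, true_and] at hz
        refine ⟨z - y, ?_, by simp⟩
        simp only [hS, Finset.mem_filter, Finset.mem_univ, true_and]
        refine ⟨fun i hi h => hz.1 i hi ?_, ?_⟩
        · have := (mulRange ρ (π i)).add_mem h (hyV i hi)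
          simpa using this
        · have := QuotientAddGroup.eq.1 hz.2
          have h3 := V.neg_mem this
          have : -(-z + y) = z - y := by abel
          rwa [this] at h3
    have hcount : S.card = n a * (S.filter fun x => x ∈ V).card := by
      rw [Finset.card_eq_sum_card_fiberwise (f := fun x => (QuotientAddGroup.mk x : A ⧸ V))
        (t := Finset.univ) (by simp)]
      rw [Finset.sum_congr rfl fun c _ => hfib c]
      rw [Finset.sum_const, Finset.card_univ, ← hna, AddSubgroup.index, Nat.card_eq_fintype_card,
        smul_eq_mul]
    have hsplit : (Finset.univ.filter fun x : A => ∀ i ∈ insert a s, x ∉ mulRange ρ (π i))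
        = S.filter fun x => ¬ x ∈ V := by
      ext x; simp [hS, hV, and_comm]
    have hadd := Finset.card_filter_add_card_filter_not (s := S) (fun x => x ∈ V)
    have hn0 : (n a : ℝ) ≠ 0 := by
      rw [← hna]; exact_mod_cast AddSubgroup.index_ne_zero_of_finite
    rw [hsplit, Finset.prod_insert ha]
    have h1 : (S.card : ℝ) = n a * (S.filter fun x => x ∈ V).card := by exact_mod_cast hcount
    have h2 : ((S.filter fun x => x ∈ V).card : ℝ) + (S.filter fun x => ¬ x ∈ V).card = S.card := by
      exact_mod_cast hadd
    have h3 : ((S.filter fun x => x ∈ V).card : ℝ) = S.card / n a := by rw [h1]; field_simp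
    have h4 : ((S.filter fun x => ¬ x ∈ V).card : ℝ) = S.card * (1 - 1 / n a) := by
      rw [h3] at h2; linear_combination h2
    rw [h4, ih']; ring

lemma sieve_L1 (ρ : R →+* AddMonoid.End A) {ι : Type*} (s : Finset ι) (π : ι → R) (n : ι → ℕ)
    (hn : ∀ i ∈ s, (mulRange ρ (π i)).index = n i) :
    L1 (fun x : A => if ∀ i ∈ s, x ∉ mulRange ρ (π i) then 1 else 0)
      (∏ i ∈ s, (2 * (1 - 1 / (n i : ℝ)))) := by
  have key := L1.prod s (fun i (x : A) => if QuotientAddGroup.mk' (mulRange ρ (π i)) x = 0 then 0 else 1)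
    (fun i => 2 * (1 - 1 / (n i : ℝ))) (fun i hi => by
      have := L1_compl (QuotientAddGroup.mk' (mulRange ρ (π i)))
      rw [← hn i hi, AddSubgroup.index, Nat.card_eq_fintype_card]
      convert this)
  refine key.congr (fun x => ?_) le_rfl
  simp only [QuotientAddGroup.mk'_apply, QuotientAddGroup.eq_zero_iff]
  by_cases h : ∀ i ∈ s, x ∉ mulRange ρ (π i)
  · rw [if_pos h, Finset.prod_congr rfl fun i hi => if_neg (h i hi), Finset.prod_const_one]
  · rw [if_neg h]
    push Not at h
    obtain ⟨i, hi, hx⟩ := h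
    symm
    refine Finset.prod_eq_zero (i := i) hi ?_
    rw [if_pos hx]
end

lemma sieve_fourier {A : Type*} [AddCommGroup A] [Fintype A] {R : Type*} [CommRing R]
    (ρ : R →+* AddMonoid.End A) {ι : Type*} (s : Finset ι) (π : ι → R)
    (hcop : ∀ i ∈ s, ∀ j ∈ s, i ≠ j → IsCoprime (π i) (π j)) (n : ι → ℕ)
    (hn : ∀ i ∈ s, (mulRange ρ (π i)).index = n i) :
    ∃ c : AddChar A ℂ → ℂ,
      (∀ x : A, (if ∀ i ∈ s, x ∉ mulRange ρ (π i) then 1 else 0) = ∑ χ, c χ * χ x) ∧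
      c 1 = ((∏ i ∈ s, (1 - 1 / (n i : ℝ)) : ℝ) : ℂ) ∧
      ∑ χ, ‖c χ‖ ≤ (∏ i ∈ s, (1 - 1 / (n i : ℝ))) * 2 ^ s.card := by
  obtain ⟨c, hc, hB⟩ := sieve_L1 ρ s π n hn
  refine ⟨c, hc, ?_, ?_⟩
  · have h1 := L1_mean c hc
    rw [Finset.sum_ite, Finset.sum_const_zero, add_zero, Finset.sum_const, nsmul_eq_mul, mul_one] at h1
    have h2 := density ρ s π hcop n hn
    have h3 : (Fintype.card A : ℂ) ≠ 0 := by exact_mod_cast Fintype.card_ne_zero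
    apply mul_right_cancel₀ h3
    rw [h1, ← Complex.ofReal_natCast, h2]
    push_cast
    ring
  · rw [Finset.prod_mul_distrib, Finset.prod_const] at hB
    rwa [mul_comm]

lemma totient_div (l : ℕ) (hl : l ≠ 0) :
    ((l.totient : ℝ) / l) = ∏ p ∈ l.primeFactors, (1 - 1 / (p : ℝ)) := by
  have h := Nat.totient_eq_mul_prod_factors l
  have h' : (l.totient : ℝ) = l * ∏ p ∈ l.primeFactors, (1 - (p : ℝ)⁻¹) := by
    have := congrArg (fun x : ℚ => (x : ℝ)) h
    push_cast at this
    exact this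
  have : (l : ℝ) ≠ 0 := by exact_mod_cast hl
  rw [h', mul_div_cancel_left₀ _ this]
  simp

lemma mult_sieve {F : Type*} [Field F] [Fintype F] (l : ℕ) (hl : l ∣ Fintype.card F - 1) :
    ∃ c : AddChar (Additive Fˣ) ℂ → ℂ,
      (∀ u : Fˣ, (if IsUFree l (u : F) then (1 : ℂ) else 0) = ∑ η, c η * η (Additive.ofMul u)) ∧
      c 1 = (((l.totient : ℝ) / l : ℝ) : ℂ) ∧
      ∑ η, ‖c η‖ ≤ ((l.totient : ℝ) / l) * 2 ^ l.primeFactors.card := by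
  have hQ : 0 < Fintype.card F - 1 := by have := Fintype.one_lt_card (α := F); omega
  have hl0 : l ≠ 0 := by rintro rfl; rw [zero_dvd_iff] at hl; omega
  rw [totient_div l hl0]
  let ρ : ℤ →+* AddMonoid.End (Additive Fˣ) := Module.toAddMonoidEnd ℤ (Additive Fˣ)
  have hmem : ∀ (d : ℕ) (x : Additive Fˣ), x ∈ mulRange ρ (d : ℤ) ↔ ∃ y : Additive Fˣ, d • y = x := by
    intro d x
    rw [mem_mulRange]
    refine exists_congr fun y => ?_
    have : ρ (d : ℤ) y = d • y := by
      show (d : ℤ) • y = _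
      rw [natCast_zsmul]
    rw [this]
  obtain ⟨c, hc, h1, hB⟩ := sieve_fourier ρ l.primeFactors (fun ℓ => (ℓ : ℤ)) (by
    intro i hi j hj hij
    rw [Nat.isCoprime_iff_coprime]
    exact (Nat.coprime_primes (Nat.prime_of_mem_primeFactors hi) (Nat.prime_of_mem_primeFactors hj)).2 hij)
    (fun ℓ => ℓ) (by
    intro ℓ hℓ
    have he : mulRange ρ (ℓ : ℤ) = (nsmulAddMonoidHom ℓ : Additive Fˣ →+ Additive Fˣ).range := by
      ext x
      rw [hmem]
      rfl
    have hcard : Nat.card (Additive Fˣ) = Fintype.card F - 1 := by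
      rw [← Fintype.card_units, ← Nat.card_eq_fintype_card]; rfl
    rw [he, IsAddCyclic.index_nsmulAddMonoidHom_range, hcard]
    exact Nat.gcd_eq_right ((Nat.dvd_of_mem_primeFactors hℓ).trans hl))
  refine ⟨c, fun u => ?_, h1, hB⟩
  rw [← hc]
  congr 1
  rw [eq_iff_iff]
  constructor
  · rintro ⟨-, h⟩ ℓ hℓ hx
    obtain ⟨y, hy⟩ := (hmem _ _).1 hx
    have hp := Nat.prime_of_mem_primeFactors hℓ
    refine hp.one_lt.ne' (h ((Additive.toMul y : Fˣ) : F) ℓ hp.pos (Nat.dvd_of_mem_primeFactors hℓ) ?_)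
    have : u = (Additive.toMul y) ^ ℓ := by
      have := congrArg Additive.toMul hy
      simpa using this.symm
    rw [this, Units.val_pow_eq_pow_val]
  · intro h
    refine ⟨u.ne_zero, fun v d hd hdl huv => ?_⟩
    by_contra hd1
    obtain ⟨ℓ, hℓ, e, rfl⟩ := Nat.exists_prime_and_dvd hd1
    refine h ℓ (Nat.mem_primeFactors.2 ⟨hℓ, (Dvd.intro _ rfl).trans hdl, hl0⟩) ((hmem _ _).2 ?_)
    have hv : v ≠ 0 := by
      rintro rfl
      rw [zero_pow hd.ne'] at huv
      exact u.ne_zero huv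
    refine ⟨Additive.ofMul ((Units.mk0 v hv) ^ e), ?_⟩
    apply Additive.toMul.injective
    simp only [toMul_nsmul, toMul_ofMul]
    ext
    simp [huv, pow_mul, ← pow_mul, mul_comm]

section
variable {K F : Type*} [Field K] [Field F] [Fintype K] [Algebra K F]

/-- the Frobenius module structure -/
noncomputable def frobEnd (K F : Type*) [Field K] [Field F] [Fintype K] [Algebra K F] :
    K[X] →+* AddMonoid.End F :=
  (Module.toAddMonoidEnd (Module.End K F) F).comp
    (aeval (FiniteField.frobeniusAlgHom K F).toLinearMap : K[X] →ₐ[K] Module.End K F).toRingHom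

lemma frob_pow_apply (i : ℕ) (x : F) :
    ((FiniteField.frobeniusAlgHom K F).toLinearMap ^ i) x = x ^ Fintype.card K ^ i := by
  induction i generalizing x with
  | zero => simp
  | succ i ih =>
    rw [pow_succ, Module.End.mul_apply, ih]
    simp only [AlgHom.toLinearMap_apply, FiniteField.coe_frobeniusAlgHom]
    rw [← pow_mul, ← pow_succ']

lemma frobEnd_apply (h : K[X]) (x : F) : frobEnd K F h x = polyAct (Fintype.card K) h x := by
  show (aeval (FiniteField.frobeniusAlgHom K F).toLinearMap h : Module.End K F) x = _
  rw [aeval_eq_sum_range, polyAct, sum_over_range _ (by simp), LinearMap.sum_apply]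
  refine Finset.sum_congr rfl fun i _ => ?_
  rw [LinearMap.smul_apply, frob_pow_apply]

lemma polyAct_zeros (h : K[X]) (hh : h ≠ 0) [Fintype F] :
    (Finset.univ.filter fun x : F => frobEnd K F h x = 0).card ≤ Fintype.card K ^ h.natDegree := by
  have hq : 1 < Fintype.card K := Fintype.one_lt_card
  set q := Fintype.card K
  set L : F[X] := ∑ i ∈ Finset.range (h.natDegree + 1), C (algebraMap K F (h.coeff i)) * X ^ q ^ i with hL
  have hLe : ∀ x, L.eval x = frobEnd K F h x := by
    intro x
    rw [frobEnd_apply, polyAct, sum_over_range _ (by simp), hL, eval_finsetSum]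
    refine Finset.sum_congr rfl fun i _ => ?_
    rw [eval_mul, eval_C, eval_pow, eval_X, Algebra.smul_def]
  have hLd : L.natDegree ≤ q ^ h.natDegree := by
    refine natDegree_sum_le_of_forall_le _ _ fun i hi => ?_
    refine (natDegree_C_mul_X_pow_le _ _).trans (Nat.pow_le_pow_right (by omega) ?_)
    rw [Finset.mem_range] at hi; omega
  have hL0 : L ≠ 0 := by
    intro h0
    have h1 : L.coeff (q ^ h.natDegree) = algebraMap K F h.leadingCoeff := by
      rw [hL, finsetSum_coeff, Finset.sum_eq_single h.natDegree]
      · simp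
      · intro i hi hne
        rw [coeff_C_mul, coeff_X_pow, if_neg, mul_zero]
        intro he
        exact hne (Nat.pow_right_injective hq he).symm
      · simp
    rw [h0, coeff_zero] at h1
    have := (map_eq_zero (algebraMap K F)).1 h1.symm
    exact hh (leadingCoeff_eq_zero.1 this)
  calc _ ≤ L.roots.toFinset.card := by
        refine Finset.card_le_card fun x hx => ?_
        rw [Multiset.mem_toFinset, mem_roots hL0, IsRoot.def, hLe]
        simpa using hx
    _ ≤ Multiset.card L.roots := Multiset.toFinset_card_le _
    _ ≤ L.natDegree := card_roots' _
    _ ≤ _ := hLd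

lemma frob_index [Fintype F] (m : ℕ) (hm : 0 < m) (hF : Fintype.card F = Fintype.card K ^ m)
    (π : K[X]) (hπ : π ∣ X ^ m - 1) :
    (mulRange (frobEnd K F) π).index = Fintype.card K ^ π.natDegree := by
  have hXm : (X ^ m - 1 : K[X]) ≠ 0 := X_pow_sub_C_ne_zero hm 1
  obtain ⟨κ, hκ⟩ := hπ
  have hπ0 : π ≠ 0 := by rintro rfl; rw [zero_mul] at hκ; exact hXm hκ
  have hκ0 : κ ≠ 0 := by rintro rfl; rw [mul_zero] at hκ; exact hXm hκ
  have hdeg : π.natDegree + κ.natDegree = m := by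
    rw [← natDegree_mul hπ0 hκ0, ← hκ]; exact natDegree_X_pow_sub_C
  have hz := polyAct_zeros (F := F) π hπ0
  have hz' := polyAct_zeros (F := F) κ hκ0
  have hact : ∀ x : F, frobEnd K F κ (frobEnd K F π x) = 0 := by
    intro x
    have : frobEnd K F (κ * π) x = frobEnd K F κ (frobEnd K F π x) := by rw [map_mul]; rfl
    rw [← this, mul_comm, ← hκ, map_sub, map_one, map_pow]
    show ((frobEnd K F X) ^ m) x - x = 0
    have h2 : frobEnd K F (X ^ m) x = x ^ Fintype.card K ^ m := by
      rw [frobEnd_apply, polyAct, ← monomial_one_right_eq_X_pow, sum_monomial_index _ _ (by simp), one_smul]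
    rw [map_pow] at h2
    rw [h2, ← hF, FiniteField.pow_card, sub_self]
  let φ : F →+ F := frobEnd K F π
  have hi : (mulRange (frobEnd K F) π).index = Nat.card φ.ker := by
    exact AddSubgroup.index_range (f := φ)
  have hmul := AddSubgroup.card_mul_index (mulRange (frobEnd K F) π)
  have hker : Nat.card φ.ker ≤ Fintype.card K ^ π.natDegree := by
    refine le_trans (le_of_eq ?_) hz
    rw [Nat.card_eq_fintype_card, Fintype.card_subtype]
    congr 1
    ext x
    simp only [Finset.mem_filter, Finset.mem_univ, true_and]
    exact AddMonoidHom.mem_ker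
  have hran : Nat.card (mulRange (frobEnd K F) π) ≤ Fintype.card K ^ κ.natDegree := by
    refine le_trans ?_ hz'
    rw [Nat.card_eq_fintype_card, Fintype.card_subtype]
    refine Finset.card_le_card fun x hx => ?_
    simp only [Finset.mem_filter, Finset.mem_univ, true_and] at hx ⊢
    obtain ⟨y, rfl⟩ := hx
    exact hact y
  rw [Nat.card_eq_fintype_card (α := F), hF, ← hdeg, pow_add] at hmul
  rw [← hi] at hker
  have hpos : 0 < Fintype.card K ^ κ.natDegree := pow_pos Fintype.card_pos _
  nlinarith

lemma irr_coprime {p r : K[X]} (hp : Irreducible p) (hp' : p.Monic) (hr : Irreducible r)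
    (hr' : r.Monic) (h : p ≠ r) : IsCoprime p r := by
  rw [hp.coprime_iff_not_dvd]
  intro hd
  exact h (eq_of_monic_of_associated hp' hr' (hp.associated_of_dvd hr hd))

lemma exists_monic_irr {h : K[X]} (hh : ¬ IsUnit h) (h0 : h ≠ 0) :
    ∃ π : K[X], Irreducible π ∧ π.Monic ∧ π ∣ h := by
  obtain ⟨p, hp, hd⟩ := WfDvdMonoid.exists_irreducible_factor hh h0
  refine ⟨normalize p, ?_, monic_normalize hp.ne_zero, ?_⟩
  · exact (normalize_associated p).symm.irreducible hp
  · exact (normalize_associated p).dvd.trans hd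

lemma add_sieve [Fintype F] (m : ℕ) (hm : 0 < m) (hF : Fintype.card F = Fintype.card K ^ m)
    (g : K[X]) (hg : g ∣ X ^ m - 1) (s : Finset K[X])
    (hs : ∀ p, p ∈ s ↔ Irreducible p ∧ p.Monic ∧ p ∣ g) :
    ∃ c : AddChar F ℂ → ℂ,
      (∀ x : F, (if IsGFree (Fintype.card K) g x then (1 : ℂ) else 0) = ∑ η, c η * η x) ∧
      c 1 = ((∏ π ∈ s, (1 - 1 / ((Fintype.card K ^ π.natDegree : ℕ) : ℝ)) : ℝ) : ℂ) ∧
      ∑ η, ‖c η‖ ≤ (∏ π ∈ s, (1 - 1 / ((Fintype.card K ^ π.natDegree : ℕ) : ℝ))) * 2 ^ s.card := by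
  have hXm : (X ^ m - 1 : K[X]) ≠ 0 := X_pow_sub_C_ne_zero hm 1
  obtain ⟨c, hc, h1, hB⟩ := sieve_fourier (frobEnd K F) s id (by
    intro i hi j hj hij
    exact irr_coprime ((hs _).1 hi).1 ((hs _).1 hi).2.1 ((hs _).1 hj).1 ((hs _).1 hj).2.1 hij)
    (fun π => Fintype.card K ^ π.natDegree) (by
    intro π hπ
    exact frob_index m hm hF π (((hs _).1 hπ).2.2.trans hg))
  refine ⟨c, fun x => ?_, h1, hB⟩
  rw [← hc]
  congr 1
  rw [eq_iff_iff]
  constructor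
  · intro h π hπ hx
    obtain ⟨y, hy⟩ := hx
    have hp := (hs _).1 hπ
    have := h π hp.2.1 hp.2.2 ⟨y, by rw [← frobEnd_apply]; exact hy.symm⟩
    exact hp.1.not_isUnit (this ▸ isUnit_one)
  · intro h k hk hkg hx
    obtain ⟨β, hβ⟩ := hx
    by_contra hk1
    obtain ⟨π, hπ, hπm, hπd⟩ := exists_monic_irr (h := k)
      (fun hu => hk1 (hk.isUnit_iff.1 hu)) hk.ne_zero
    refine h π ((hs _).2 ⟨hπ, hπm, hπd.trans hkg⟩) (mulRange_anti _ hπd ⟨β, ?_⟩)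
    rw [hβ, ← frobEnd_apply]; rfl

lemma finite_quot (g : K[X]) (hg : g ≠ 0) : Module.Finite K (K[X] ⧸ Ideal.span {g}) :=
  (AdjoinRoot.powerBasis hg).finite

lemma card_quot (g : K[X]) (hg : g ≠ 0) :
    Nat.card (K[X] ⧸ Ideal.span {g}) = Fintype.card K ^ g.natDegree := by
  have := finite_quot g hg
  rw [Module.natCard_eq_pow_finrank (K := K), finrank_quotient_span_eq_natDegree,
    Nat.card_eq_fintype_card]

lemma polyTotient_div (g : K[X]) (hg : g ≠ 0) (s : Finset K[X])
    (hs : ∀ p, p ∈ s ↔ Irreducible p ∧ p.Monic ∧ p ∣ g) :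
    (polyTotient g : ℝ) / (Fintype.card K : ℝ) ^ g.natDegree =
      ∏ π ∈ s, (1 - 1 / ((Fintype.card K ^ π.natDegree : ℕ) : ℝ)) := by
  set A := K[X] ⧸ Ideal.span {g} with hA
  have hfin : Finite A := by
    have := finite_quot g hg
    exact Module.finite_of_finite K
  have : Fintype A := Fintype.ofFinite A
  let ρ : K[X] →+* AddMonoid.End A := Module.toAddMonoidEnd K[X] A
  have hmem : ∀ (π : K[X]) (y : K[X]), π ∣ g →
      ((Ideal.Quotient.mk (Ideal.span {g}) y : A) ∈ mulRange ρ π ↔ π ∣ y) := by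
    intro π y hπ
    constructor
    · rintro ⟨z, hz⟩
      obtain ⟨z, rfl⟩ := Ideal.Quotient.mk_surjective z
      have h1 : (Ideal.Quotient.mk (Ideal.span {g}) (π * z) : A) = Ideal.Quotient.mk (Ideal.span {g}) y := hz
      rw [Ideal.Quotient.eq, Ideal.mem_span_singleton] at h1
      have h2 := hπ.trans h1
      exact (dvd_sub_right (Dvd.intro _ rfl)).1 h2
    · rintro ⟨z, rfl⟩
      exact ⟨Ideal.Quotient.mk (Ideal.span {g}) z, rfl⟩
  have hd := density ρ s id (by
    intro i hi j hj hij
    exact irr_coprime ((hs _).1 hi).1 ((hs _).1 hi).2.1 ((hs _).1 hj).1 ((hs _).1 hj).2.1 hij)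
    (fun π => Fintype.card K ^ π.natDegree) (by
    intro π hπ
    have hp := (hs _).1 hπ
    have hle : Ideal.span {g} ≤ Ideal.span {π} := Ideal.span_singleton_le_span_singleton.2 hp.2.2
    let φ : A →+ K[X] ⧸ Ideal.span {π} := (Ideal.Quotient.factor hle).toAddMonoidHom
    have hsur : Function.Surjective φ := Ideal.Quotient.factor_surjective hle
    have hker : mulRange ρ π = φ.ker := by
      ext y
      obtain ⟨y, rfl⟩ := Ideal.Quotient.mk_surjective y
      rw [hmem π y hp.2.2, AddMonoidHom.mem_ker]
      have : φ (Ideal.Quotient.mk (Ideal.span {g}) y) = Ideal.Quotient.mk (Ideal.span {π}) y := rfl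
      rw [this, Ideal.Quotient.eq_zero_iff_mem, Ideal.mem_span_singleton]
    show (mulRange ρ π).index = _
    rw [hker, AddSubgroup.index_ker, AddMonoidHom.range_eq_top.2 hsur, ← card_quot π hp.1.ne_zero]
    exact Nat.card_congr (AddSubgroup.topEquiv).toEquiv)
  have hcard : (Fintype.card A : ℝ) = (Fintype.card K : ℝ) ^ g.natDegree := by
    rw [← Nat.card_eq_fintype_card, card_quot g hg]; push_cast; rfl
  have htot : polyTotient g = (Finset.univ.filter fun x : A => ∀ i ∈ s, x ∉ mulRange ρ (id i)).card := by
    rw [polyTotient, Nat.card_congr (Equiv.ofBijective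
      (fun u : Aˣ => (⟨u, u.isUnit⟩ : {x : A // IsUnit x}))
      ⟨fun u v h => Units.ext (Subtype.ext_iff.1 h), fun x => ⟨x.2.unit, rfl⟩⟩), Nat.card_eq_fintype_card,
      Fintype.card_subtype]
    congr 1
    ext x
    simp only [Finset.mem_filter, Finset.mem_univ, true_and, id]
    obtain ⟨y, rfl⟩ := Ideal.Quotient.mk_surjective x
    have hu : IsUnit (Ideal.Quotient.mk (Ideal.span {g}) y) ↔ IsCoprime y g := by
      constructor
      · rintro h
        obtain ⟨z, hz⟩ := h.exists_right_inv
        obtain ⟨z, rfl⟩ := Ideal.Quotient.mk_surjective z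
        rw [← map_mul, ← map_one (Ideal.Quotient.mk (Ideal.span {g})), Ideal.Quotient.eq,
          Ideal.mem_span_singleton] at hz
        obtain ⟨w, hw⟩ := hz
        exact ⟨z, -w, by linear_combination hw⟩
      · rintro ⟨a, b, hab⟩
        refine IsUnit.of_mul_eq_one (Ideal.Quotient.mk (Ideal.span {g}) a) ?_
        rw [← map_mul, ← map_one (Ideal.Quotient.mk (Ideal.span {g})), Ideal.Quotient.eq,
          Ideal.mem_span_singleton]
        exact ⟨-b, by linear_combination hab⟩
    rw [hu]
    constructor
    · intro hc π hπ hx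
      have hp := (hs _).1 hπ
      rw [hmem π y hp.2.2] at hx
      exact hp.1.not_isUnit (hc.isUnit_of_dvd' hx hp.2.2)
    · intro h
      refine isCoprime_of_irreducible_dvd (fun h0 => hg h0.2) ?_
      intro z hz hzy hzg
      obtain ⟨π, hπ, hπm, hπd⟩ := exists_monic_irr (h := z) hz.not_isUnit hz.ne_zero
      refine h π ((hs _).2 ⟨hπ, hπm, hπd.trans hzg⟩) ?_
      rw [hmem π y (hπd.trans hzg)]
      exact hπd.trans hzy
  rw [htot, hd, hcard, mul_div_cancel_left₀]
  exact pow_ne_zero _ (by exact_mod_cast Fintype.card_ne_zero)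
end

lemma trace_sieve {K F : Type*} [Field K] [Field F] [Fintype K] [Fintype F] [Algebra K F] (a : K) :
    ∃ c : AddChar F ℂ → ℂ,
      (∀ u : F, (if Algebra.trace K F u = a then (1 : ℂ) else 0) = ∑ η, c η * η u) ∧
      c 1 = ((1 / (Fintype.card K : ℝ) : ℝ) : ℂ) ∧ ∑ η, ‖c η‖ ≤ 1 := by
  have hq : (Fintype.card K : ℂ) ≠ 0 := by exact_mod_cast Fintype.card_ne_zero
  have hq' : (Fintype.card K : ℝ) ≠ 0 := by exact_mod_cast Fintype.card_ne_zero
  have key := L1.sum (Finset.univ : Finset (AddChar K ℂ))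
    (fun ψ (u : F) => (1 / (Fintype.card K : ℂ) * ψ (-a)) *
      (ψ.compAddMonoidHom (Algebra.trace K F).toAddMonoidHom) u)
    (fun ψ => ‖(1 / (Fintype.card K : ℂ) * ψ (-a))‖ * 1)
    (fun ψ _ => (L1.char (ψ.compAddMonoidHom (Algebra.trace K F).toAddMonoidHom)).smul _)
  have key2 : L1 (fun u : F => if Algebra.trace K F u = a then (1 : ℂ) else 0) 1 := by
    refine key.congr (fun u => ?_) (le_of_eq ?_)
    · have h1 : ∀ ψ : AddChar K ℂ, (1 / (Fintype.card K : ℂ) * ψ (-a)) *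
          (ψ.compAddMonoidHom (Algebra.trace K F).toAddMonoidHom) u
          = 1 / (Fintype.card K : ℂ) * ψ (Algebra.trace K F u - a) := by
        intro ψ
        rw [AddChar.compAddMonoidHom_apply, sub_eq_neg_add, AddChar.map_add_eq_mul, mul_assoc]
        rfl
      simp_rw [h1]
      rw [← Finset.mul_sum, AddChar.sum_apply_eq_ite]
      by_cases h : Algebra.trace K F u = a
      · simp [h, hq]
      · simp [h, sub_eq_zero]
    · simp only [norm_mul, AddChar.norm_apply, mul_one]
      rw [Finset.sum_const, Finset.card_univ, AddChar.card_eq]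
      simp [hq']
  obtain ⟨c, hc, hB⟩ := key2
  refine ⟨c, hc, ?_, hB⟩
  have h1 := L1_mean c hc
  rw [Finset.sum_ite, Finset.sum_const_zero, add_zero, Finset.sum_const, nsmul_eq_mul, mul_one] at h1
  have hsur := Algebra.trace_surjective K F
  have hfib : ∀ b : K, (Finset.univ.filter fun u : F => Algebra.trace K F u = b).card
      = (Finset.univ.filter fun u : F => Algebra.trace K F u = a).card := by
    intro b
    exact AddMonoidHom.card_fiber_eq_of_mem_range (Algebra.trace K F).toAddMonoidHom
      (hsur b) (hsur a)
  have hcount : Fintype.card F = Fintype.card K *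
      (Finset.univ.filter fun u : F => Algebra.trace K F u = a).card := by
    rw [← Finset.card_univ (α := F), Finset.card_eq_sum_card_fiberwise
      (f := fun u => Algebra.trace K F u) (t := Finset.univ) (by simp)]
    rw [Finset.sum_congr rfl fun c _ => hfib c]
    rw [Finset.sum_const, Finset.card_univ, smul_eq_mul]
  have h3 : (Fintype.card F : ℂ) ≠ 0 := by exact_mod_cast Fintype.card_ne_zero
  apply mul_right_cancel₀ h3
  rw [h1]
  have h4 : (Fintype.card F : ℂ) = Fintype.card K *
      (Finset.univ.filter fun u : F => Algebra.trace K F u = a).card := by exact_mod_cast hcount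
  rw [h4]
  push_cast
  field_simp

lemma add_param {F : Type*} [Field F] [Fintype F] (p : ℕ) [Fact p.Prime] [CharP F p] [Algebra (ZMod p) F]
    (η : AddChar F ℂ) : ∃ b : F, ∀ x, η x = psi1 p F (b * x) := by
  have hne : psi1 p F ≠ 1 := by
    intro h
    obtain ⟨x, hx⟩ := psi1_ne_one (F := F) p
    rw [h] at hx; simp at hx
  have hinj := AddChar.to_mulShift_inj_of_isPrimitive (AddChar.IsPrimitive.of_ne_one hne)
  have hbij := (Fintype.bijective_iff_injective_and_card
    (AddChar.mulShift (psi1 p F))).2 ⟨hinj, by rw [AddChar.card_eq]⟩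
  obtain ⟨b, hb⟩ := hbij.2 η
  exact ⟨b, fun x => by rw [← hb, AddChar.mulShift_apply]⟩

lemma mult_param (F : Type*) [Field F] [Fintype F] :
    ∃ χ : MulChar F ℂ, (∀ u : F, χ u = 1 → u = 1) ∧
      ∀ η : AddChar (Additive Fˣ) ℂ, ∃ i : ℕ, 0 < i ∧
        (∀ u : Fˣ, η (Additive.ofMul u) = χ (u : F) ^ i) := by
  have hQ1 := Fintype.one_lt_card (α := F)
  set N := Fintype.card F - 1 with hN
  have hNpos : N ≠ 0 := by omega
  obtain ⟨χ, hχ⟩ := MulChar.exists_mulChar_orderOf F (n := N) dvd_rfl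
    (Complex.isPrimitiveRoot_exp N hNpos)
  obtain ⟨g, hg⟩ := IsCyclic.exists_generator (α := Fˣ)
  have hcardU : Nat.card Fˣ = N := by rw [Nat.card_eq_fintype_card, Fintype.card_units]
  have hpow : ∀ u : Fˣ, ∃ k : ℕ, u = g ^ k := by
    intro u
    obtain ⟨k, -, hk⟩ := (IsOfFinOrder.mem_zpowers_iff_mem_range_orderOf (isOfFinOrder_of_finite g)).1 (hg u) |> Finset.mem_image.1
    exact ⟨k, hk.symm⟩
  have hgN : g ^ N = 1 := by rw [← hcardU]; exact pow_card_eq_one'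
  have hprim : IsPrimitiveRoot (χ (g : F)) N := by
    refine ⟨by rw [← map_pow, ← Units.val_pow_eq_pow_val, hgN]; simp, fun k hk => ?_⟩
    rw [← hχ]
    apply orderOf_dvd_of_pow_eq_one
    ext u
    obtain ⟨e, rfl⟩ := hpow u
    rw [MulChar.pow_apply_coe, MulChar.one_apply_coe, Units.val_pow_eq_pow_val, map_pow,
      ← pow_mul, mul_comm, pow_mul, hk, one_pow]
  refine ⟨χ, fun u hu => ?_, fun η => ?_⟩
  · have hu0 : u ≠ 0 := by rintro rfl; rw [MulChar.map_zero] at hu; exact zero_ne_one hu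
    obtain ⟨e, he⟩ := hpow (Units.mk0 u hu0)
    have he' : u = (g : F) ^ e := by
      have := congrArg (fun x : Fˣ => (x : F)) he
      simpa using this
    rw [he', map_pow] at hu
    obtain ⟨k, rfl⟩ := hprim.dvd_of_pow_eq_one e hu
    rw [pow_mul, hgN, one_pow] at he
    have := congrArg (fun x : Fˣ => (x : F)) he
    simpa using this
  · have h1 : η (Additive.ofMul g) ^ N = 1 := by
      rw [← AddChar.map_nsmul_eq_pow, ← ofMul_pow, hgN, ofMul_one, AddChar.map_zero_eq_one]
    have : NeZero N := ⟨hNpos⟩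
    obtain ⟨i, -, hi⟩ := hprim.eq_pow_of_pow_eq_one h1
    refine ⟨i + N, by omega, fun u => ?_⟩
    obtain ⟨e, rfl⟩ := hpow u
    rw [ofMul_pow, AddChar.map_nsmul_eq_pow, ← hi, Units.val_pow_eq_pow_val, map_pow, ← pow_mul,
      ← pow_mul, mul_add, pow_add, mul_comm e i, mul_comm e N, pow_mul _ N, hprim.pow_eq_one,
      one_pow, mul_one]

lemma final_abs {P : Type*} [Fintype P] (P0 : P) (c S : P → ℂ) (N T D B E : ℝ)
    (hN : (N : ℂ) = ∑ x, c x * S x) (h0 : S P0 = T) (hc0 : c P0 = D) (hD : 0 ≤ D)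
    (hB : ∑ x, ‖c x‖ ≤ B) (hE : ∀ x, x ≠ P0 → ‖S x‖ ≤ E) (hE0 : 0 ≤ E) :
    D * T - (B - D) * E ≤ N := by
  rw [← Finset.add_sum_erase _ _ (Finset.mem_univ P0), h0, hc0] at hN
  rw [← Finset.add_sum_erase _ _ (Finset.mem_univ P0), hc0, Complex.norm_real,
    Real.norm_of_nonneg hD] at hB
  have h1 : ‖∑ x ∈ Finset.univ.erase P0, c x * S x‖ ≤ (B - D) * E := by
    calc _ ≤ ∑ x ∈ Finset.univ.erase P0, ‖c x * S x‖ := norm_sum_le _ _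
      _ ≤ ∑ x ∈ Finset.univ.erase P0, ‖c x‖ * E := by
        refine Finset.sum_le_sum fun x hx => ?_
        rw [norm_mul]
        exact mul_le_mul_of_nonneg_left (hE x (Finset.ne_of_mem_erase hx)) (norm_nonneg _)
      _ = (∑ x ∈ Finset.univ.erase P0, ‖c x‖) * E := by rw [Finset.sum_mul]
      _ ≤ _ := mul_le_mul_of_nonneg_right (by linarith) hE0
  have h2 : ∑ x ∈ Finset.univ.erase P0, c x * S x = ((N - D * T : ℝ) : ℂ) := by
    push_cast
    rw [hN]; ring
  rw [h2, Complex.norm_real, Real.norm_eq_abs] at h1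
  have := neg_abs_le (N - D * T)
  linarith

lemma sum_pair {A B R : Type*} [Fintype A] [Fintype B] [CommSemiring R] (f : A → R) (g : B → R) :
    (∑ a, f a) * (∑ b, g b) = ∑ x : A × B, f x.1 * g x.2 := by
  rw [Fintype.sum_mul_sum, Fintype.sum_prod_type]

lemma sum_quad {A B C D X : Type*} [Fintype A] [Fintype B] [Fintype C] [Fintype D] [Fintype X]
    (c1 : A → ℂ) (c2 : B → ℂ) (c3 : C → ℂ) (c4 : D → ℂ)
    (e1 : A → X → ℂ) (e2 : B → X → ℂ) (e3 : C → X → ℂ) (e4 : D → X → ℂ) :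
    ∑ x, (∑ a, c1 a * e1 a x) * (∑ a, c2 a * e2 a x) * (∑ a, c3 a * e3 a x) *
      (∑ a, c4 a * e4 a x) = ∑ P : ((A × B) × C) × D,
        (c1 P.1.1.1 * c2 P.1.1.2 * c3 P.1.2 * c4 P.2) *
        ∑ x, e1 P.1.1.1 x * e2 P.1.1.2 x * e3 P.1.2 x * e4 P.2 x := by
  simp_rw [sum_pair, Finset.mul_sum]
  rw [Finset.sum_comm]
  refine Finset.sum_congr rfl fun P _ => Finset.sum_congr rfl fun x _ => ?_
  ring

lemma norm_quad {A B C D : Type*} [Fintype A] [Fintype B] [Fintype C] [Fintype D]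
    (c1 : A → ℂ) (c2 : B → ℂ) (c3 : C → ℂ) (c4 : D → ℂ) :
    ∑ P : ((A × B) × C) × D, ‖c1 P.1.1.1 * c2 P.1.1.2 * c3 P.1.2 * c4 P.2‖ =
      (∑ a, ‖c1 a‖) * (∑ a, ‖c2 a‖) * (∑ a, ‖c3 a‖) * (∑ a, ‖c4 a‖) := by
  simp_rw [sum_pair, norm_mul]

lemma mult_ext {F : Type*} [Field F] [Fintype F] (χ : MulChar F ℂ) (l : ℕ)
    (i : AddChar (Additive Fˣ) ℂ → ℕ) (hi : ∀ η, 0 < i η)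
    (hχ : ∀ η, ∀ u : Fˣ, η (Additive.ofMul u) = χ (u : F) ^ i η)
    (c : AddChar (Additive Fˣ) ℂ → ℂ)
    (hc : ∀ u : Fˣ, (if IsUFree l (u : F) then (1:ℂ) else 0) = ∑ η, c η * η (Additive.ofMul u))
    (α : F) : (if IsUFree l α then (1:ℂ) else 0) = ∑ η, c η * χ α ^ i η := by
  by_cases h : α = 0
  · subst h
    rw [if_neg (fun h => h.1 rfl)]
    refine (Finset.sum_eq_zero fun η _ => ?_).symm
    rw [MulChar.map_zero, zero_pow (hi η).ne', mul_zero]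
  · have := hc (Units.mk0 α h)
    rw [Units.val_mk0] at this
    rw [this]
    refine Finset.sum_congr rfl fun η _ => ?_
    rw [hχ, Units.val_mk0]

lemma one_of_dvd {F : Type*} [Field F] [Fintype F] (χ : MulChar F ℂ)
    (η : AddChar (Additive Fˣ) ℂ) (i : ℕ)
    (hχ : ∀ u : Fˣ, η (Additive.ofMul u) = χ (u : F) ^ i) (h : Fintype.card F - 1 ∣ i) :
    η = 1 := by
  obtain ⟨k, rfl⟩ := h
  ext u
  have := hχ (Additive.toMul u)
  rw [pow_mul, mulchar_pow_card χ (Units.ne_zero _), one_pow] at this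
  simpa using this

lemma good_count {F : Type*} [Field F] [Fintype F] (f : RatFunc F) (hf0 : f ≠ 0) :
    (Fintype.card F : ℝ) - (f.num.natDegree + f.denom.natDegree + 1 : ℕ) ≤
      ((Finset.univ.filter (fun α : F => α ≠ 0 ∧ RatFunc.eval (RingHom.id F) α f ≠ 0)).card : ℝ) := by
  have hsub : (Finset.univ : Finset F) ⊆
      (Finset.univ.filter (fun α : F => α ≠ 0 ∧ RatFunc.eval (RingHom.id F) α f ≠ 0)) ∪
      (f.num.roots.toFinset ∪ (f.denom.roots.toFinset ∪ {0})) := by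
    intro α _
    simp only [Finset.mem_union, Finset.mem_filter, Finset.mem_univ, true_and, Multiset.mem_toFinset,
      Finset.mem_singleton, mem_roots (RatFunc.num_ne_zero hf0), mem_roots (RatFunc.denom_ne_zero f),
      IsRoot.def]
    by_contra hcon
    push Not at hcon
    obtain ⟨h1, h2, h3, h4⟩ := hcon
    have := h1 h4
    rw [RatFunc.eval, div_eq_zero_iff] at this
    rcases this with h | h
    · exact h2 h
    · exact h3 h
  have h := Finset.card_le_card hsub
  have h1 := Finset.card_union_le (Finset.univ.filter (fun α : F => α ≠ 0 ∧ RatFunc.eval (RingHom.id F) α f ≠ 0))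
      (f.num.roots.toFinset ∪ (f.denom.roots.toFinset ∪ {0}))
  have h2 := Finset.card_union_le f.num.roots.toFinset (f.denom.roots.toFinset ∪ {0})
  have h3 := Finset.card_union_le f.denom.roots.toFinset {0}
  have h4 := (Multiset.toFinset_card_le f.num.roots).trans (card_roots' _)
  have h5 := (Multiset.toFinset_card_le f.denom.roots).trans (card_roots' _)
  rw [Finset.card_singleton] at h3
  rw [Finset.card_univ] at h
  have : Fintype.card F ≤ (Finset.univ.filter (fun α : F => α ≠ 0 ∧ RatFunc.eval (RingHom.id F) α f ≠ 0)).card + (f.num.natDegree + f.denom.natDegree + 1) := by omega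
  have h6 : (Fintype.card F : ℝ) ≤ _ := Nat.cast_le.2 this
  push_cast at h6 ⊢
  linarith

lemma core_bound {K F : Type*} [Field K] [Field F] [Fintype K] [Fintype F] [Algebra K F]
    (p ν m : ℕ) (hp : p.Prime) (hν : Fintype.card F = p ^ ν) (hm : 0 < m)
    (hF : Fintype.card F = Fintype.card K ^ m) (hQ3 : 3 ≤ Fintype.card F)
    (f : RatFunc F) (hf : ¬ ∃ (c : F) (i : ℤ) (h : RatFunc F) (d : ℕ), 1 < d ∧
      d ∣ Fintype.card F - 1 ∧ f = RatFunc.C c * RatFunc.X ^ i * h ^ d) (a : K)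
    (l₁ l₂ : ℕ) (hl₁ : l₁ ∣ Fintype.card F - 1) (hl₂ : l₂ ∣ Fintype.card F - 1)
    (g : K[X]) (hg : g ∣ X ^ m - 1) (s : Finset K[X])
    (hs : ∀ p, p ∈ s ↔ Irreducible p ∧ p.Monic ∧ p ∣ g) (N : ℕ)
    (hN : N = Nat.card {α : F // IsUFree l₁ α ∧ IsGFree (Fintype.card K) g α ∧
      IsUFree l₂ (RatFunc.eval (RingHom.id F) α f) ∧ Algebra.trace K F α⁻¹ = a})
    (θ₁ θ₂ Θ n : ℝ) (hθ₁ : θ₁ = l₁.totient / l₁) (hθ₂ : θ₂ = l₂.totient / l₂)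
    (hΘ : Θ = ∏ π ∈ s, (1 - 1 / ((Fintype.card K ^ π.natDegree : ℕ) : ℝ)))
    (hn : n = (f.num.natDegree + f.denom.natDegree : ℕ)) (hΘ0 : 0 ≤ Θ) :
    θ₁ * θ₂ * Θ / Fintype.card K * ((Fintype.card F : ℝ) - (n + 2) *
      (Fintype.card K * Real.sqrt (Fintype.card F)) * 2 ^ l₁.primeFactors.card *
      2 ^ l₂.primeFactors.card * 2 ^ s.card) ≤ N := by
  have : Fact p.Prime := ⟨hp⟩
  have : CharP F p := charP_of_card_eq_prime_pow hν
  letI : Algebra (ZMod p) F := ZMod.algebra F p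
  have hf0 : f ≠ 0 := by
    rintro rfl
    exact hf ⟨0, 0, 0, Fintype.card F - 1, by omega, dvd_rfl, by simp⟩
  obtain ⟨χ, hχ, hpar⟩ := mult_param F
  choose i hi hiη using hpar
  choose b hb using add_param (F := F) p
  obtain ⟨c1, h1, h1', h1''⟩ := mult_sieve l₁ hl₁
  obtain ⟨c2, h2, h2', h2''⟩ := mult_sieve l₂ hl₂
  obtain ⟨c3, h3, h3', h3''⟩ := add_sieve m hm hF g hg s hs
  obtain ⟨c4, h4, h4', h4''⟩ := trace_sieve (F := F) a
  rw [← hΘ] at h3' h3''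
  rw [← hθ₁] at h1' h1''
  rw [← hθ₂] at h2' h2''
  have hθ₁0 : 0 ≤ θ₁ := by rw [hθ₁]; positivity
  have hθ₂0 : 0 ≤ θ₂ := by rw [hθ₂]; positivity
  have hNsum : ((N : ℝ) : ℂ) = ∑ α : F, (if IsUFree l₁ α then (1:ℂ) else 0) *
      (if IsUFree l₂ (RatFunc.eval (RingHom.id F) α f) then (1:ℂ) else 0) *
      (if IsGFree (Fintype.card K) g α then (1:ℂ) else 0) *
      (if Algebra.trace K F α⁻¹ = a then (1:ℂ) else 0) := by
    rw [hN, Nat.card_eq_fintype_card, Fintype.card_subtype, Complex.ofReal_natCast,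
      Finset.natCast_card_filter]
    refine Finset.sum_congr rfl fun α _ => ?_
    by_cases e1 : IsUFree l₁ α <;> by_cases e2 : IsGFree (Fintype.card K) g α <;>
      by_cases e3 : IsUFree l₂ (RatFunc.eval (RingHom.id F) α f) <;>
      by_cases e4 : Algebra.trace K F α⁻¹ = a <;> simp only [e1, e2, e3, e4] <;> simp
  have hNsum2 : ((N : ℝ) : ℂ) = ∑ α : F, (∑ η, c1 η * χ α ^ i η) *
      (∑ η, c2 η * χ (RatFunc.eval (RingHom.id F) α f) ^ i η) *
      (∑ η, c3 η * η α) * (∑ η, c4 η * η α⁻¹) := by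
    rw [hNsum]
    refine Finset.sum_congr rfl fun α _ => ?_
    rw [mult_ext χ l₁ i hi hiη c1 h1, mult_ext χ l₂ i hi hiη c2 h2, h3, h4]
  rw [sum_quad c1 c2 c3 c4 (fun η α => χ α ^ i η)
    (fun η α => χ (RatFunc.eval (RingHom.id F) α f) ^ i η) (fun η α => η α) (fun η α => η α⁻¹)]
    at hNsum2
  have hsq : 1 ≤ Real.sqrt (Fintype.card F) := by
    rw [Real.one_le_sqrt]; exact_mod_cast (by omega : 1 ≤ Fintype.card F)
  have hn0 : 0 ≤ n := by rw [hn]; positivity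
  have hKpos : (0:ℝ) < Fintype.card K := by exact_mod_cast Fintype.card_pos
  have hD : 0 ≤ θ₁ * θ₂ * Θ * (1 / Fintype.card K) := by positivity
  set T : ℝ := ((Finset.univ.filter (fun α : F => α ≠ 0 ∧
    RatFunc.eval (RingHom.id F) α f ≠ 0)).card : ℝ) with hT
  have key := final_abs (((1, 1), 1), 1) _ _ N T (θ₁ * θ₂ * Θ * (1 / Fintype.card K))
    ((θ₁ * 2 ^ l₁.primeFactors.card) * (θ₂ * 2 ^ l₂.primeFactors.card) * (Θ * 2 ^ s.card) * 1)
    ((n + 2) * Real.sqrt (Fintype.card F)) hNsum2 ?_ ?_ hD ?_ ?_ (by positivity)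
  · have hT' := good_count f hf0
    rw [← hT] at hT'
    have hT'' : (Fintype.card F : ℝ) - (n + 1) ≤ T := by
      rw [hn]; push_cast at hT' ⊢; linarith
    have hge : (Fintype.card F : ℝ) ≤ T + (n + 2) * Real.sqrt (Fintype.card F) := by
      nlinarith
    have := mul_le_mul_of_nonneg_left hge hD
    refine le_trans (le_of_eq ?_) ((sub_le_sub_right this ((θ₁ * 2 ^ l₁.primeFactors.card) * (θ₂ * 2 ^ l₂.primeFactors.card) * (Θ * 2 ^ s.card) * ((n + 2) * Real.sqrt (Fintype.card F)))).trans (le_trans (le_of_eq ?_) key))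
    · field_simp
    · ring
  · have hone : ∀ u : Fˣ, χ (u : F) ^ i 1 = 1 := fun u => by
      rw [← hiη 1 u]; simp
    have hone' : ∀ x : F, χ x ^ i 1 = if x ≠ 0 then 1 else 0 := by
      intro x
      split_ifs with hx
      · exact hone (Units.mk0 x hx)
      · rw [not_not.1 hx, MulChar.map_zero, zero_pow (hi 1).ne']
    simp only [hone', AddChar.one_apply, mul_one]
    rw [hT, Complex.ofReal_natCast, Finset.natCast_card_filter]
    refine Finset.sum_congr rfl fun α _ => ?_
    by_cases e1 : α = 0 <;> by_cases e2 : RatFunc.eval (RingHom.id F) α f = 0 <;>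
      simp [e1, e2]
  · simp only [h1', h2', h3', h4']
    push_cast; ring
  · rw [norm_quad]
    have n1 : 0 ≤ ∑ η, ‖c1 η‖ := by positivity
    have n2 : 0 ≤ ∑ η, ‖c2 η‖ := by positivity
    have n3 : 0 ≤ ∑ η, ‖c3 η‖ := by positivity
    have n4 : 0 ≤ ∑ η, ‖c4 η‖ := by positivity
    gcongr
  · rintro ⟨⟨⟨η1, η2⟩, η3⟩, η4⟩ hne
    have hw := weil_main p ν hν χ hχ hQ3 f hf0 hf (i η1) (i η2) (hi _) (hi _) (b η3) (b η4) ?_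
    · refine le_trans (le_of_eq ?_) (hw.trans (le_of_eq ?_))
      · congr 1
        refine Finset.sum_congr rfl fun α _ => ?_
        rw [AddChar.map_add_eq_mul, ← hb, ← hb]
        ring
      · rw [hn]; push_cast; ring
    · by_contra hcon
      push Not at hcon
      obtain ⟨⟨hb3, hb4⟩, hd1, hd2⟩ := hcon
      apply hne
      have e3 : η3 = 1 := by ext x; rw [hb, hb3]; simp
      have e4 : η4 = 1 := by ext x; rw [hb, hb4]; simp
      rw [e3, e4, one_of_dvd χ η1 _ (hiη η1) hd1, one_of_dvd χ η2 _ (hiη η2) hd2]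

/-- The basic lower bound
`N(l₁,l₂,g) ≥ (θ(l₁)θ(l₂)Θ(g)/q)·(q^m − (n+2)·q^{m/2+1}·W(l₁)W(l₂)W(g))`, and consequently
`q^{m/2−1} > (n+2)·W(l₁)W(l₂)W(g)` implies `N(l₁,l₂,g) > 0`. -/
theorem Ncount_lower_bound {K F : Type*} [Field K] [DecidableEq K] [Field F]
    [Fintype K] [Fintype F] [Algebra K F]
    (q m n : ℕ) (p t : ℕ) (hp : p.Prime) (hq : q = p ^ t) (ht : 0 < t)
    (hm : 3 ≤ m) (hn : 0 < n) (hK : Fintype.card K = q) (hF : Fintype.card F = q ^ m)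
    (f : RatFunc F) (hf : ¬ ExceptionalRatFunc f)
    (hdeg : f.num.natDegree + f.denom.natDegree = n) (a : K)
    (l₁ l₂ : ℕ) (hl₁ : l₁ ∣ q ^ m - 1) (hl₂ : l₂ ∣ q ^ m - 1)
    (g : K[X]) (hg : g ∣ X ^ m - 1) :
    ((Ncount q f a l₁ l₂ g : ℝ) ≥
      ((l₁.totient : ℝ) / l₁) * ((l₂.totient : ℝ) / l₂) *
        ((polyTotient g : ℝ) / (q : ℝ) ^ g.natDegree) / q *
        ((q : ℝ) ^ m - (n + 2) * (q : ℝ) ^ ((m : ℝ) / 2 + 1) *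
          2 ^ l₁.primeFactors.card * 2 ^ l₂.primeFactors.card *
          2 ^ (normalizedFactors g).toFinset.card)) ∧
    ((q : ℝ) ^ ((m : ℝ) / 2 - 1) >
        (n + 2) * 2 ^ l₁.primeFactors.card * 2 ^ l₂.primeFactors.card *
          2 ^ (normalizedFactors g).toFinset.card →
      0 < Ncount q f a l₁ l₂ g) := by
  subst hK
  have hg0 : g ≠ 0 := by
    rintro rfl
    rw [zero_dvd_iff] at hg
    exact X_pow_sub_C_ne_zero (by omega : 0 < m) (1 : K) (by rw [map_one]; exact hg)
  have hs : ∀ r : K[X], r ∈ (normalizedFactors g).toFinset ↔ Irreducible r ∧ r.Monic ∧ r ∣ g := by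
    intro r
    rw [Multiset.mem_toFinset]
    exact Polynomial.mem_normalizedFactors_iff hg0
  have hq2 : 2 ≤ Fintype.card K := Fintype.one_lt_card (α := K)
  have hQ8 : 8 ≤ Fintype.card F := by
    rw [hF]
    calc 8 = 2 ^ 3 := by norm_num
      _ ≤ 2 ^ m := Nat.pow_le_pow_right (by norm_num) hm
      _ ≤ _ := Nat.pow_le_pow_left hq2 m
  have hl₁' := hl₁
  have hl₂' := hl₂
  rw [← hF] at hl₁' hl₂'
  have hl₁0 : 0 < l₁ := Nat.pos_of_dvd_of_pos hl₁' (by omega)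
  have hl₂0 : 0 < l₂ := Nat.pos_of_dvd_of_pos hl₂' (by omega)
  have hΘ := polyTotient_div g hg0 _ hs
  have hqr : (2 : ℝ) ≤ Fintype.card K := by exact_mod_cast hq2
  have hqr0 : (0 : ℝ) < Fintype.card K := by linarith
  have hΘpos : 0 < (polyTotient g : ℝ) / (Fintype.card K : ℝ) ^ g.natDegree := by
    rw [hΘ]
    refine Finset.prod_pos fun r hr => ?_
    have hd := ((hs r).1 hr).1.natDegree_pos
    have h1 : 1 < Fintype.card K ^ r.natDegree := Nat.one_lt_pow hd.ne' (by omega)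
    have h2 : (1 : ℝ) < ((Fintype.card K ^ r.natDegree : ℕ) : ℝ) := by exact_mod_cast h1
    rw [sub_pos, div_lt_one (by linarith)]
    exact h2
  have hmain := core_bound p (t * m) m hp (by rw [hF, hq, pow_mul]) (by omega) hF (by omega) f
    (fun h => hf (Or.inl h)) a l₁ l₂ hl₁' hl₂' g hg _ hs (Ncount (Fintype.card K) f a l₁ l₂ g) rfl
    _ _ _ (n : ℝ) rfl rfl hΘ (by rw [hdeg]) hΘpos.le
  have hsq : (Fintype.card K : ℝ) * Real.sqrt (Fintype.card F) =
      (Fintype.card K : ℝ) ^ ((m : ℝ) / 2 + 1) := by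
    rw [Real.rpow_add_one hqr0.ne', hF, Real.sqrt_eq_rpow, Nat.cast_pow, ← Real.rpow_natCast,
      ← Real.rpow_mul hqr0.le, mul_comm, mul_one_div]
  rw [hsq, hF, Nat.cast_pow] at hmain
  refine ⟨hmain, fun hgt => ?_⟩
  have hθ₁ : (0 : ℝ) < (l₁.totient : ℝ) / l₁ :=
    div_pos (by exact_mod_cast Nat.totient_pos.2 hl₁0) (by exact_mod_cast hl₁0)
  have hθ₂ : (0 : ℝ) < (l₂.totient : ℝ) / l₂ :=
    div_pos (by exact_mod_cast Nat.totient_pos.2 hl₂0) (by exact_mod_cast hl₂0)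
  have hpw : (0 : ℝ) < (Fintype.card K : ℝ) ^ ((m : ℝ) / 2 + 1) := Real.rpow_pos_of_pos hqr0 _
  have hprod : (Fintype.card K : ℝ) ^ ((m : ℝ) / 2 + 1) * (Fintype.card K : ℝ) ^ ((m : ℝ) / 2 - 1)
      = (Fintype.card K : ℝ) ^ m := by
    rw [← Real.rpow_add hqr0, ← Real.rpow_natCast]
    congr 1
    ring
  have hmul := mul_lt_mul_of_pos_left hgt hpw
  rw [hprod] at hmul
  have hpos : (0 : ℝ) < Ncount (Fintype.card K) f a l₁ l₂ g := by
    refine lt_of_lt_of_le ?_ hmain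
    refine mul_pos (by positivity) ?_
    rw [sub_pos]
    refine lt_of_le_of_lt (le_of_eq ?_) hmul
    ring
  exact_mod_cast hpos
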